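/- Assume additionally r > 0, q ≥ 0, β ≥ 1, and that Γ₁ satisfies the exterior sphere condition. Let α ∈ (0,1), let f ∈ C^α(O) obey the elliptic growth condition, and let g be continuous on cl(Γ₁) and obey the elliptic growth condition. Then there exists a function u, continuous on O ∪ Γ₁ and belonging to C^{2+α}(O), which obeys the elliptic growth condition on O and satisfies A u = f on O and u = g on Γ₁. -/

import Mathlib

open Real Set MeasureTheory

noncomputable section

/-- First directional derivative of `u` at `z` in direction `v`. -/
def D1 (u : ℝ × ℝ → ℝ) (z v : ℝ × ℝ) : ℝ := fderiv ℝ u z v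

/-- Second directional derivative of `u` at `z` in directions `v`, `w`. -/
def D2 (u : ℝ × ℝ → ℝ) (z v w : ℝ × ℝ) : ℝ := fderiv ℝ (fun z' => fderiv ℝ u z' v) z w

/-- The elliptic Heston operator
`(Au)(x,y) = −(y/2)(u_xx + 2ρσ u_xy + σ² u_yy) − (r − q − y/2) u_x − κ(θ − y) u_y + r u`. -/
def hestonA (σ ρ κ θ q r : ℝ) (u : ℝ × ℝ → ℝ) (z : ℝ × ℝ) : ℝ :=
  -(z.2 / 2) * (D2 u z (1, 0) (1, 0) + 2 * ρ * σ * D2 u z (1, 0) (0, 1)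
      + σ ^ 2 * D2 u z (0, 1) (0, 1))
    - (r - q - z.2 / 2) * D1 u z (1, 0) - κ * (θ - z.2) * D1 u z (0, 1) + r * u z

/-- The open upper half-plane `ℍ = ℝ × (0,∞)`. -/
def HH : Set (ℝ × ℝ) := {z | 0 < z.2}

/-- `Γ₁ = ∂O ∩ ℍ`. -/
def Gamma1 (O : Set (ℝ × ℝ)) : Set (ℝ × ℝ) := frontier O ∩ HH

/-- `Γ₀`: the interior, relative to `∂ℍ = ℝ × {0}`, of `∂ℍ ∩ ∂O`. -/
def Gamma0 (O : Set (ℝ × ℝ)) : Set (ℝ × ℝ) :=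
  {z | z.2 = 0 ∧ z.1 ∈ interior {x : ℝ | (x, (0 : ℝ)) ∈ frontier O}}

/-- The elliptic growth condition: `|v(x,y)| ≤ C (1 + e^{M₁ y} + e^{M₂ x})` on `S`,
with `0 ≤ M₁ < min (r/(κθ)) μ`, `μ = 2κ/σ²`, and `M₂ ∈ [0,1)`. -/
def ellGrowth (σ κ θ r : ℝ) (S : Set (ℝ × ℝ)) (v : ℝ × ℝ → ℝ) : Prop :=
  ∃ C M₁ M₂ : ℝ, 0 < C ∧ 0 ≤ M₁ ∧ M₁ < min (r / (κ * θ)) (2 * κ / σ ^ 2) ∧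
    0 ≤ M₂ ∧ M₂ < 1 ∧ ∀ z ∈ S, |v z| ≤ C * (1 + exp (M₁ * z.2) + exp (M₂ * z.1))

/-- `v` is uniformly `α`-Hölder continuous on `S`. -/
def holderOn (α : ℝ) (S : Set (ℝ × ℝ)) (v : ℝ × ℝ → ℝ) : Prop :=
  ∃ C : ℝ, ∀ z ∈ S, ∀ w ∈ S, |v z - v w| ≤ C * dist z w ^ α

/-- `v` is locally `α`-Hölder continuous on `S` (Hölder on every compact subset). -/
def locHolderOn (α : ℝ) (S : Set (ℝ × ℝ)) (v : ℝ × ℝ → ℝ) : Prop :=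
  ∀ K : Set (ℝ × ℝ), IsCompact K → K ⊆ S → holderOn α K v

/-- `u ∈ C^{2+α}(O)`: twice continuously differentiable on the open set `O` with all
derivatives through order two locally `α`-Hölder continuous on `O`. -/
def C2alphaOn (α : ℝ) (O : Set (ℝ × ℝ)) (u : ℝ × ℝ → ℝ) : Prop :=
  ContDiffOn ℝ 2 u O ∧ locHolderOn α O u ∧
  (∀ v, locHolderOn α O fun z => D1 u z v) ∧
  (∀ v w, locHolderOn α O fun z => D2 u z v w)

/-- The boundary portion `Γ` of `O` satisfies the exterior sphere condition: for every
`z₀ ∈ Γ` there is a closed Euclidean ball meeting `cl(O)` exactly at `z₀`. -/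
def extSphere (O Γ : Set (ℝ × ℝ)) : Prop :=
  ∀ z₀ ∈ Γ, ∃ c : ℝ × ℝ, ∃ R : ℝ, 0 < R ∧
    {z : ℝ × ℝ | Real.sqrt ((z.1 - c.1) ^ 2 + (z.2 - c.2) ^ 2) ≤ R} ∩ closure O = {z₀}

section HestonHelpers
open scoped ContDiff Topology

/-- Directional derivative as an operator on functions. -/
def dd (v : ℝ × ℝ) (u : ℝ × ℝ → ℝ) : ℝ × ℝ → ℝ := fun z => fderiv ℝ u z v
/-- derivative in the first variable -/
abbrev dx (u : ℝ × ℝ → ℝ) : ℝ × ℝ → ℝ := dd (1, 0) u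
/-- derivative in the second variable -/
abbrev dy (u : ℝ × ℝ → ℝ) : ℝ × ℝ → ℝ := dd (0, 1) u

/-- the constant coefficient principal part -/
def PP (σ ρ : ℝ) (u : ℝ × ℝ → ℝ) (z : ℝ × ℝ) : ℝ :=
  dx (dx u) z + 2 * ρ * σ * dy (dx u) z + σ ^ 2 * dy (dy u) z

theorem hestonA_eq (σ ρ κ θ q r : ℝ) (u : ℝ × ℝ → ℝ) (z : ℝ × ℝ) :
    hestonA σ ρ κ θ q r u z = -(z.2 / 2) * PP σ ρ u z
      - (r - q - z.2 / 2) * dx u z - κ * (θ - z.2) * dy u z + r * u z := rfl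

theorem dd_contDiff {v : ℝ × ℝ} {u : ℝ × ℝ → ℝ} (hu : ContDiff ℝ ∞ u) : ContDiff ℝ ∞ (dd v u) := by
  have h : ContDiff ℝ ∞ (fderiv ℝ u) := hu.fderiv_right (by simp)
  exact h.clm_apply contDiff_const

attribute [fun_prop] dd_contDiff

@[fun_prop] theorem dd_differentiable {v : ℝ × ℝ} {u : ℝ × ℝ → ℝ} (hu : ContDiff ℝ ∞ u) :
    Differentiable ℝ (dd v u) := (dd_contDiff hu).differentiable (by simp)

@[fun_prop] theorem dd_continuous {v : ℝ × ℝ} {u : ℝ × ℝ → ℝ} (hu : ContDiff ℝ ∞ u) :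
    Continuous (dd v u) := (dd_contDiff hu).continuous

theorem smooth_diff {u : ℝ × ℝ → ℝ} (hu : ContDiff ℝ ∞ u) : Differentiable ℝ u :=
  hu.differentiable (by simp)

theorem dd_add {v : ℝ × ℝ} {f g : ℝ × ℝ → ℝ} {z : ℝ × ℝ} (hf : DifferentiableAt ℝ f z)
    (hg : DifferentiableAt ℝ g z) : dd v (fun z => f z + g z) z = dd v f z + dd v g z := by
  simp only [dd]; rw [fderiv_fun_add hf hg]; rfl

theorem dd_sub {v : ℝ × ℝ} {f g : ℝ × ℝ → ℝ} {z : ℝ × ℝ} (hf : DifferentiableAt ℝ f z)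
    (hg : DifferentiableAt ℝ g z) : dd v (fun z => f z - g z) z = dd v f z - dd v g z := by
  simp only [dd]; rw [fderiv_fun_sub hf hg]; rfl

theorem dd_mul {v : ℝ × ℝ} {f g : ℝ × ℝ → ℝ} {z : ℝ × ℝ} (hf : DifferentiableAt ℝ f z)
    (hg : DifferentiableAt ℝ g z) :
    dd v (fun z => f z * g z) z = dd v f z * g z + f z * dd v g z := by
  simp only [dd]; rw [fderiv_fun_mul hf hg]; simp; ring

theorem dd_const_mul {v : ℝ × ℝ} {g : ℝ × ℝ → ℝ} {z : ℝ × ℝ} (c : ℝ)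
    (hg : DifferentiableAt ℝ g z) : dd v (fun z => c * g z) z = c * dd v g z := by
  simp only [dd]; rw [fderiv_const_mul hg]; simp

theorem dd_const {v : ℝ × ℝ} {z : ℝ × ℝ} (c : ℝ) : dd v (fun _ => c) z = 0 := by
  simp [dd]

theorem dd_neg {v : ℝ × ℝ} {g : ℝ × ℝ → ℝ} {z : ℝ × ℝ} :
    dd v (fun z => - g z) z = - dd v g z := by
  simp only [dd]; rw [fderiv_fun_neg]; rfl

theorem dd_comp {v : ℝ × ℝ} {b : ℝ → ℝ} {b' : ℝ} {g : ℝ × ℝ → ℝ} {z : ℝ × ℝ}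
    (hb : HasDerivAt b b' (g z)) (hg : DifferentiableAt ℝ g z) :
    dd v (fun z => b (g z)) z = b' * dd v g z := by
  have := (hb.comp_hasFDerivAt z hg.hasFDerivAt).fderiv
  simp only [dd]
  change fderiv ℝ (b ∘ g) z v = _
  rw [this]; simp

theorem dx_fst (z : ℝ × ℝ) : dx (fun z => z.1) z = 1 := by
  simp only [dx, dd]; rw [show (fun z : ℝ × ℝ => z.1) = (ContinuousLinearMap.fst ℝ ℝ ℝ) from rfl]
  rw [ContinuousLinearMap.fderiv]; simp
theorem dx_snd (z : ℝ × ℝ) : dx (fun z => z.2) z = 0 := by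
  simp only [dx, dd]; rw [show (fun z : ℝ × ℝ => z.2) = (ContinuousLinearMap.snd ℝ ℝ ℝ) from rfl]
  rw [ContinuousLinearMap.fderiv]; simp
theorem dy_fst (z : ℝ × ℝ) : dy (fun z => z.1) z = 0 := by
  simp only [dy, dd]; rw [show (fun z : ℝ × ℝ => z.1) = (ContinuousLinearMap.fst ℝ ℝ ℝ) from rfl]
  rw [ContinuousLinearMap.fderiv]; simp
theorem dy_snd (z : ℝ × ℝ) : dy (fun z => z.2) z = 1 := by
  simp only [dy, dd]; rw [show (fun z : ℝ × ℝ => z.2) = (ContinuousLinearMap.snd ℝ ℝ ℝ) from rfl]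
  rw [ContinuousLinearMap.fderiv]; simp

theorem dd_congr {v : ℝ × ℝ} {f g : ℝ × ℝ → ℝ} {z : ℝ × ℝ} (h : f =ᶠ[𝓝 z] g) :
    dd v f z = dd v g z := by
  simp only [dd]; rw [h.fderiv_eq]

theorem dd_congr' {v : ℝ × ℝ} {f g : ℝ × ℝ → ℝ} {z : ℝ × ℝ} (h : f =ᶠ[𝓝 z] g) :
    dd v f =ᶠ[𝓝 z] dd v g := by
  filter_upwards [h.eventuallyEq_nhds] with w hw using dd_congr hw

theorem dd_tsupport {v : ℝ × ℝ} {f : ℝ × ℝ → ℝ} : tsupport (dd v f) ⊆ tsupport f :=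
  tsupport_fderiv_apply_subset ℝ v

theorem dd_compact {v : ℝ × ℝ} {f : ℝ × ℝ → ℝ} (hf : HasCompactSupport f) :
    HasCompactSupport (dd v f) := hf.fderiv_apply ℝ v

/-- symmetric second derivatives -/
theorem dd_comm {v w : ℝ × ℝ} {f : ℝ × ℝ → ℝ} {z : ℝ × ℝ} (hf : ContDiffAt ℝ 2 f z) :
    dd v (dd w f) z = dd w (dd v f) z := by
  have hs : IsSymmSndFDerivAt ℝ f z := hf.isSymmSndFDerivAt (by simp)
  have hd : DifferentiableAt ℝ (fderiv ℝ f) z :=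
    (hf.fderiv_right (m := 1) (by norm_num)).differentiableAt (by simp)
  have key : ∀ a b : ℝ × ℝ, dd a (dd b f) z = fderiv ℝ (fderiv ℝ f) z a b := by
    intro a b
    change fderiv ℝ (fun y => fderiv ℝ f y b) z a = _
    rw [fderiv_clm_apply hd (differentiableAt_const _)]
    simp
  rw [key, key]; exact hs v w

/-- integration by parts -/
theorem ibp {v : ℝ × ℝ} {f g : ℝ × ℝ → ℝ} (hf : ContDiff ℝ 1 f) (hg : ContDiff ℝ 1 g)
    (hgc : HasCompactSupport g) : ∫ z, f z * dd v g z = - ∫ z, dd v f z * g z := by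
  have cf : Continuous (dd v f) := (hf.continuous_fderiv (by simp)).clm_apply continuous_const
  have cg : Continuous (dd v g) := (hg.continuous_fderiv (by simp)).clm_apply continuous_const
  apply integral_mul_fderiv_eq_neg_fderiv_mul_of_integrable
  · exact (cf.mul hg.continuous).integrable_of_hasCompactSupport hgc.mul_left
  · exact (hf.continuous.mul cg).integrable_of_hasCompactSupport (dd_compact hgc).mul_left
  · exact (hf.continuous.mul hg.continuous).integrable_of_hasCompactSupport hgc.mul_left
  · exact fun x _ => hf.differentiable (by simp) x
  · exact fun x _ => hg.differentiable (by simp) x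

/-- the formal adjoint of the Heston operator -/
def Ast (σ ρ κ θ q r : ℝ) (u : ℝ × ℝ → ℝ) (z : ℝ × ℝ) : ℝ :=
  -(z.2 / 2) * PP σ ρ u z + (r - q - z.2 / 2 - ρ * σ) * dx u z
    + (κ * (θ - z.2) - σ ^ 2) * dy u z + (r - κ) * u z

theorem integral_dd_zero {v : ℝ × ℝ} {g : ℝ × ℝ → ℝ} (hg : ContDiff ℝ ∞ g)
    (hgc : HasCompactSupport g) : ∫ z, dd v g z = 0 := by
  have := ibp (v := v) (f := fun _ => 1) contDiff_const (hg.of_le (by simp)) hgc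
  simpa [dd_const] using this

theorem smooth_fst : ContDiff ℝ ∞ (fun z : ℝ × ℝ => z.1) := contDiff_fst
theorem smooth_snd : ContDiff ℝ ∞ (fun z : ℝ × ℝ => z.2) := contDiff_snd

theorem integral_adj (σ ρ κ θ q r : ℝ) {w φ : ℝ × ℝ → ℝ} (hw : ContDiff ℝ ∞ w)
    (hφ : ContDiff ℝ ∞ φ) (hc : HasCompactSupport φ) :
    ∫ z, w z * Ast σ ρ κ θ q r φ z = ∫ z, hestonA σ ρ κ θ q r w z * φ z := by
  have hwd := smooth_diff hw
  have hφd := smooth_diff hφ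
  have hcx : HasCompactSupport (dd (1, 0) φ) := dd_compact hc
  have hcy : HasCompactSupport (dd (0, 1) φ) := dd_compact hc
  have hcxx : HasCompactSupport (dd (1, 0) (dd (1, 0) φ)) := dd_compact hcx
  have hcxy : HasCompactSupport (dd (0, 1) (dd (1, 0) φ)) := dd_compact hcx
  have hcyy : HasCompactSupport (dd (0, 1) (dd (0, 1) φ)) := dd_compact hcy
  set G1 : ℝ × ℝ → ℝ := fun z => (-(1 / 2) * (z.2 * w z)) * dx φ z
    + ((1 / 2) * (z.2 * dx w z) + ρ * σ * (z.2 * dy w z) + (r - q - (1/2) * z.2) * w z) * φ z with hG1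
  set G2 : ℝ × ℝ → ℝ := fun z => (-(ρ * σ) * (z.2 * w z)) * dx φ z
    + (-(σ ^ 2 / 2) * (z.2 * w z)) * dy φ z
    + ((σ ^ 2 / 2) * (z.2 * dy w z) + (κ * (θ - z.2) - σ ^ 2 / 2) * w z) * φ z with hG2
  have s1 : ContDiff ℝ ∞ G1 := by fun_prop
  have s2 : ContDiff ℝ ∞ G2 := by fun_prop
  have c1 : HasCompactSupport G1 := hcx.mul_left.add hc.mul_left
  have c2 : HasCompactSupport G2 := (hcx.mul_left.add hcy.mul_left).add hc.mul_left
  have key : ∀ z, w z * Ast σ ρ κ θ q r φ z - hestonA σ ρ κ θ q r w z * φ z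
      = dd (1, 0) G1 z + dd (0, 1) G2 z := by
    intro z
    have hxy : dd (1, 0) (dd (0, 1) w) z = dd (0, 1) (dd (1, 0) w) z :=
      dd_comm (contDiff_infty.1 hw 2).contDiffAt
    simp only [hG1, hG2]
    simp (disch := fun_prop) only [dd_add, dd_sub, dd_mul, dd_const, dx_snd, dy_snd]
    rw [hestonA_eq, Ast, PP, PP, hxy]
    ring
  have i1 : Integrable (fun z => w z * Ast σ ρ κ θ q r φ z) := by
    apply Continuous.integrable_of_hasCompactSupport
    · simp only [Ast, PP]; fun_prop
    · apply HasCompactSupport.mul_left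
      exact (((hcxx.add hcxy.mul_left).add hcyy.mul_left).mul_left.add hcx.mul_left
        |>.add hcy.mul_left |>.add hc.mul_left)
  have i2 : Integrable (fun z => hestonA σ ρ κ θ q r w z * φ z) := by
    apply Continuous.integrable_of_hasCompactSupport
    · simp only [hestonA_eq, PP]; fun_prop
    · exact hc.mul_left
  have j1 : Integrable (dd (1, 0) G1) :=
    (dd_continuous s1).integrable_of_hasCompactSupport (dd_compact c1)
  have j2 : Integrable (dd (0, 1) G2) :=
    (dd_continuous s2).integrable_of_hasCompactSupport (dd_compact c2)
  rw [← sub_eq_zero, ← integral_sub i1 i2, integral_congr_ae (Filter.Eventually.of_forall key),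
    integral_add j1 j2, integral_dd_zero s1 c1, integral_dd_zero s2 c2, add_zero]

/-- smooth cutoff functions -/
theorem exists_cutoff {K O : Set (ℝ × ℝ)} (hK : IsCompact K) (hO : IsOpen O) (hKO : K ⊆ O) :
    ∃ χ : ℝ × ℝ → ℝ, ContDiff ℝ ∞ χ ∧ HasCompactSupport χ ∧ tsupport χ ⊆ O ∧
      (∀ z, 0 ≤ χ z) ∧ (∀ᶠ z in 𝓝ˢ K, χ z = 1) := by
  obtain ⟨L, hL, hKL, hLO⟩ := exists_compact_between hK hO hKO
  obtain ⟨L', hL', hKL', hLO'⟩ := exists_compact_between hK isOpen_interior hKL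
  obtain ⟨f, h1, h0, h01⟩ := exists_contMDiffMap_one_nhds_of_subset_interior
    (modelWithCornersSelf ℝ (ℝ × ℝ)) (n := (⊤ : ℕ∞)) hK.isClosed hKL'
  have hsup : tsupport (f : ℝ × ℝ → ℝ) ⊆ L := by
    refine closure_minimal ?_ hL.isClosed
    intro z hz
    by_contra hzL
    exact hz (h0 z fun h => hzL (interior_subset (hLO' h)))
  refine ⟨f, f.contMDiff.contDiff, HasCompactSupport.of_support_subset_isCompact hL
    ((subset_tsupport _).trans hsup), hsup.trans hLO, fun z => (h01 z).1, h1⟩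

theorem cont_mul {f φ : ℝ × ℝ → ℝ} {O : Set (ℝ × ℝ)} (hO : IsOpen O) (hf : ContinuousOn f O)
    (hφ : Continuous φ) (hs : tsupport φ ⊆ O) : Continuous (fun z => f z * φ z) :=
  (hf.mul hφ.continuousOn).continuous_of_tsupport_subset hO ((tsupport_mul_subset_right).trans hs)

/-- smoothed positive part -/
def bet (ε t : ℝ) : ℝ := (t + √(t ^ 2 + ε ^ 2)) / 2
/-- first derivative of `bet` -/
def bet1 (ε t : ℝ) : ℝ := (1 + t / √(t ^ 2 + ε ^ 2)) / 2
/-- second derivative of `bet` -/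
def bet2 (ε t : ℝ) : ℝ := (ε ^ 2 / (√(t ^ 2 + ε ^ 2)) ^ 3) / 2

theorem sq_pos_aux {ε : ℝ} (hε : 0 < ε) (t : ℝ) : 0 < t ^ 2 + ε ^ 2 := by positivity

theorem bet_deriv {ε : ℝ} (hε : 0 < ε) (t : ℝ) : HasDerivAt (bet ε) (bet1 ε t) t := by
  have h0 := sq_pos_aux hε t
  have h1 : HasDerivAt (fun t : ℝ => t ^ 2 + ε ^ 2) (2 * t) t := by
    simpa using (hasDerivAt_pow 2 t).add_const (ε ^ 2)
  have h2 := h1.sqrt h0.ne'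
  have h3 := ((hasDerivAt_id t).add h2).div_const 2
  refine h3.congr_deriv ?_
  have : 0 < √(t ^ 2 + ε ^ 2) := Real.sqrt_pos.2 h0
  simp only [bet1]; field_simp

theorem bet1_deriv {ε : ℝ} (hε : 0 < ε) (t : ℝ) : HasDerivAt (bet1 ε) (bet2 ε t) t := by
  have h0 := sq_pos_aux hε t
  have h1 : HasDerivAt (fun t : ℝ => t ^ 2 + ε ^ 2) (2 * t) t := by
    simpa using (hasDerivAt_pow 2 t).add_const (ε ^ 2)
  have h2 := h1.sqrt h0.ne'
  have hp : 0 < √(t ^ 2 + ε ^ 2) := Real.sqrt_pos.2 h0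
  have h3 := (((hasDerivAt_id t).div h2 hp.ne').const_add 1).div_const 2
  refine h3.congr_deriv ?_
  have hs : √(t ^ 2 + ε ^ 2) ^ 2 = t ^ 2 + ε ^ 2 := Real.sq_sqrt h0.le
  simp only [bet2, id]
  generalize √(t ^ 2 + ε ^ 2) = s at *
  have he : ε ^ 2 = s ^ 2 - t ^ 2 := by linarith
  rw [he]; field_simp

theorem bet_smooth {ε : ℝ} (hε : 0 < ε) : ContDiff ℝ ∞ (bet ε) := by
  unfold bet
  have : ContDiff ℝ ∞ (fun t : ℝ => √(t ^ 2 + ε ^ 2)) := by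
    apply ContDiff.sqrt (by fun_prop)
    intro t; exact (sq_pos_aux hε t).ne'
  fun_prop

theorem bet_facts {ε : ℝ} (hε : 0 < ε) (t : ℝ) : 0 ≤ bet1 ε t ∧ bet1 ε t ≤ 1 ∧ 0 ≤ bet2 ε t ∧
    0 ≤ bet ε t - t * bet1 ε t ∧ bet ε t - t * bet1 ε t ≤ ε / 2 ∧ 0 ≤ bet ε t ∧ t ≤ bet ε t ∧
    bet ε t ≤ max t 0 + ε / 2 := by
  have h0 := sq_pos_aux hε t
  have hp : 0 < √(t ^ 2 + ε ^ 2) := Real.sqrt_pos.2 h0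
  have hs : √(t ^ 2 + ε ^ 2) ^ 2 = t ^ 2 + ε ^ 2 := Real.sq_sqrt h0.le
  simp only [bet, bet1, bet2]
  generalize √(t ^ 2 + ε ^ 2) = s at *
  have e1 : ε ≤ s := by nlinarith
  have e2 : |t| ≤ s := abs_le_of_sq_le_sq (by nlinarith) hp.le
  have e3 := abs_le.1 e2
  have e4 : s ≤ |t| + ε := by
    apply le_of_sq_le_sq _ (by positivity)
    nlinarith [sq_abs t, abs_nonneg t]
  have f1 : (t + s) / 2 - t * ((1 + t / s) / 2) = ε ^ 2 / s / 2 := by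
    have he : ε ^ 2 = s ^ 2 - t ^ 2 := by linarith
    rw [he]; field_simp; ring
  have g1 : -1 ≤ t / s := by rw [le_div_iff₀ hp]; linarith
  have g2 : t / s ≤ 1 := by rw [div_le_one hp]; linarith
  have g3 : ε ^ 2 / s ≤ ε := by rw [div_le_iff₀ hp]; nlinarith
  refine ⟨by linarith, by linarith, by positivity, by rw [f1]; positivity, by rw [f1]; linarith,
    by linarith, by linarith, ?_⟩
  rcases le_total 0 t with h | h
  · rw [abs_of_nonneg h] at e4; rw [max_eq_left h]; linarith
  · rw [abs_of_nonpos h] at e4; rw [max_eq_right h]; linarith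

theorem dd_comp_fun {v : ℝ × ℝ} {b b' : ℝ → ℝ} {φ : ℝ × ℝ → ℝ} (hb : ∀ t, HasDerivAt b (b' t) t)
    (hφ : ContDiff ℝ ∞ φ) : dd v (fun z => b (φ z)) = fun z => b' (φ z) * dd v φ z := by
  ext z; exact dd_comp (hb _) (smooth_diff hφ z)

theorem PP_comp (σ ρ : ℝ) {b b' b'' : ℝ → ℝ} {φ : ℝ × ℝ → ℝ} (hb : ∀ t, HasDerivAt b (b' t) t)
    (hb' : ∀ t, HasDerivAt b' (b'' t) t) (hφ : ContDiff ℝ ∞ φ) (z : ℝ × ℝ) :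
    PP σ ρ (fun z => b (φ z)) z = b' (φ z) * PP σ ρ φ z + b'' (φ z) *
      (dx φ z ^ 2 + 2 * ρ * σ * dx φ z * dy φ z + σ ^ 2 * dy φ z ^ 2) := by
  have hd := smooth_diff hφ
  have hd2 : DifferentiableAt ℝ (fun z => b' (φ z)) z :=
    ((hb' (φ z)).differentiableAt).comp z (hd z)
  have key : ∀ v w, dd w (dd v (fun z => b (φ z))) z
      = b'' (φ z) * dd w φ z * dd v φ z + b' (φ z) * dd w (dd v φ) z := by
    intro v w
    rw [dd_comp_fun hb hφ, dd_mul hd2 (dd_differentiable hφ z), dd_comp (hb' _) (hd z)]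
  simp only [PP, dx, dy, key]; ring

theorem Q_nonneg {σ ρ : ℝ} (hρ₁ : -1 < ρ) (hρ₂ : ρ < 1) (a b : ℝ) :
    0 ≤ a ^ 2 + 2 * ρ * σ * a * b + σ ^ 2 * b ^ 2 := by
  nlinarith [sq_nonneg (a + ρ * σ * b), mul_nonneg (sq_nonneg (σ * b))
    (mul_pos (sub_pos.2 hρ₂) (by linarith : 0 < ρ + 1)).le]

theorem hestonA_comp (σ ρ κ θ q r : ℝ) {b b' b'' : ℝ → ℝ} {φ : ℝ × ℝ → ℝ}
    (hb : ∀ t, HasDerivAt b (b' t) t)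
    (hb' : ∀ t, HasDerivAt b' (b'' t) t) (hφ : ContDiff ℝ ∞ φ) (z : ℝ × ℝ) :
    hestonA σ ρ κ θ q r (fun z => b (φ z)) z = b' (φ z) * hestonA σ ρ κ θ q r φ z
      - (z.2 / 2) * b'' (φ z) *
      (dx φ z ^ 2 + 2 * ρ * σ * dx φ z * dy φ z + σ ^ 2 * dy φ z ^ 2)
      + r * (b (φ z) - φ z * b' (φ z)) := by
  rw [hestonA_eq, hestonA_eq, PP_comp σ ρ hb hb' hφ]
  simp only [dx, dy]
  rw [dd_comp_fun hb hφ, dd_comp_fun hb hφ]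
  ring

theorem Ast_comp (σ ρ κ θ q r : ℝ) {b b' b'' : ℝ → ℝ} {φ : ℝ × ℝ → ℝ}
    (hb : ∀ t, HasDerivAt b (b' t) t)
    (hb' : ∀ t, HasDerivAt b' (b'' t) t) (hφ : ContDiff ℝ ∞ φ) (z : ℝ × ℝ) :
    Ast σ ρ κ θ q r (fun z => b (φ z)) z = b' (φ z) * Ast σ ρ κ θ q r φ z
      - (z.2 / 2) * b'' (φ z) *
      (dx φ z ^ 2 + 2 * ρ * σ * dx φ z * dy φ z + σ ^ 2 * dy φ z ^ 2)
      + (r - κ) * (b (φ z) - φ z * b' (φ z)) := by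
  rw [Ast, Ast, PP_comp σ ρ hb hb' hφ]
  simp only [dx, dy]
  rw [dd_comp_fun hb hφ, dd_comp_fun hb hφ]
  ring

theorem dd_lin {v : ℝ × ℝ} {f g : ℝ × ℝ → ℝ} (a b : ℝ) (hf : ContDiff ℝ ∞ f)
    (hg : ContDiff ℝ ∞ g) : dd v (fun z => a * f z + b * g z)
      = fun z => a * dd v f z + b * dd v g z := by
  have hfd := smooth_diff hf
  have hgd := smooth_diff hg
  ext z
  rw [dd_add (by fun_prop) (by fun_prop), dd_const_mul _ (hfd z), dd_const_mul _ (hgd z)]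

theorem PP_lin (σ ρ : ℝ) {f g : ℝ × ℝ → ℝ} (a b : ℝ) (hf : ContDiff ℝ ∞ f)
    (hg : ContDiff ℝ ∞ g) (z : ℝ × ℝ) :
    PP σ ρ (fun z => a * f z + b * g z) z = a * PP σ ρ f z + b * PP σ ρ g z := by
  simp only [PP, dx, dy]
  rw [dd_lin a b hf hg, dd_lin a b hf hg, dd_lin a b (by fun_prop) (by fun_prop),
    dd_lin a b (by fun_prop) (by fun_prop), dd_lin a b (by fun_prop) (by fun_prop)]
  ring

theorem hestonA_lin (σ ρ κ θ q r : ℝ) {f g : ℝ × ℝ → ℝ} (a b : ℝ) (hf : ContDiff ℝ ∞ f)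
    (hg : ContDiff ℝ ∞ g) (z : ℝ × ℝ) :
    hestonA σ ρ κ θ q r (fun z => a * f z + b * g z) z =
      a * hestonA σ ρ κ θ q r f z + b * hestonA σ ρ κ θ q r g z := by
  rw [hestonA_eq, hestonA_eq, hestonA_eq, PP_lin σ ρ a b hf hg]
  simp only [dx, dy]
  rw [dd_lin a b hf hg, dd_lin a b hf hg]; ring

theorem Ast_lin (σ ρ κ θ q r : ℝ) {f g : ℝ × ℝ → ℝ} (a b : ℝ) (hf : ContDiff ℝ ∞ f)
    (hg : ContDiff ℝ ∞ g) (z : ℝ × ℝ) :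
    Ast σ ρ κ θ q r (fun z => a * f z + b * g z) z =
      a * Ast σ ρ κ θ q r f z + b * Ast σ ρ κ θ q r g z := by
  rw [Ast, Ast, Ast, PP_lin σ ρ a b hf hg]
  simp only [dx, dy]
  rw [dd_lin a b hf hg, dd_lin a b hf hg]; ring

theorem Ast_cont (σ ρ κ θ q r : ℝ) {φ : ℝ × ℝ → ℝ} (hφ : ContDiff ℝ ∞ φ) :
    Continuous (Ast σ ρ κ θ q r φ) := by
  have := hφ.continuous
  unfold Ast PP; fun_prop

theorem Ast_tsupport (σ ρ κ θ q r : ℝ) {φ : ℝ × ℝ → ℝ} :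
    tsupport (Ast σ ρ κ θ q r φ) ⊆ tsupport φ := by
  refine closure_minimal ?_ (isClosed_tsupport _)
  intro z hz
  by_contra hn
  apply hz
  have h1 : ∀ v, z ∉ tsupport (dd v φ) := fun v h => hn (dd_tsupport h)
  have h2 : ∀ v w, z ∉ tsupport (dd v (dd w φ)) := fun v w h => h1 w (dd_tsupport h)
  have e0 : φ z = 0 := image_eq_zero_of_notMem_tsupport hn
  have e1 : ∀ v, dd v φ z = 0 := fun v => image_eq_zero_of_notMem_tsupport (h1 v)
  have e2 : ∀ v w, dd v (dd w φ) z = 0 := fun v w => image_eq_zero_of_notMem_tsupport (h2 v w)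
  simp [Ast, PP, e0, e1, e2]

theorem Ast_compact (σ ρ κ θ q r : ℝ) {φ : ℝ × ℝ → ℝ} (hc : HasCompactSupport φ) :
    HasCompactSupport (Ast σ ρ κ θ q r φ) :=
  hc.of_isClosed_subset (isClosed_tsupport _) (Ast_tsupport σ ρ κ θ q r)

theorem le_of_eps {L R C : ℝ} (h : ∀ ε > 0, L ≤ R + ε * C) : L ≤ R := by
  by_contra hlt
  push Not at hlt
  have hC : 0 < |C| + 1 := by positivity
  have := h ((L - R) / (|C| + 1) / 2) (by have : 0 < L - R := by linarith
                                          positivity)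
  have h2 : (L - R) / (|C| + 1) / 2 * C ≤ (L - R) / 2 := by
    have h3 : (L - R) / (|C| + 1) / 2 * C ≤ (L - R) / (|C| + 1) / 2 * (|C| + 1) := by
      apply mul_le_mul_of_nonneg_left (by linarith [le_abs_self C])
      have : 0 < L - R := by linarith
      positivity
    have h4 : (L - R) / (|C| + 1) / 2 * (|C| + 1) = (L - R) / 2 := by field_simp
    linarith
  linarith

theorem dominate {σ ρ κ θ q r : ℝ} (hρ₁ : -1 < ρ) (hρ₂ : ρ < 1) {O : Set (ℝ × ℝ)} (hO : IsOpen O)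
    (hOsub : O ⊆ HH) {f wp wm φ : ℝ × ℝ → ℝ} (hf : ContinuousOn f O)
    (hwp : ContDiff ℝ ∞ wp) (hwm : ContDiff ℝ ∞ wm)
    (hp : ∀ z ∈ O, f z ≤ hestonA σ ρ κ θ q r wp z) (hm : ∀ z ∈ O, hestonA σ ρ κ θ q r wm z ≤ f z)
    (hmp : ∀ z ∈ O, wm z ≤ wp z)
    (hφ : ContDiff ℝ ∞ φ) (hc : HasCompactSupport φ) (hs : tsupport φ ⊆ O) :
    ∫ z, f z * φ z ≤ ∫ z, (max (Ast σ ρ κ θ q r φ z) 0 * wp z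
      - max (-Ast σ ρ κ θ q r φ z) 0 * wm z) := by
  obtain ⟨χ, χs, χc, χO, χ0, χ1⟩ := exists_cutoff hc hO hs
  replace χ1 : ∀ z ∈ tsupport φ, χ z = 1 := fun z hz => χ1.self_of_nhdsSet z hz
  set S := Ast σ ρ κ θ q r with hS
  have intf : ∀ {ψ : ℝ × ℝ → ℝ}, ContDiff ℝ ∞ ψ → HasCompactSupport ψ → tsupport ψ ⊆ O →
      Integrable (fun z => f z * ψ z) := fun h1 h2 h3 =>
    (cont_mul hO hf h1.continuous h3).integrable_of_hasCompactSupport h2.mul_left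
  have intA : ∀ {w ψ : ℝ × ℝ → ℝ}, ContDiff ℝ ∞ w → ContDiff ℝ ∞ ψ → HasCompactSupport ψ →
      Integrable (fun z => hestonA σ ρ κ θ q r w z * ψ z) := fun hw h1 h2 => by
    apply Continuous.integrable_of_hasCompactSupport
    · have := hw.continuous
      have := h1.continuous
      simp only [hestonA_eq, PP]; fun_prop
    · exact h2.mul_left
  have intS : ∀ {w ψ : ℝ × ℝ → ℝ}, Continuous w → ContDiff ℝ ∞ ψ → HasCompactSupport ψ →
      Integrable (fun z => w z * S ψ z) := fun hw h1 h2 =>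
    (hw.mul (Ast_cont σ ρ κ θ q r h1)).integrable_of_hasCompactSupport
      (Ast_compact σ ρ κ θ q r h2).mul_left
  have intM : Integrable (fun z => max (S φ z) 0 * wp z - max (-S φ z) 0 * wm z) := by
    have cS := Ast_cont σ ρ κ θ q r hφ
    have kS := Ast_compact σ ρ κ θ q r hc
    apply Continuous.integrable_of_hasCompactSupport
    · have := hwp.continuous
      have := hwm.continuous
      fun_prop
    · have k1 : HasCompactSupport (fun z => max (S φ z) 0) :=
        kS.comp_left (g := fun t => max t 0) (by simp)
      have k2 : HasCompactSupport (fun z => max (-S φ z) 0) :=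
        kS.comp_left (g := fun t => max (-t) 0) (by simp)
      exact k1.mul_right.sub k2.mul_right
  apply le_of_eps (C := ∫ z, (wp z - wm z) * (|r - κ| * χ z) + (wp z - wm z) * S χ z)
  intro ε hε
  set b : ℝ → ℝ := fun t => bet ε t - ε / 2 with hb
  have b1 : ∀ t, HasDerivAt b (bet1 ε t) t := fun t => (bet_deriv hε t).sub_const _
  have b2 := bet1_deriv hε
  have b0 : b 0 = 0 := by simp [hb, bet, Real.sqrt_sq hε.le]
  set B : ℝ × ℝ → ℝ := fun z => b (φ z) with hB
  have Bs : ContDiff ℝ ∞ B := ((bet_smooth hε).comp hφ).sub contDiff_const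
  have Bc : HasCompactSupport B := hc.comp_left b0
  have BO : tsupport B ⊆ O := (tsupport_comp_subset b0 φ).trans hs
  set T1 : ℝ × ℝ → ℝ := fun z => 1 * B z + ε * χ z with hT1
  set T2 : ℝ × ℝ → ℝ := fun z => 1 * T1 z + (-1) * φ z with hT2
  have T1s : ContDiff ℝ ∞ T1 := by fun_prop
  have T2s : ContDiff ℝ ∞ T2 := by fun_prop
  have T1c : HasCompactSupport T1 := Bc.mul_left.add χc.mul_left
  have T2c : HasCompactSupport T2 := T1c.mul_left.add hc.mul_left
  have sup_aux : ∀ {u v : ℝ × ℝ → ℝ} (a c : ℝ), tsupport u ⊆ O → tsupport v ⊆ O →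
      tsupport (fun z => a * u z + c * v z) ⊆ O := by
    intro u v a c hu hv
    refine (tsupport_add _ _).trans (union_subset ?_ ?_)
    · exact (tsupport_mul_subset_right).trans hu
    · exact (tsupport_mul_subset_right).trans hv
  have T1O : tsupport T1 ⊆ O := sup_aux _ _ BO χO
  have T2O : tsupport T2 ⊆ O := sup_aux _ _ T1O hs
  have hBφ : ∀ z, 0 ≤ T1 z ∧ 0 ≤ T2 z := by
    intro z
    have hf := bet_facts hε (φ z)
    by_cases hz : z ∈ tsupport φ
    · simp only [hT2, hT1, hB, hb, χ1 z hz]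
      constructor <;> linarith [hf.2.2.2.2.2.1, hf.2.2.2.2.2.2.1]
    · have h0 : φ z = 0 := image_eq_zero_of_notMem_tsupport hz
      have : 0 ≤ ε * χ z := mul_nonneg hε.le (χ0 z)
      simp only [hT2, hT1, hB, h0, b0]
      constructor <;> linarith
  have zero_of : ∀ {u : ℝ × ℝ → ℝ} {z}, tsupport u ⊆ O → z ∉ O → u z = 0 := fun h hz =>
    image_eq_zero_of_notMem_tsupport fun hh => hz (h hh)
  have e1 : ∫ z, f z * T1 z ≤ ∫ z, wp z * S T1 z := by
    rw [hS, integral_adj σ ρ κ θ q r hwp T1s T1c]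
    apply integral_mono (intf T1s T1c T1O) (intA hwp T1s T1c)
    intro z
    by_cases hz : z ∈ O
    · exact mul_le_mul_of_nonneg_right (hp z hz) (hBφ z).1
    · simp [zero_of T1O hz]
  have e2 : ∫ z, wm z * S T2 z ≤ ∫ z, f z * T2 z := by
    rw [hS, integral_adj σ ρ κ θ q r hwm T2s T2c]
    apply integral_mono (intA hwm T2s T2c) (intf T2s T2c T2O)
    intro z
    by_cases hz : z ∈ O
    · exact mul_le_mul_of_nonneg_right (hm z hz) (hBφ z).2
    · simp [zero_of T2O hz]
  have e3 : ∫ z, f z * φ z = (∫ z, f z * T1 z) - ∫ z, f z * T2 z := by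
    rw [← integral_sub (intf T1s T1c T1O) (intf T2s T2c T2O)]
    congr 1; ext z; simp only [hT2]; ring
  have iE : Integrable fun z => (wp z - wm z) * (|r - κ| * χ z) + (wp z - wm z) * S χ z := by
    apply Integrable.add
    · apply Continuous.integrable_of_hasCompactSupport
      · have := hwp.continuous
        have := hwm.continuous
        have := χs.continuous
        fun_prop
      · exact χc.mul_left.mul_left
    · exact intS (hwp.continuous.sub hwm.continuous) χs χc
  rw [← integral_const_mul, ← integral_add intM (iE.const_mul ε)]
  calc _ = _ := e3
    _ ≤ (∫ z, wp z * S T1 z) - ∫ z, wm z * S T2 z := by linarith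
    _ = ∫ z, (wp z * S T1 z - wm z * S T2 z) :=
      (integral_sub (intS hwp.continuous T1s T1c) (intS hwm.continuous T2s T2c)).symm
    _ ≤ _ := by
      apply integral_mono ((intS hwp.continuous T1s T1c).sub (intS hwm.continuous T2s T2c))
        (intM.add (iE.const_mul ε))
      intro z
      have st : ∀ {u : ℝ × ℝ → ℝ}, tsupport u ⊆ O → tsupport (S u) ⊆ O := fun h =>
        (Ast_tsupport σ ρ κ θ q r).trans h
      by_cases hz : z ∈ O
      swap
      · simp [zero_of (st T1O) hz, zero_of (st T2O) hz, zero_of (st hs) hz, zero_of (st χO) hz,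
          zero_of χO hz]
      have hy : 0 < z.2 := hOsub hz
      have hw := hmp z hz
      have k2 : S T2 z = 1 * S T1 z + (-1) * S φ z := Ast_lin σ ρ κ θ q r 1 (-1) T1s hφ z
      have k1 : S T1 z = 1 * S B z + ε * S χ z := Ast_lin σ ρ κ θ q r 1 ε Bs χs z
      have k3 : S B z ≤ max (S φ z) 0 + ε * (|r - κ| * χ z) := by
        have hcomp := Ast_comp σ ρ κ θ q r b1 b2 hφ z
        have hf := bet_facts hε (φ z)
        have hQ := Q_nonneg (σ := σ) hρ₁ hρ₂ (dx φ z) (dy φ z)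
        have t1 : 0 ≤ (z.2 / 2) * bet2 ε (φ z) *
          (dx φ z ^ 2 + 2 * ρ * σ * dx φ z * dy φ z + σ ^ 2 * dy φ z ^ 2) :=
          mul_nonneg (mul_nonneg (by linarith) hf.2.2.1) hQ
        have t2 : bet1 ε (φ z) * S φ z ≤ max (S φ z) 0 := by
          rcases le_total 0 (S φ z) with h | h
          · rw [max_eq_left h]; nlinarith [hf.2.1]
          · rw [max_eq_right h]; exact mul_nonpos_of_nonneg_of_nonpos hf.1 h
        have t3 : (r - κ) * (b (φ z) - φ z * bet1 ε (φ z)) ≤ ε * (|r - κ| * χ z) := by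
          by_cases hzs : z ∈ tsupport φ
          · rw [χ1 z hzs]
            have : |b (φ z) - φ z * bet1 ε (φ z)| ≤ ε := by
              rw [abs_le]; simp only [hb]
              constructor <;> linarith [hf.2.2.2.1, hf.2.2.2.2.1]
            calc _ ≤ |(r - κ) * (b (φ z) - φ z * bet1 ε (φ z))| := le_abs_self _
              _ = |r - κ| * |b (φ z) - φ z * bet1 ε (φ z)| := abs_mul _ _
              _ ≤ |r - κ| * ε := by gcongr
              _ = _ := by ring
          · have h0 : φ z = 0 := image_eq_zero_of_notMem_tsupport hzs
            rw [h0, b0]; simp only [zero_mul, sub_zero, mul_zero]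
            exact mul_nonneg hε.le (mul_nonneg (abs_nonneg _) (χ0 z))
        have : S B z = _ := hcomp
        rw [this]; linarith
      have k4 : S φ z = max (S φ z) 0 - max (-S φ z) 0 := by
        rcases le_total 0 (S φ z) with h | h
        · rw [max_eq_left h, max_eq_right (by linarith)]; ring
        · rw [max_eq_right h, max_eq_left (by linarith)]; ring
      have k5 := mul_le_mul_of_nonneg_left k3 (sub_nonneg.2 hw)
      have k6 : wp z * S T1 z - wm z * S T2 z = (wp z - wm z) * S B z
        + ε * ((wp z - wm z) * S χ z) + wm z * S φ z := by rw [k2, k1]; ring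
      simp only [Pi.add_apply, Pi.sub_apply]
      rw [k6]
      have k7 : wm z * S φ z = wm z * (max (S φ z) 0 - max (-S φ z) 0) := by rw [← k4]
      nlinarith [k5, k7]

section abstractHB
variable {X : Type*} [MeasurableSpace X] {μ : Measure X}

theorem L2_inner_mono {a b c : Lp ℝ 2 μ} (ha : 0 ≤ a) (hb : b ≤ c) : inner ℝ a b ≤ inner ℝ a c := by
  rw [L2.inner_def, L2.inner_def]
  apply integral_mono_ae (L2.integrable_inner a b) (L2.integrable_inner a c)
  filter_upwards [(Lp.coeFn_nonneg a).2 ha, (Lp.coeFn_le b c).2 hb] with x h1 h2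
  simp only [RCLike.inner_apply, conj_trivial]
  exact mul_le_mul_of_nonneg_right h2 h1

theorem L2_pos_coe (a : Lp ℝ 2 μ) : (a⁺ : Lp ℝ 2 μ) =ᵐ[μ] fun x => max (a x) 0 := by
  filter_upwards [Lp.coeFn_sup a 0, Lp.coeFn_zero ℝ 2 μ] with x h h0
  rw [posPart_def, h, Pi.sup_apply, h0]; rfl

theorem L2_neg_coe (a : Lp ℝ 2 μ) : (a⁻ : Lp ℝ 2 μ) =ᵐ[μ] fun x => max (-a x) 0 := by
  filter_upwards [Lp.coeFn_sup (-a) 0, Lp.coeFn_zero ℝ 2 μ, Lp.coeFn_neg a] with x h h0 hn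
  rw [negPart_def, h, Pi.sup_apply, h0, hn]; rfl

theorem L2_pos_smul {c : ℝ} (hc : 0 ≤ c) (a : Lp ℝ 2 μ) : (c • a)⁺ = c • a⁺ := by
  apply Lp.ext
  filter_upwards [L2_pos_coe (c • a), L2_pos_coe a, Lp.coeFn_smul c a, Lp.coeFn_smul c (a⁺)]
    with x h1 h2 h3 h4
  rw [h1, h4, h3]; simp only [Pi.smul_apply, smul_eq_mul]; rw [h2, mul_max_of_nonneg _ _ hc]; simp

theorem L2_inner_pos_neg (a : Lp ℝ 2 μ) : inner ℝ (a⁺) (a⁻) = 0 := by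
  rw [L2.inner_def]
  apply integral_eq_zero_of_ae
  filter_upwards [L2_pos_coe a, L2_neg_coe a] with x h1 h2
  rw [h1, h2]
  simp only [RCLike.inner_apply, conj_trivial, Pi.zero_apply]
  rcases le_total 0 (a x) with h | h
  · rw [max_eq_right (a := -a x) (by linarith)]; ring
  · rw [max_eq_right h]; ring

theorem L2_nonneg_of_inner {v : Lp ℝ 2 μ} (h : ∀ ψ : Lp ℝ 2 μ, 0 ≤ ψ → 0 ≤ inner ℝ v ψ) : 0 ≤ v := by
  have h1 := h (v⁻) (negPart_nonneg v)
  have h2 : inner ℝ v (v⁻) = - inner ℝ (v⁻) (v⁻) := by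
    conv_lhs => rw [← posPart_sub_negPart v]
    rw [inner_sub_left, ]
    simp [L2_inner_pos_neg]
  have h3 : (v⁻ : Lp ℝ 2 μ) = 0 := by
    rw [← inner_self_eq_zero (𝕜 := ℝ)]
    exact le_antisymm (by linarith) real_inner_self_nonneg
  exact negPart_eq_zero.1 h3

theorem abstract_HB {M : Type*} [AddCommGroup M] [Module ℝ M] (T : M →ₗ[ℝ] Lp ℝ 2 μ)
    (l : M →ₗ[ℝ] ℝ) (P N : Set (Lp ℝ 2 μ)) (hP : P.Nonempty) (hN : N.Nonempty) (e : Lp ℝ 2 μ)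
    (hPN : ∀ p ∈ P, ∀ n ∈ N, n ≤ p)
    (hPm : ∀ p₁ ∈ P, ∀ p₂ ∈ P, ∀ ε > (0 : ℝ), ∃ p ∈ P, p ≤ p₁ + ε • e ∧ p ≤ p₂ + ε • e)
    (hNm : ∀ p₁ ∈ N, ∀ p₂ ∈ N, ∀ ε > (0 : ℝ), ∃ p ∈ N, p₁ ≤ p + ε • e ∧ p₂ ≤ p + ε • e)
    (hl : ∀ φ : M, ∀ p ∈ P, ∀ n ∈ N, l φ ≤ inner ℝ ((T φ)⁺) p - inner ℝ ((T φ)⁻) n) :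
    ∃ u : Lp ℝ 2 μ, (∀ φ, inner ℝ u (T φ) = l φ) ∧ (∀ p ∈ P, u ≤ p) ∧ ∀ n ∈ N, n ≤ u := by
  obtain ⟨p0, hp0⟩ := hP
  obtain ⟨n0, hn0⟩ := hN
  set I : Type _ := P × N
  have : Nonempty I := ⟨⟨⟨p0, hp0⟩, ⟨n0, hn0⟩⟩⟩
  set F : Lp ℝ 2 μ → I → ℝ := fun ψ i => inner ℝ (ψ⁺) i.1.1 - inner ℝ (ψ⁻) i.2.1 with hF
  have bdd : ∀ ψ, BddBelow (range (F ψ)) := by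
    intro ψ
    refine ⟨inner ℝ (ψ⁺) n0 - inner ℝ (ψ⁻) p0, ?_⟩
    rintro _ ⟨⟨⟨p, hp⟩, ⟨n, hn⟩⟩, rfl⟩
    exact sub_le_sub (L2_inner_mono (posPart_nonneg ψ) (hPN p hp n0 hn0))
      (L2_inner_mono (negPart_nonneg ψ) (hPN p0 hp0 n hn))
  set G : Lp ℝ 2 μ → ℝ := fun ψ => ⨅ i, F ψ i with hG
  have G_le : ∀ ψ i, G ψ ≤ F ψ i := fun ψ i => ciInf_le (bdd ψ) i
  have G_hom : ∀ c : ℝ, 0 < c → ∀ x, G (c • x) = c * G x := by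
    intro c hc x
    have hsup : (c • x)⁺ = c • x⁺ := L2_pos_smul hc.le x
    have hsdn : (c • x)⁻ = c • x⁻ := by
      rw [← posPart_neg, ← posPart_neg, ← smul_neg, L2_pos_smul hc.le]
    simp only [hG, Real.mul_iInf_of_nonneg hc.le]
    congr 1; ext i
    simp only [hF, hsup, hsdn, real_inner_smul_left]; ring
  have split : ∀ (ψ p n : Lp ℝ 2 μ), inner ℝ (ψ⁺) p - inner ℝ (ψ⁻) n
      = inner ℝ (ψ⁺) (p - n) + inner ℝ ψ n := by
    intro ψ p n
    conv_rhs => rw [show inner ℝ ψ n = inner ℝ (ψ⁺ - ψ⁻) n by rw [posPart_sub_negPart]]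
    rw [inner_sub_left, inner_sub_right]; ring
  have G_add : ∀ x y, G (x + y) ≤ G x + G y := by
    intro x y
    have key : ∀ i j, G (x + y) ≤ F x i + F y j := by
      rintro ⟨⟨p₁, hp₁⟩, ⟨n₁, hn₁⟩⟩ ⟨⟨p₂, hp₂⟩, ⟨n₂, hn₂⟩⟩
      apply le_of_eps (C := inner ℝ (x⁺) e + inner ℝ (x⁻) e + inner ℝ (y⁺) e + inner ℝ (y⁻) e)
      intro ε hε
      obtain ⟨p, hp, hpa, hpb⟩ := hPm p₁ hp₁ p₂ hp₂ ε hε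
      obtain ⟨n, hn, hna, hnb⟩ := hNm n₁ hn₁ n₂ hn₂ ε hε
      have h1 := G_le (x + y) ⟨⟨p, hp⟩, ⟨n, hn⟩⟩
      simp only [hF] at h1 ⊢
      rw [split] at h1
      have hm : 0 ≤ p - n := sub_nonneg.2 (hPN p hp n hn)
      have h2 : inner ℝ ((x + y)⁺) (p - n) ≤ inner ℝ (x⁺ + y⁺) (p - n) := by
        rw [real_inner_comm, real_inner_comm (p - n)]
        exact L2_inner_mono hm (sup_le (add_le_add (le_posPart x) (le_posPart y))
          (add_nonneg (posPart_nonneg x) (posPart_nonneg y)))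
      rw [inner_add_left, ] at h2
      rw [inner_add_left] at h1
      have e1 := split x p n
      have e2 := split y p n
      have a1 := L2_inner_mono (posPart_nonneg x) hpa
      have a2 := L2_inner_mono (posPart_nonneg y) hpb
      have a3 := L2_inner_mono (negPart_nonneg x) hna
      have a4 := L2_inner_mono (negPart_nonneg y) hnb
      rw [inner_add_right, real_inner_smul_right] at a1 a2 a3 a4
      linarith
    have k2 : ∀ i, G (x + y) - F x i ≤ G y := fun i => le_ciInf fun j => by linarith [key i j]
    have k3 : G (x + y) - G y ≤ G x := le_ciInf fun i => by linarith [k2 i]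
    linarith
  have G0 : G 0 = 0 := by
    have : F 0 = fun _ => 0 := by ext i; simp [hF]
    simp only [hG, this]; simp
  have hlG : ∀ φ, l φ ≤ G (T φ) := fun φ => le_ciInf fun i => hl φ _ i.1.2 _ i.2.2
  have hker : ∀ φ, T φ = 0 → l φ = 0 := by
    intro φ h
    have h1 := hlG φ
    have h2 := hlG (-φ)
    rw [map_neg l, map_neg T, h, neg_zero, G0] at h2
    rw [h, G0] at h1
    linarith
  obtain ⟨g, hg⟩ := T.rangeRestrict.exists_rightInverse_of_surjective
    (LinearMap.range_rangeRestrict T)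
  have hg' : ∀ y, T.rangeRestrict (g y) = y := fun y => LinearMap.congr_fun hg y
  have hlg : ∀ φ, l (g (T.rangeRestrict φ)) = l φ := by
    intro φ
    have : l (g (T.rangeRestrict φ) - φ) = 0 := by
      apply hker
      have := hg' (T.rangeRestrict φ)
      have h2 := congrArg Subtype.val this
      rw [map_sub]; exact sub_eq_zero.2 h2
    rw [map_sub] at this; linarith
  let pm : Lp ℝ 2 μ →ₗ.[ℝ] ℝ := ⟨LinearMap.range T, l.comp g⟩
  obtain ⟨Λ, hΛ1, hΛ2⟩ := exists_extension_of_le_sublinear pm G G_hom G_add (by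
    rintro ⟨x, φ, rfl⟩
    have : pm ⟨T φ, ⟨φ, rfl⟩⟩ = l φ := hlg φ
    rw [this]; exact hlG φ)
  have hbound : ∀ ψ, Λ ψ ≤ (‖p0‖ + ‖n0‖) * ‖ψ‖ := by
    intro ψ
    refine (hΛ2 ψ).trans ((G_le ψ ⟨⟨p0, hp0⟩, ⟨n0, hn0⟩⟩).trans ?_)
    simp only [hF]
    have h1 : ‖ψ⁺‖ ≤ ‖ψ‖ := norm_le_norm_of_abs_le_abs (by
      rw [abs_of_nonneg (posPart_nonneg ψ)]
      rw [← posPart_add_negPart]; exact le_add_of_nonneg_right (negPart_nonneg ψ))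
    have h2 : ‖ψ⁻‖ ≤ ‖ψ‖ := norm_le_norm_of_abs_le_abs (by
      rw [abs_of_nonneg (negPart_nonneg ψ)]
      rw [← posPart_add_negPart]; exact le_add_of_nonneg_left (posPart_nonneg ψ))
    have h3 := abs_le.1 (abs_real_inner_le_norm (ψ⁺) p0)
    have h4 := abs_le.1 (abs_real_inner_le_norm (ψ⁻) n0)
    nlinarith [norm_nonneg p0, norm_nonneg n0]
  let Λc : Lp ℝ 2 μ →L[ℝ] ℝ := Λ.mkContinuous (‖p0‖ + ‖n0‖) (by
    intro ψ
    rw [Real.norm_eq_abs, abs_le]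
    have := hbound (-ψ)
    rw [map_neg, norm_neg] at this
    exact ⟨by linarith, hbound ψ⟩)
  obtain ⟨u, hu⟩ := (InnerProductSpace.toDual ℝ (Lp ℝ 2 μ)).surjective Λc
  have hu' : ∀ ψ, inner ℝ u ψ = Λ ψ := by
    intro ψ
    rw [← InnerProductSpace.toDual_apply_apply, hu]; rfl
  refine ⟨u, ?_, ?_, ?_⟩
  · intro φ
    rw [hu', ← hlg φ]
    exact hΛ1 ⟨T φ, ⟨φ, rfl⟩⟩
  · intro p hp
    rw [← sub_nonneg]
    apply L2_nonneg_of_inner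
    intro ψ hψ
    have h1 := (hΛ2 ψ).trans (G_le ψ ⟨⟨p, hp⟩, ⟨n0, hn0⟩⟩)
    simp only [hF, posPart_of_nonneg hψ, negPart_of_nonneg hψ, inner_zero_left, sub_zero] at h1
    rw [inner_sub_left, hu', real_inner_comm]; linarith
  · intro n hn
    rw [← sub_nonneg]
    apply L2_nonneg_of_inner
    intro ψ hψ
    have h1 := (hΛ2 (-ψ)).trans (G_le (-ψ) ⟨⟨p0, hp0⟩, ⟨n, hn⟩⟩)
    simp only [hF, posPart_neg, negPart_neg, posPart_of_nonneg hψ, negPart_of_nonneg hψ,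
      inner_zero_left, zero_sub, map_neg] at h1
    rw [inner_sub_left, hu', real_inner_comm]; linarith

end abstractHB

/-- smooth supersolutions dominating `G` -/
structure Super (σ ρ κ θ q r : ℝ) (O : Set (ℝ × ℝ)) (V f G w : ℝ × ℝ → ℝ) : Prop where
  smooth : ContDiff ℝ ∞ w
  super : ∀ z ∈ O, f z ≤ hestonA σ ρ κ θ q r w z
  dom : ∀ z ∈ O, G z ≤ w z
  growth : ∃ C, ∀ z ∈ O, |w z| ≤ C * V z

theorem hestonA_neg (σ ρ κ θ q r : ℝ) {w : ℝ × ℝ → ℝ} (hw : ContDiff ℝ ∞ w) (z : ℝ × ℝ) :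
    hestonA σ ρ κ θ q r (fun z => - w z) z = - hestonA σ ρ κ θ q r w z := by
  have := hestonA_lin σ ρ κ θ q r (-1) 0 hw hw z
  simpa using this

theorem super_min {σ ρ κ θ q r : ℝ} (hρ₁ : -1 < ρ) (hρ₂ : ρ < 1) (hr : 0 < r) {O : Set (ℝ × ℝ)}
    (hOsub : O ⊆ HH) {V f G w₁ w₂ : ℝ × ℝ → ℝ} {c0 : ℝ} (hc0 : 0 < c0) (hV : ContDiff ℝ ∞ V)
    (hV1 : ∀ z, 1 ≤ V z) (hVA : ∀ z ∈ O, c0 * V z ≤ hestonA σ ρ κ θ q r V z)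
    (h1 : Super σ ρ κ θ q r O V f G w₁) (h2 : Super σ ρ κ θ q r O V f G w₂) {ε : ℝ} (hε : 0 < ε) :
    ∃ w, Super σ ρ κ θ q r O V f G w ∧ ∀ z, w z ≤ w₁ z + ε * V z ∧ w z ≤ w₂ z + ε * V z := by
  obtain ⟨δ, hδ, hδ1, hδ2⟩ : ∃ δ > 0, δ ≤ ε ∧ r * δ ≤ ε * c0 := by
    refine ⟨min ε (ε * c0 / r), lt_min hε (by positivity), min_le_left _ _, ?_⟩
    calc r * min ε (ε * c0 / r) ≤ r * (ε * c0 / r) := by gcongr; exact min_le_right _ _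
      _ = ε * c0 := by field_simp
  set D : ℝ × ℝ → ℝ := fun z => 1 * w₁ z + (-1) * w₂ z with hD
  have w1s := h1.smooth
  have w2s := h2.smooth
  have Ds : ContDiff ℝ ∞ D := by fun_prop
  set B : ℝ × ℝ → ℝ := fun z => bet δ (D z) with hB
  have Bs : ContDiff ℝ ∞ B := (bet_smooth hδ).comp Ds
  set E : ℝ × ℝ → ℝ := fun z => 1 * w₁ z + (-1) * B z with hE
  have Es : ContDiff ℝ ∞ E := by fun_prop
  obtain ⟨C1, hC1⟩ := h1.growth
  obtain ⟨C2, hC2⟩ := h2.growth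
  refine ⟨fun z => 1 * E z + ε * V z, ⟨by fun_prop, ?_, ?_, ?_⟩, ?_⟩
  · intro z hz
    have hf := bet_facts hδ (D z)
    have hy : 0 < z.2 := hOsub hz
    have hQ := Q_nonneg (σ := σ) hρ₁ hρ₂ (dx D z) (dy D z)
    rw [hestonA_lin _ _ _ _ _ _ _ _ Es hV, hestonA_lin _ _ _ _ _ _ _ _ w1s Bs,
      hestonA_comp _ _ _ _ _ _ (bet_deriv hδ) (bet1_deriv hδ) Ds,
      hestonA_lin _ _ _ _ _ _ _ _ w1s w2s]
    have t1 : 0 ≤ (z.2 / 2) * bet2 δ (D z) *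
          (dx D z ^ 2 + 2 * ρ * σ * dx D z * dy D z + σ ^ 2 * dy D z ^ 2) :=
          mul_nonneg (mul_nonneg (by linarith) hf.2.2.1) hQ
    have t2 : r * (bet δ (D z) - D z * bet1 δ (D z)) ≤ r * (δ / 2) := by
      gcongr; exact hf.2.2.2.2.1
    have t3 : ε * (c0 * V z) ≤ ε * hestonA σ ρ κ θ q r V z := by
      gcongr; exact hVA z hz
    have t4 : ε * c0 * 1 ≤ ε * c0 * V z := by gcongr; exact hV1 z
    have t5 := mul_nonneg hf.1 (sub_nonneg.2 (h2.super z hz))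
    have t6 := mul_nonneg (sub_nonneg.2 hf.2.1) (sub_nonneg.2 (h1.super z hz))
    nlinarith
  · intro z hz
    have hf := bet_facts hδ (D z)
    have a1 := h1.dom z hz
    have a2 := h2.dom z hz
    have a3 : ε * 1 ≤ ε * V z := by gcongr; exact hV1 z
    have a4 := hf.2.2.2.2.2.2.2
    simp only [hE, hB]
    rcases le_total 0 (D z) with h | h
    · rw [max_eq_left h] at a4; simp only [hD] at a4 ⊢; linarith
    · rw [max_eq_right h] at a4; linarith
  · refine ⟨C1 + (C1 + C2 + δ) + ε, fun z hz => ?_⟩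
    have hf := bet_facts hδ (D z)
    have a1 := hC1 z hz
    have a2 := hC2 z hz
    have a3 : δ * 1 ≤ δ * V z := by gcongr; exact hV1 z
    have a4 := hf.2.2.2.2.2.2.2
    have a5 : |B z| ≤ (C1 + C2 + δ) * V z := by
      rw [abs_of_nonneg hf.2.2.2.2.2.1]
      have : max (D z) 0 ≤ |w₁ z| + |w₂ z| := by
        apply max_le
        · simp only [hD]; linarith [le_abs_self (w₁ z), neg_abs_le (w₂ z)]
        · positivity
      linarith
    have a6 : |1 * E z + ε * V z| ≤ |w₁ z| + |B z| + ε * V z := by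
      have : 0 < ε * V z := mul_pos hε (by linarith [hV1 z])
      simp only [hE]
      rw [abs_le]
      constructor <;> linarith [le_abs_self (w₁ z), neg_abs_le (w₁ z), le_abs_self (B z),
        neg_abs_le (B z)]
    linarith
  · intro z
    have hf := bet_facts hδ (D z)
    have a1 := hf.2.2.2.2.2.1
    have a2 := hf.2.2.2.2.2.2.1
    simp only [hE, hB]
    constructor
    · linarith
    · have : D z = 1 * w₁ z + (-1) * w₂ z := rfl
      linarith

/-- the space of test functions on `O` -/
def Tst (O : Set (ℝ × ℝ)) : Submodule ℝ (ℝ × ℝ → ℝ) where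
  carrier := {φ | ContDiff ℝ ∞ φ ∧ HasCompactSupport φ ∧ tsupport φ ⊆ O}
  zero_mem' := ⟨contDiff_const, HasCompactSupport.zero, by simp [tsupport]⟩
  add_mem' := fun {a b} ha hb => ⟨ha.1.add hb.1, ha.2.1.add hb.2.1,
    (tsupport_add _ _).trans (union_subset ha.2.2 hb.2.2)⟩
  smul_mem' := fun c a ha => ⟨contDiff_const.mul ha.1, ha.2.1.mul_left,
    (tsupport_mul_subset_right (f := fun _ => c)).trans ha.2.2⟩

theorem exists_weight {V : ℝ × ℝ → ℝ} (hV : Continuous V) (hV1 : ∀ z, 1 ≤ V z) :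
    ∃ k : ℝ × ℝ → ℝ, Continuous k ∧ (∀ z, 0 < k z) ∧ MemLp (fun z => V z * k z) 2 := by
  have h1 : ∀ x : ℝ, 0 < 1 + x ^ 2 := fun x => by positivity
  have h2 : ∀ z, 0 < V z := fun z => by linarith [hV1 z]
  refine ⟨fun z => (V z)⁻¹ * ((1 + z.1 ^ 2)⁻¹ * (1 + z.2 ^ 2)⁻¹), ?_, ?_, ?_⟩
  · have := fun z => (h2 z).ne'
    have c1 : Continuous fun z : ℝ × ℝ => (1 + z.1 ^ 2)⁻¹ :=
      Continuous.inv₀ (by fun_prop) fun z => (h1 _).ne'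
    have c2 : Continuous fun z : ℝ × ℝ => (1 + z.2 ^ 2)⁻¹ :=
      Continuous.inv₀ (by fun_prop) fun z => (h1 _).ne'
    exact (hV.inv₀ this).mul (c1.mul c2)
  · intro z
    have := h2 z
    have := h1 z.1
    have := h1 z.2
    positivity
  · have e : (fun z => V z * ((V z)⁻¹ * ((1 + z.1 ^ 2)⁻¹ * (1 + z.2 ^ 2)⁻¹)))
        = fun z : ℝ × ℝ => (1 + z.1 ^ 2)⁻¹ * (1 + z.2 ^ 2)⁻¹ := by
      ext z
      rw [← mul_assoc, mul_inv_cancel₀ (h2 z).ne', one_mul]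
    rw [e]
    have c1 : Continuous fun z : ℝ × ℝ => (1 + z.1 ^ 2)⁻¹ :=
      Continuous.inv₀ (by fun_prop) fun z => (h1 _).ne'
    have c2 : Continuous fun z : ℝ × ℝ => (1 + z.2 ^ 2)⁻¹ :=
      Continuous.inv₀ (by fun_prop) fun z => (h1 _).ne'
    have i1 : Integrable (fun z : ℝ × ℝ => (1 + z.1 ^ 2)⁻¹ * (1 + z.2 ^ 2)⁻¹) :=
      integrable_inv_one_add_sq.mul_prod integrable_inv_one_add_sq
    refine (memLp_two_iff_integrable_sq (c1.mul c2).aestronglyMeasurable).2 ?_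
    apply i1.mono' ((c1.mul c2).pow 2).aestronglyMeasurable
    refine Filter.Eventually.of_forall fun z => ?_
    have a1 : 0 < (1 + z.1 ^ 2)⁻¹ := inv_pos.2 (h1 _)
    have a2 : 0 < (1 + z.2 ^ 2)⁻¹ := inv_pos.2 (h1 _)
    have b1 : (1 + z.1 ^ 2)⁻¹ ≤ 1 := inv_le_one_of_one_le₀ (by nlinarith)
    have b2 : (1 + z.2 ^ 2)⁻¹ ≤ 1 := inv_le_one_of_one_le₀ (by nlinarith)
    change ‖((1 + z.1 ^ 2)⁻¹ * (1 + z.2 ^ 2)⁻¹) ^ 2‖ ≤ _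
    rw [Real.norm_eq_abs, abs_of_nonneg (by positivity), sq]
    calc _ ≤ ((1 + z.1 ^ 2)⁻¹ * (1 + z.2 ^ 2)⁻¹) * (1 * 1) := by gcongr
      _ = _ := by ring

theorem weak_exists {σ ρ κ θ q r : ℝ} (hρ₁ : -1 < ρ) (hρ₂ : ρ < 1) (hr : 0 < r) {O : Set (ℝ × ℝ)}
    (hO : IsOpen O) (hOsub : O ⊆ HH) {V f G : ℝ × ℝ → ℝ} {c0 : ℝ} (hc0 : 0 < c0)
    (hV : ContDiff ℝ ∞ V)
    (hV1 : ∀ z, 1 ≤ V z) (hVA : ∀ z ∈ O, c0 * V z ≤ hestonA σ ρ κ θ q r V z)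
    (hf : ContinuousOn f O) {C1 : ℝ}
    (h1 : Super σ ρ κ θ q r O V f G (fun z => C1 * V z))
    (h2 : Super σ ρ κ θ q r O V (fun z => -f z) (fun z => -G z) (fun z => C1 * V z)) :
    ∃ u : ℝ × ℝ → ℝ, Measurable u ∧ (∀ z, |u z| ≤ |C1| * V z) ∧
      (∀ φ ∈ Tst O, ∫ z, u z * Ast σ ρ κ θ q r φ z = ∫ z, f z * φ z) ∧
      (∀ w, Super σ ρ κ θ q r O V f G w → ∀ᵐ z ∂(volume.restrict O), u z ≤ w z) ∧
      (∀ w, Super σ ρ κ θ q r O V (fun z => -f z) (fun z => -G z) w →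
        ∀ᵐ z ∂(volume.restrict O), - w z ≤ u z) := by
  obtain ⟨k, kc, kpos, kL⟩ := exists_weight hV.continuous hV1
  have kne : ∀ z, k z ≠ 0 := fun z => (kpos z).ne'
  set μ : Measure (ℝ × ℝ) := volume.restrict O with hμ
  have mem : ∀ {w : ℝ × ℝ → ℝ}, ContDiff ℝ ∞ w → (∃ C, ∀ z ∈ O, |w z| ≤ C * V z) →
      MemLp (fun z => w z * k z) 2 μ := by
    rintro w hw ⟨C, hC⟩
    have kL' : MemLp (fun z => V z * k z) 2 μ := kL.restrict O
    apply (kL'.const_mul C).mono' (hw.continuous.mul kc).aestronglyMeasurable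
    filter_upwards [ae_restrict_mem hO.measurableSet] with z hz
    rw [Real.norm_eq_abs]; simp only [Pi.mul_apply]; rw [abs_mul, abs_of_pos (kpos z)]
    calc _ ≤ (C * V z) * k z := mul_le_mul_of_nonneg_right (hC z hz) (kpos z).le
      _ = _ := by ring
  have memT : ∀ φ ∈ Tst O, MemLp (fun z => Ast σ ρ κ θ q r φ z * (k z)⁻¹) 2 μ := by
    rintro φ ⟨hφ, hc, hs⟩
    apply MemLp.restrict
    apply Continuous.memLp_of_hasCompactSupport
    · exact (Ast_cont σ ρ κ θ q r hφ).mul (kc.inv₀ kne)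
    · exact (Ast_compact σ ρ κ θ q r hc).mul_right
  let T : Tst O →ₗ[ℝ] Lp ℝ 2 μ :=
    { toFun := fun φ => (memT φ.1 φ.2).toLp
      map_add' := fun φ ψ => by
        rw [← MemLp.toLp_add]
        congr 1; ext z
        have := Ast_lin σ ρ κ θ q r 1 1 φ.2.1 ψ.2.1 z
        simp only [one_mul] at this
        have e : Ast σ ρ κ θ q r ((φ + ψ : Tst O) : ℝ × ℝ → ℝ) z = _ := this
        simp only [Pi.add_apply]
        rw [e]; ring
      map_smul' := fun c φ => by
        simp only [RingHom.id_apply]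
        rw [← MemLp.toLp_const_smul]
        congr 1; ext z
        have := Ast_lin σ ρ κ θ q r c 0 φ.2.1 φ.2.1 z
        simp only [zero_mul, add_zero] at this
        have e : Ast σ ρ κ θ q r ((c • φ : Tst O) : ℝ × ℝ → ℝ) z = _ := this
        simp only [Pi.smul_apply, smul_eq_mul]
        rw [e]; ring }
  have intf : ∀ φ ∈ Tst O, Integrable (fun z => f z * φ z) := fun φ hφ =>
    (cont_mul hO hf hφ.1.continuous hφ.2.2).integrable_of_hasCompactSupport hφ.2.1.mul_left
  let l : Tst O →ₗ[ℝ] ℝ :=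
    { toFun := fun φ => ∫ z, f z * φ.1 z
      map_add' := fun φ ψ => by
        rw [← integral_add (intf _ φ.2) (intf _ ψ.2)]
        congr 1; ext z; simp only [Submodule.coe_add, Pi.add_apply]; ring
      map_smul' := fun c φ => by
        simp only [RingHom.id_apply, smul_eq_mul]
        rw [← integral_const_mul]
        congr 1; ext z; simp only [Submodule.coe_smul, Pi.smul_apply, smul_eq_mul]; ring }
  set P : Set (Lp ℝ 2 μ) := {p | ∃ w, Super σ ρ κ θ q r O V f G w ∧ p =ᵐ[μ] fun z => w z * k z}
    with hP
  set N : Set (Lp ℝ 2 μ) := {p | ∃ w, Super σ ρ κ θ q r O V (fun z => -f z) (fun z => -G z) w ∧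
    p =ᵐ[μ] fun z => - w z * k z} with hN
  have memP : ∀ {w}, (hw : Super σ ρ κ θ q r O V f G w) →
      (mem hw.smooth hw.growth).toLp ∈ P := fun hw => ⟨_, hw, MemLp.coeFn_toLp _⟩
  have growth_neg : ∀ {w : ℝ × ℝ → ℝ}, (∃ C, ∀ z ∈ O, |w z| ≤ C * V z) →
      ∃ C, ∀ z ∈ O, |-w z| ≤ C * V z := by
    rintro w ⟨C, hC⟩; exact ⟨C, fun z hz => by rw [abs_neg]; exact hC z hz⟩
  have memN : ∀ {w}, (hw : Super σ ρ κ θ q r O V (fun z => -f z) (fun z => -G z) w) →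
      (mem hw.smooth.neg (growth_neg hw.growth)).toLp ∈ N :=
    fun hw => ⟨_, hw, MemLp.coeFn_toLp _⟩
  have Vg : ∃ C, ∀ z ∈ O, |V z| ≤ C * V z := ⟨1, fun z _ => by
    rw [abs_of_nonneg (by linarith [hV1 z])]; linarith⟩
  set e : Lp ℝ 2 μ := (mem hV Vg).toLp with he
  have hee : e =ᵐ[μ] fun z => V z * k z := MemLp.coeFn_toLp _
  obtain ⟨v, hv1, hv2, hv3⟩ := abstract_HB T l P N ⟨_, memP h1⟩ ⟨_, memN h2⟩ e
    (by
      rintro p ⟨w, hw, hp⟩ n ⟨w', hw', hn⟩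
      rw [← Lp.coeFn_le]
      filter_upwards [hp, hn, ae_restrict_mem hO.measurableSet] with z a b hz
      rw [a, b]
      have := hw.dom z hz
      have := hw'.dom z hz
      exact mul_le_mul_of_nonneg_right (by linarith) (kpos z).le)
    (by
      rintro p ⟨w, hw, hp⟩ p' ⟨w', hw', hp'⟩ ε hε
      obtain ⟨w3, hw3, h3⟩ := super_min hρ₁ hρ₂ hr hOsub hc0 hV hV1 hVA hw hw' hε
      refine ⟨_, memP hw3, ?_, ?_⟩
      · rw [← Lp.coeFn_le]
        filter_upwards [hp, hee, MemLp.coeFn_toLp (mem hw3.smooth hw3.growth),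
          Lp.coeFn_add p (ε • e), Lp.coeFn_smul ε e] with z a b c d d'
        rw [c, d, Pi.add_apply, d', Pi.smul_apply, a, b, smul_eq_mul]
        nlinarith [mul_le_mul_of_nonneg_right (h3 z).1 (kpos z).le]
      · rw [← Lp.coeFn_le]
        filter_upwards [hp', hee, MemLp.coeFn_toLp (mem hw3.smooth hw3.growth),
          Lp.coeFn_add p' (ε • e), Lp.coeFn_smul ε e] with z a b c d d'
        rw [c, d, Pi.add_apply, d', Pi.smul_apply, a, b, smul_eq_mul]
        nlinarith [mul_le_mul_of_nonneg_right (h3 z).2 (kpos z).le])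
    (by
      rintro p ⟨w, hw, hp⟩ p' ⟨w', hw', hp'⟩ ε hε
      obtain ⟨w3, hw3, h3⟩ := super_min hρ₁ hρ₂ hr hOsub hc0 hV hV1 hVA hw hw' hε
      refine ⟨_, memN hw3, ?_, ?_⟩
      · rw [← Lp.coeFn_le]
        filter_upwards [hp, hee, MemLp.coeFn_toLp (mem hw3.smooth.neg (growth_neg hw3.growth)),
          Lp.coeFn_add (mem hw3.smooth.neg (growth_neg hw3.growth)).toLp (ε • e),
          Lp.coeFn_smul ε e] with z a b c d d'
        rw [d, Pi.add_apply, d', Pi.smul_apply, a, b, c, smul_eq_mul]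
        nlinarith [mul_le_mul_of_nonneg_right (h3 z).1 (kpos z).le]
      · rw [← Lp.coeFn_le]
        filter_upwards [hp', hee, MemLp.coeFn_toLp (mem hw3.smooth.neg (growth_neg hw3.growth)),
          Lp.coeFn_add (mem hw3.smooth.neg (growth_neg hw3.growth)).toLp (ε • e),
          Lp.coeFn_smul ε e] with z a b c d d'
        rw [d, Pi.add_apply, d', Pi.smul_apply, a, b, c, smul_eq_mul]
        nlinarith [mul_le_mul_of_nonneg_right (h3 z).2 (kpos z).le])
    (by
      rintro ⟨φ, hφ⟩ p ⟨w, hw, hp⟩ n ⟨w', hw', hn⟩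
      have hT : T ⟨φ, hφ⟩ =ᵐ[μ] fun z => Ast σ ρ κ θ q r φ z * (k z)⁻¹ :=
        MemLp.coeFn_toLp (memT φ hφ)
      have hd := dominate (q := q) hρ₁ hρ₂ hO hOsub hf hw.smooth hw'.smooth.neg hw.super
        (fun z hz => by
          have := hw'.super z hz
          rw [hestonA_neg _ _ _ _ _ _ hw'.smooth]; linarith)
        (fun z hz => by
          have := hw.dom z hz
          have := hw'.dom z hz
          linarith) hφ.1 hφ.2.1 hφ.2.2
      refine hd.trans (le_of_eq ?_)
      rw [← setIntegral_eq_integral_of_forall_compl_eq_zero (s := O)]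
      · rw [L2.inner_def, L2.inner_def, ← integral_sub (L2.integrable_inner _ _)
          (L2.integrable_inner _ _)]
        apply integral_congr_ae
        filter_upwards [hT, L2_pos_coe (T ⟨φ, hφ⟩), L2_neg_coe (T ⟨φ, hφ⟩), hp, hn] with z a b c d e
        simp only [RCLike.inner_apply, conj_trivial]
        rw [b, c, d, e, a]
        have e1 : max (Ast σ ρ κ θ q r φ z * (k z)⁻¹) 0 = max (Ast σ ρ κ θ q r φ z) 0 * (k z)⁻¹ := by
          rw [max_mul_of_nonneg _ _ (inv_nonneg.2 (kpos z).le), zero_mul]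
        have e2 : max (-(Ast σ ρ κ θ q r φ z * (k z)⁻¹)) 0
            = max (-Ast σ ρ κ θ q r φ z) 0 * (k z)⁻¹ := by
          rw [max_mul_of_nonneg _ _ (inv_nonneg.2 (kpos z).le), zero_mul, neg_mul]
        rw [e1, e2]
        have := kne z
        field_simp
      · intro z hz
        have : Ast σ ρ κ θ q r φ z = 0 := image_eq_zero_of_notMem_tsupport
          fun h => hz (hφ.2.2 (Ast_tsupport σ ρ κ θ q r h))
        simp [this])
  set u0 : ℝ × ℝ → ℝ := fun z => v z * (k z)⁻¹ with hu0
  have u0m : Measurable u0 := (Lp.stronglyMeasurable v).measurable.mul kc.measurable.inv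
  have up : ∀ w, Super σ ρ κ θ q r O V f G w → ∀ᵐ z ∂μ, u0 z ≤ w z := by
    intro w hw
    have := hv2 _ (memP hw)
    rw [← Lp.coeFn_le] at this
    filter_upwards [this, MemLp.coeFn_toLp (mem hw.smooth hw.growth)] with z a b
    rw [b] at a
    rw [hu0]; exact (mul_inv_le_iff₀ (kpos z)).2 a
  have dn : ∀ w, Super σ ρ κ θ q r O V (fun z => -f z) (fun z => -G z) w →
      ∀ᵐ z ∂μ, - w z ≤ u0 z := by
    intro w hw
    have := hv3 _ (memN hw)
    rw [← Lp.coeFn_le] at this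
    filter_upwards [this, MemLp.coeFn_toLp (mem hw.smooth.neg (growth_neg hw.growth))] with z a b
    rw [b] at a
    rw [hu0]; exact (le_mul_inv_iff₀ (kpos z)).2 a
  set u : ℝ × ℝ → ℝ := fun z => max (-(|C1| * V z)) (min (|C1| * V z) (u0 z)) with hu
  have um : Measurable u := by
    have := hV.continuous.measurable
    fun_prop
  have hbd : ∀ z, C1 * V z ≤ |C1| * V z := fun z =>
    mul_le_mul_of_nonneg_right (le_abs_self C1) (by linarith [hV1 z])
  have huu : u0 =ᵐ[μ] u := by
    filter_upwards [up _ h1, dn _ h2] with z a b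
    have := hbd z
    simp only [hu]; rw [min_eq_right (by linarith), max_eq_right (by linarith)]
  refine ⟨u, um, ?_, ?_, ?_, ?_⟩
  · intro z
    have : 0 ≤ |C1| * V z := mul_nonneg (abs_nonneg _) (by linarith [hV1 z])
    rw [abs_le]; constructor
    · exact le_max_left _ _
    · exact max_le (by linarith) (min_le_left _ _)
  · intro φ hφ
    rw [← setIntegral_eq_integral_of_forall_compl_eq_zero (s := O)]
    · have h3 := hv1 ⟨φ, hφ⟩
      refine Eq.trans ?_ h3
      rw [L2.inner_def]
      apply integral_congr_ae
      filter_upwards [huu, MemLp.coeFn_toLp (memT φ hφ)] with z a b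
      have : (T ⟨φ, hφ⟩) z = _ := b
      simp only [RCLike.inner_apply, conj_trivial]
      rw [← a, this]; simp only [hu0]; ring
    · intro z hz
      have : Ast σ ρ κ θ q r φ z = 0 := image_eq_zero_of_notMem_tsupport
          fun h => hz (hφ.2.2 (Ast_tsupport σ ρ κ θ q r h))
      simp [this]
  · intro w hw; filter_upwards [up w hw, huu] with z a b; rw [← b]; exact a
  · intro w hw; filter_upwards [dn w hw, huu] with z a b; rw [← b]; exact a

/-- dyadic powers -/
def pw (a : ℝ) (n : ℕ) : ℝ := (2 : ℝ) ^ (-(a * n))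

theorem pw_pos (a : ℝ) (n : ℕ) : 0 < pw a n := by unfold pw; positivity
theorem pw_add (a b : ℝ) (n : ℕ) : pw (a + b) n = pw a n * pw b n := by
  unfold pw; rw [← Real.rpow_add (by norm_num)]; congr 1; ring
theorem pw_mono {a b : ℝ} (h : b ≤ a) (n : ℕ) : pw a n ≤ pw b n := by
  unfold pw; apply Real.rpow_le_rpow_of_exponent_le (by norm_num)
  have : b * n ≤ a * n := mul_le_mul_of_nonneg_right h (Nat.cast_nonneg n)
  linarith
theorem pw_neg_one (n : ℕ) : pw (-1) n = (2 : ℝ) ^ n := by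
  unfold pw; simp
theorem pw_zero (n : ℕ) : pw 0 n = 1 := by unfold pw; simp
theorem pw_at_zero (a : ℝ) : pw a 0 = 1 := by unfold pw; simp
theorem pw_eq_pow (a : ℝ) (n : ℕ) : pw a n = ((2 : ℝ) ^ (-a)) ^ n := by
  unfold pw; rw [← Real.rpow_natCast, ← Real.rpow_mul (by norm_num)]; congr 1; ring
theorem pw_summable {a : ℝ} (ha : 0 < a) : Summable (pw a) := by
  have : pw a = fun n : ℕ => ((2 : ℝ) ^ (-a)) ^ n := funext (pw_eq_pow a)
  rw [this]
  apply summable_geometric_of_lt_one (by positivity)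
  exact Real.rpow_lt_one_of_one_lt_of_neg (by norm_num) (by linarith)

/-- essentially bounded measurable functions -/
def BM (h : ℝ × ℝ → ℝ) : Prop :=
  AEStronglyMeasurable h volume ∧ ∃ M, ∀ᵐ z, |h z| ≤ M

theorem BM.locInt {h : ℝ × ℝ → ℝ} (hh : BM h) : LocallyIntegrable h := by
  obtain ⟨M, hM⟩ := hh.2
  exact (memLp_top_of_bound hh.1 M hM).locallyIntegrable le_top

theorem BM.int_mul {h φ : ℝ × ℝ → ℝ} (hh : BM h) (hφ : Continuous φ) (hc : HasCompactSupport φ) :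
    Integrable (fun z => h z * φ z) := by
  obtain ⟨M, hM⟩ := hh.2
  exact (hφ.integrable_of_hasCompactSupport hc).bdd_mul hh.1 hM

/-- test kernels -/
structure Ker (K : ℝ × ℝ → ℝ) : Prop where
  smooth : ContDiff ℝ ∞ K
  cpt : HasCompactSupport K

theorem Ker.dd {K : ℝ × ℝ → ℝ} (hK : Ker K) (v : ℝ × ℝ) : Ker (dd v K) :=
  ⟨dd_contDiff hK.smooth, dd_compact hK.cpt⟩

/-- rescaled kernel -/
def scl (K : ℝ × ℝ → ℝ) (n : ℕ) : ℝ × ℝ → ℝ := fun z => (4 : ℝ) ^ n * K ((2 : ℝ) ^ n • z)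

/-- dyadic averages -/
def J (K : ℝ × ℝ → ℝ) (n : ℕ) (h : ℝ × ℝ → ℝ) (z : ℝ × ℝ) : ℝ :=
  ∫ w, h w * scl K n (z - w)

theorem two_pow_ne (n : ℕ) : (2 : ℝ) ^ n ≠ 0 := by positivity

theorem scl_ker {K : ℝ × ℝ → ℝ} (hK : Ker K) (n : ℕ) : Ker (scl K n) := by
  refine ⟨?_, ?_⟩
  · have := hK.smooth
    unfold scl
    exact contDiff_const.mul (this.comp (contDiff_const_smul _))
  · exact (hK.cpt.comp_smul (two_pow_ne n)).mul_left

theorem scl_dd {K : ℝ × ℝ → ℝ} (hK : Ker K) (n : ℕ) (v : ℝ × ℝ) :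
    dd v (scl K n) = fun z => (2 : ℝ) ^ n * scl (dd v K) n z := by
  ext z
  have hd := smooth_diff hK.smooth
  have h1 : HasFDerivAt (fun z : ℝ × ℝ => (2 : ℝ) ^ n • z)
      ((2 : ℝ) ^ n • ContinuousLinearMap.id ℝ (ℝ × ℝ)) z :=
    ((2 : ℝ) ^ n • ContinuousLinearMap.id ℝ (ℝ × ℝ)).hasFDerivAt
  have h2 := ((hd ((2 : ℝ) ^ n • z)).hasFDerivAt.comp z h1).const_mul ((4 : ℝ) ^ n)
  have h3 : dd v (scl K n) z = _ := congrArg (fun L => L v) h2.fderiv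
  rw [h3]
  simp [scl, dd]; ring

theorem integral_scl (k : ℝ × ℝ → ℝ) (n : ℕ) (z : ℝ × ℝ) :
    ∫ w, scl k n (z - w) = ∫ w, k w := by
  rw [integral_sub_left_eq_self (scl k n) volume z]
  simp only [scl]
  rw [integral_const_mul, Measure.integral_comp_smul]
  simp only [Module.finrank_prod, Module.finrank_self, smul_eq_mul]
  rw [abs_of_pos (by positivity), ← mul_assoc, ← pow_mul, mul_comm n, pow_mul]
  norm_num

theorem J_contDiff {K h : ℝ × ℝ → ℝ} (hK : Ker K) (hh : BM h) (n : ℕ) :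
    ContDiff ℝ ∞ (J K n h) :=
  (scl_ker hK n).cpt.contDiff_convolution_right (ContinuousLinearMap.mul ℝ ℝ) hh.locInt
    (scl_ker hK n).smooth

theorem J_dd {K h : ℝ × ℝ → ℝ} (hK : Ker K) (hh : BM h) (n : ℕ) (v : ℝ × ℝ) :
    dd v (J K n h) = fun z => (2 : ℝ) ^ n * J (dd v K) n h z := by
  ext z
  have k := scl_ker hK n
  have h1 := k.cpt.hasFDerivAt_convolution_right (ContinuousLinearMap.mul ℝ ℝ) hh.locInt
    (contDiff_infty.1 k.smooth 1) z
  have h2 : dd v (J K n h) z = _ := congrArg (fun L => L v) h1.fderiv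
  rw [h2]
  rw [convolution_precompR_apply _ hh.locInt (k.cpt.fderiv ℝ)
    ((contDiff_infty.1 k.smooth 1).continuous_fderiv (by simp))]
  have h3 : (fun a => fderiv ℝ (scl K n) a v) = fun z => (2 : ℝ) ^ n * scl (dd v K) n z :=
    scl_dd hK n v
  rw [h3]
  simp only [convolution, J, ContinuousLinearMap.mul_apply']
  rw [← integral_const_mul]
  congr 1; ext w; ring

theorem scl_int {k : ℝ × ℝ → ℝ} (hk : Continuous k) (hc : HasCompactSupport k) (n : ℕ) (z : ℝ × ℝ) :
    Integrable (fun w => scl k n (z - w)) := by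
  apply Integrable.comp_sub_left (f := scl k n)
  apply Continuous.integrable_of_hasCompactSupport
  · unfold scl; fun_prop
  · exact (hc.comp_smul (two_pow_ne n)).mul_left

theorem J_int {K h : ℝ × ℝ → ℝ} (hK : Ker K) (hh : BM h) (n : ℕ) (z : ℝ × ℝ) :
    Integrable (fun w => h w * scl K n (z - w)) := by
  obtain ⟨M, hM⟩ := hh.2
  exact (scl_int hK.smooth.continuous hK.cpt n z).bdd_mul hh.1 hM

theorem J_bound {K h : ℝ × ℝ → ℝ} (hK : Ker K) (hh : BM h) :
    ∃ C, ∀ n z, |J K n h z| ≤ C := by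
  obtain ⟨M, hM⟩ := hh.2
  refine ⟨M * ∫ w, |K w|, fun n z => ?_⟩
  rw [← integral_scl (fun w => |K w|) n z, ← integral_const_mul]
  rw [← Real.norm_eq_abs, J]
  apply norm_integral_le_of_norm_le
  · exact (scl_int hK.smooth.continuous.abs hK.cpt.norm n z).const_mul M
  · filter_upwards [hM] with w hw
    simp only [scl]
    rw [Real.norm_eq_abs, abs_mul, abs_mul, abs_of_pos (by positivity : (0 : ℝ) < 4 ^ n)]
    gcongr

/-- globally bounded and Hölder functions -/
def Hol (α : ℝ) (h : ℝ × ℝ → ℝ) : Prop :=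
  (∃ M, ∀ z, |h z| ≤ M) ∧ ∃ C, 0 ≤ C ∧ ∀ z w, |h z - h w| ≤ C * dist z w ^ α

theorem Hol.cont {α : ℝ} (hα : 0 < α) {h : ℝ × ℝ → ℝ} (hh : Hol α h) : Continuous h := by
  obtain ⟨_, C, hC0, hC⟩ := hh
  have : HolderWith C.toNNReal α.toNNReal h := by
    intro z w
    rw [edist_dist, edist_dist, Real.dist_eq, Real.coe_toNNReal _ hα.le,
      ENNReal.ofReal_rpow_of_nonneg dist_nonneg hα.le, ← ENNReal.ofReal_coe_nnreal,
      ← ENNReal.ofReal_mul (by positivity), Real.coe_toNNReal _ hC0]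
    exact ENNReal.ofReal_le_ofReal (hC z w)
  exact this.continuous (by simpa using hα)

theorem Hol.bm {α : ℝ} (hα : 0 < α) {h : ℝ × ℝ → ℝ} (hh : Hol α h) : BM h :=
  ⟨(hh.cont hα).aestronglyMeasurable, hh.1.imp fun _ hM => Filter.Eventually.of_forall hM⟩

theorem J_holder {α : ℝ} (hα : 0 < α) {K h : ℝ × ℝ → ℝ} (hK : Ker K) (hh : Hol α h)
    (hK0 : ∫ w, K w = 0) : ∃ C, ∀ n z, |J K n h z| ≤ C * pw α n := by
  obtain ⟨C, hC0, hC⟩ := hh.2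
  have hb := hh.bm hα
  set k : ℝ × ℝ → ℝ := fun v => ‖v‖ ^ α * |K v| with hk
  have kc : Continuous k :=
    (continuous_norm.rpow_const (fun _ => Or.inr hα.le)).mul hK.smooth.continuous.abs
  have ks : HasCompactSupport k := hK.cpt.norm.mul_left
  refine ⟨C * ∫ w, k w, fun n z => ?_⟩
  have e1 : J K n h z = ∫ w, (h w - h z) * scl K n (z - w) := by
    have : ∫ w, h z * scl K n (z - w) = 0 := by
      rw [integral_const_mul, integral_scl, hK0, mul_zero]
    simp only [sub_mul]
    rw [integral_sub (J_int hK hb n z) ((scl_int hK.smooth.continuous hK.cpt n z).const_mul _),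
      this, sub_zero, J]
  rw [e1, ← integral_scl k n z, mul_right_comm, ← integral_const_mul]
  rw [← Real.norm_eq_abs]
  apply norm_integral_le_of_norm_le
  · exact (scl_int kc ks n z).const_mul _
  · refine Filter.Eventually.of_forall fun w => ?_
    simp only [scl, hk]
    rw [Real.norm_eq_abs, abs_mul, abs_mul, abs_of_pos (by positivity : (0 : ℝ) < 4 ^ n)]
    have h1 := hC w z
    have h2 : ‖(2 : ℝ) ^ n • (z - w)‖ ^ α * pw α n = dist w z ^ α := by
      rw [norm_smul, ← dist_eq_norm, dist_comm, Real.norm_of_nonneg (by positivity),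
        Real.mul_rpow (by positivity) dist_nonneg, mul_right_comm]
      have : ((2 : ℝ) ^ n) ^ α * pw α n = 1 := by
        unfold pw
        rw [← Real.rpow_natCast, ← Real.rpow_mul (by norm_num), ← Real.rpow_add (by norm_num)]
        rw [show (n : ℝ) * α + -(α * n) = 0 by ring, Real.rpow_zero]
      rw [this, one_mul]
    rw [← h2] at h1
    calc _ ≤ (C * (‖(2 : ℝ) ^ n • (z - w)‖ ^ α * pw α n)) * (4 ^ n * |K ((2 : ℝ) ^ n • (z - w))|) := by
          gcongr
      _ = _ := by ring

/-- order of decay of a sequence of functions -/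
def OrdD (a : ℝ) (s : ℕ → ℝ × ℝ → ℝ) : Prop := ∃ C, 0 ≤ C ∧ ∀ n z, |s n z| ≤ C * pw a n

theorem OrdD.of_le {a : ℝ} {s : ℕ → ℝ × ℝ → ℝ} (h : ∃ C, ∀ n z, |s n z| ≤ C * pw a n) : OrdD a s := by
  obtain ⟨C, hC⟩ := h
  exact ⟨|C|, abs_nonneg _, fun n z => (hC n z).trans
    (mul_le_mul_of_nonneg_right (le_abs_self _) (pw_pos a n).le)⟩

theorem OrdD.add {a : ℝ} {s t : ℕ → ℝ × ℝ → ℝ} (hs : OrdD a s) (ht : OrdD a t) :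
    OrdD a (fun n z => s n z + t n z) := by
  obtain ⟨C, h0, hC⟩ := hs
  obtain ⟨D, h0', hD⟩ := ht
  refine ⟨C + D, by positivity, fun n z => (abs_add_le _ _).trans ?_⟩
  linarith [hC n z, hD n z]

theorem OrdD.mono {a b : ℝ} (hab : b ≤ a) {s : ℕ → ℝ × ℝ → ℝ} (hs : OrdD a s) : OrdD b s := by
  obtain ⟨C, h0, hC⟩ := hs
  exact ⟨C, h0, fun n z => (hC n z).trans (mul_le_mul_of_nonneg_left (pw_mono hab n) h0)⟩

/-- weighted dyadic averages -/
def TT (c : ℝ) (K h : ℝ × ℝ → ℝ) (n : ℕ) (z : ℝ × ℝ) : ℝ := pw c n * J K n h z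

/-- initial term -/
def T0 (K h : ℝ × ℝ → ℝ) (n : ℕ) (z : ℝ × ℝ) : ℝ := if n = 0 then J K 0 h z else 0

theorem TT_smooth {K h : ℝ × ℝ → ℝ} (c : ℝ) (hK : Ker K) (hh : BM h) (n : ℕ) :
    ContDiff ℝ ∞ (TT c K h n) := contDiff_const.mul (J_contDiff hK hh n)

theorem TT_dd {K h : ℝ × ℝ → ℝ} (c : ℝ) (hK : Ker K) (hh : BM h) (n : ℕ) (v : ℝ × ℝ) :
    dd v (TT c K h n) = TT (c - 1) (dd v K) h n := by
  ext z
  unfold TT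
  rw [dd_const_mul _ (smooth_diff (J_contDiff hK hh n) z), J_dd hK hh, sub_eq_add_neg, pw_add,
    pw_neg_one]; ring

theorem TT_ord {K h : ℝ × ℝ → ℝ} (c : ℝ) (hK : Ker K) (hh : BM h) : OrdD c (TT c K h) := by
  obtain ⟨C, hC⟩ := J_bound hK hh
  apply OrdD.of_le ⟨C, fun n z => ?_⟩
  unfold TT
  rw [abs_mul, abs_of_pos (pw_pos c n), mul_comm]
  exact mul_le_mul_of_nonneg_right (hC n z) (pw_pos c n).le

theorem TT_ord_holder {α : ℝ} (hα : 0 < α) {K h : ℝ × ℝ → ℝ} (c : ℝ) (hK : Ker K) (hh : Hol α h)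
    (v : ℝ × ℝ) : OrdD (c + α) (TT c (dd v K) h) := by
  obtain ⟨C, hC⟩ := J_holder hα (hK.dd v) hh (integral_dd_zero hK.smooth hK.cpt)
  apply OrdD.of_le ⟨C, fun n z => ?_⟩
  unfold TT
  rw [abs_mul, abs_of_pos (pw_pos c n), pw_add]
  calc _ ≤ pw c n * (C * pw α n) := mul_le_mul_of_nonneg_left (hC n z) (pw_pos c n).le
    _ = _ := by ring

theorem T0_smooth {K h : ℝ × ℝ → ℝ} (hK : Ker K) (hh : BM h) (n : ℕ) :
    ContDiff ℝ ∞ (T0 K h n) := by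
  unfold T0
  split_ifs
  · exact J_contDiff hK hh 0
  · exact contDiff_const

theorem T0_dd {K h : ℝ × ℝ → ℝ} (hK : Ker K) (hh : BM h) (n : ℕ) (v : ℝ × ℝ) :
    dd v (T0 K h n) = T0 (dd v K) h n := by
  ext z
  unfold T0
  split_ifs
  · have := congrFun (J_dd hK hh 0 v) z
    simpa using this
  · exact dd_const 0

theorem T0_ord {K h : ℝ × ℝ → ℝ} (a : ℝ) (hK : Ker K) (hh : BM h) : OrdD a (T0 K h) := by
  obtain ⟨C, hC⟩ := J_bound hK hh
  apply OrdD.of_le ⟨|C|, fun n z => ?_⟩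
  unfold T0
  split_ifs with h
  · subst h; rw [pw_at_zero, mul_one]; exact (hC 0 z).trans (le_abs_self C)
  · simp only [abs_zero]; exact mul_nonneg (abs_nonneg _) (pw_pos a n).le

theorem one_dim_kernel : ∃ (ζ ψ ℓ : ℝ → ℝ), ContDiff ℝ ∞ ζ ∧ ContDiff ℝ ∞ ψ ∧ ContDiff ℝ ∞ ℓ ∧
    (∀ t, HasDerivAt ℓ (ψ t) t) ∧ (∀ t, t * ψ t = ζ t) ∧ Monotone ζ ∧ ζ 0 = 0 ∧
    (∀ t, 1 ≤ t → ζ t = 1) ∧ (∀ t, 1 ≤ t → ℓ t = Real.log t) := by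
  set ζ : ℝ → ℝ := fun t => Real.smoothTransition (2 * t - 1) with hζ
  set ψ : ℝ → ℝ := fun t => ζ t / t with hψ
  have sζ : ContDiff ℝ ∞ ζ := by
    have h1 : ContDiff ℝ ∞ (fun t : ℝ => 2 * t - 1) := by fun_prop
    exact (Real.smoothTransition.contDiff (n := ⊤)).comp h1
  have z0 : ∀ t ≤ (1/2 : ℝ), ζ t = 0 := fun t ht => by
    rw [hζ]; exact Real.smoothTransition.zero_of_nonpos (by linarith)
  have z1 : ∀ t, 1 ≤ t → ζ t = 1 := fun t ht => by
    rw [hζ]; exact Real.smoothTransition.one_of_one_le (by linarith)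
  have sψ : ContDiff ℝ ∞ ψ := by
    rw [contDiff_iff_contDiffAt]
    intro t
    by_cases ht : t = 0
    · have : ψ =ᶠ[𝓝 t] fun _ => 0 := by
        filter_upwards [Iio_mem_nhds (show t < 1/2 by rw [ht]; norm_num)] with s hs
        simp only [hψ]; rw [z0 s (le_of_lt hs), zero_div]
      exact contDiffAt_const.congr_of_eventuallyEq this
    · exact sζ.contDiffAt.div contDiffAt_id ht
  set ℓ : ℝ → ℝ := fun s => ∫ t in (1:ℝ)..s, ψ t with hℓ
  have dℓ : ∀ t, HasDerivAt ℓ (ψ t) t := fun t =>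
    intervalIntegral.integral_hasDerivAt_right (sψ.continuous.intervalIntegrable _ _)
      (sψ.continuous.stronglyMeasurableAtFilter _ _) sψ.continuous.continuousAt
  refine ⟨ζ, ψ, ℓ, sζ, sψ, ?_, dℓ, ?_, ?_, z0 0 (by norm_num), z1, ?_⟩
  · rw [contDiff_infty_iff_deriv]
    refine ⟨fun t => (dℓ t).differentiableAt, ?_⟩
    rw [show deriv ℓ = ψ from funext fun t => (dℓ t).deriv]; exact sψ
  · intro t
    by_cases ht : t = 0
    · rw [ht, z0 0 (by norm_num), zero_mul]
    · simp only [hψ]; field_simp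
  · intro s t hst
    exact Real.smoothTransition.monotone (by linarith)
  · intro t ht
    simp only [hℓ]
    rw [intervalIntegral.integral_congr (g := fun s => s⁻¹)]
    · rw [integral_inv_of_pos (by norm_num) (by linarith), div_one]
    · intro s hs
      rw [uIcc_of_le ht] at hs
      simp only [hψ]; rw [z1 s hs.1, one_div]

theorem kernel_exists {σ ρ : ℝ} (hσ : σ ≠ 0) (hρ₁ : -1 < ρ) (hρ₂ : ρ < 1) :
    ∃ η Ψ : ℝ × ℝ → ℝ, Ker η ∧ Ker Ψ ∧ ∫ z, η z = 1 ∧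
      ∀ z, PP σ ρ Ψ z = 4 * η ((2 : ℝ) • z) - η z := by
  obtain ⟨ζ, ψ, ℓ, sζ, sψ, sℓ, dℓ, hψ, mζ, ζ0, ζ1, ℓ1⟩ := one_dim_kernel
  have hσ2 : 0 < σ ^ 2 := by positivity
  have hρ : 0 < 1 - ρ ^ 2 := by nlinarith
  set d := σ ^ 2 * (1 - ρ ^ 2) with hd
  have dpos : 0 < d := by positivity
  set Q : ℝ × ℝ → ℝ := fun z => (σ ^ 2 / d) * (z.1 * z.1) - (2 * ρ * σ / d) * (z.1 * z.2)
    + (1 / d) * (z.2 * z.2) with hQ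
  have sQ : ContDiff ℝ ∞ Q := by fun_prop
  have hf := smooth_fst
  have hs := smooth_snd
  have Qx : dx Q = fun z => (2 * σ ^ 2 / d) * z.1 - (2 * ρ * σ / d) * z.2 := by
    ext z
    simp only [hQ]
    simp (disch := fun_prop) only [dd_add, dd_sub, dd_mul, dd_const, dx_snd, dy_snd, dx_fst, dy_fst]
    ring
  have Qy : dy Q = fun z => (2 / d) * z.2 - (2 * ρ * σ / d) * z.1 := by
    ext z
    simp only [hQ]
    simp (disch := fun_prop) only [dd_add, dd_sub, dd_mul, dd_const, dx_snd, dy_snd, dx_fst, dy_fst]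
    ring
  have PQ : ∀ z, PP σ ρ Q z = 4 := by
    intro z
    simp only [PP]
    rw [Qx, Qy]
    simp (disch := fun_prop) only [dd_sub, dd_mul, dd_const, dx_snd, dy_snd, dx_fst, dy_fst]
    rw [hd]; field_simp; ring
  have GQ : ∀ z, dx Q z ^ 2 + 2 * ρ * σ * dx Q z * dy Q z + σ ^ 2 * dy Q z ^ 2 = 4 * Q z := by
    intro z
    rw [Qx, Qy]
    simp only [hQ]
    rw [hd]; field_simp; ring
  have Q1 : ∀ z, z.1 ^ 2 ≤ Q z := by
    intro z
    have : Q z - z.1 ^ 2 = (z.2 - ρ * σ * z.1) ^ 2 / d := by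
      simp only [hQ]; rw [hd]; field_simp; ring
    have h2 : 0 ≤ (z.2 - ρ * σ * z.1) ^ 2 / d := by positivity
    linarith
  have Q2 : ∀ z, z.2 ^ 2 / σ ^ 2 ≤ Q z := by
    intro z
    have : Q z - z.2 ^ 2 / σ ^ 2 = (σ * z.1 - ρ * z.2) ^ 2 / d := by
      simp only [hQ]; rw [hd]; field_simp; ring
    have h2 : 0 ≤ (σ * z.1 - ρ * z.2) ^ 2 / d := by positivity
    linarith
  have Qs : ∀ z, Q ((2 : ℝ) • z) = 4 * Q z := by
    intro z; simp only [hQ, Prod.smul_fst, Prod.smul_snd, smul_eq_mul]; ring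
  have Qbig : ∀ z, z ∉ Metric.closedBall (0 : ℝ × ℝ) (1 + |σ|) → 1 < Q z := by
    intro z hz
    by_contra hq
    push Not at hq
    apply hz
    rw [mem_closedBall_zero_iff, Prod.norm_def, max_le_iff, Real.norm_eq_abs, Real.norm_eq_abs]
    have h1 : |z.1| ≤ 1 := abs_le_one_iff_mul_self_le_one.2 (by nlinarith [Q1 z])
    have h2 : |z.2| ≤ |σ| := by
      apply sq_le_sq.1
      have := (Q2 z).trans hq
      rwa [div_le_one hσ2] at this
    exact ⟨by linarith [abs_nonneg σ], by linarith⟩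
  set L : ℝ × ℝ → ℝ := fun z => ℓ (Q z) with hL
  have sL : ContDiff ℝ ∞ L := sℓ.comp sQ
  have dψ : ∀ t, HasDerivAt ψ (deriv ψ t) t := fun t =>
    ((sψ.differentiable (by simp)) t).hasDerivAt
  have dζ : ∀ t, HasDerivAt ζ (deriv ζ t) t := fun t =>
    ((sζ.differentiable (by simp)) t).hasDerivAt
  have eζ : ∀ t, deriv ζ t = ψ t + t * deriv ψ t := by
    intro t
    have h1 : HasDerivAt (fun t => t * ψ t) (1 * ψ t + t * deriv ψ t) t :=
      (hasDerivAt_id t).mul (dψ t)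
    rw [show (fun t => t * ψ t) = ζ from funext hψ] at h1
    rw [h1.deriv, one_mul]
  set η0 : ℝ × ℝ → ℝ := fun z => 4 * deriv ζ (Q z) with hη0
  have PL : ∀ z, PP σ ρ L z = η0 z := by
    intro z
    simp only [hL, hη0]
    rw [PP_comp σ ρ dℓ dψ sQ z, PQ, GQ, eζ]; ring
  have sdζ : ContDiff ℝ ∞ (deriv ζ) := (contDiff_infty_iff_deriv.1 sζ).2
  have sη0 : ContDiff ℝ ∞ η0 := contDiff_const.mul (sdζ.comp sQ)
  have dζ1 : ∀ t, 1 < t → deriv ζ t = 0 := by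
    intro t ht
    have : ζ =ᶠ[𝓝 t] fun _ => 1 := by
      filter_upwards [Ioi_mem_nhds ht] with s hs using ζ1 s (le_of_lt hs)
    rw [this.deriv_eq]; simp
  have cη0 : HasCompactSupport η0 :=
    HasCompactSupport.intro (isCompact_closedBall _ _) fun z hz => by
      simp only [hη0]; rw [dζ1 _ (Qbig z hz), mul_zero]
  obtain ⟨c, hc, hc1⟩ := exists_deriv_eq_slope ζ (by norm_num : (0:ℝ) < 1)
    sζ.continuous.continuousOn (fun t _ => (dζ t).differentiableAt.differentiableWithinAt)
  have hm : 0 < ∫ z, η0 z := by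
    apply Continuous.integral_pos_of_hasCompactSupport_nonneg_nonzero
      (x := (0, Real.sqrt (c * d))) sη0.continuous cη0
    · intro z
      simp only [hη0, Pi.zero_apply]
      have : 0 ≤ deriv ζ (Q z) := mζ.deriv_nonneg
      positivity
    · have : Q (0, Real.sqrt (c * d)) = c := by
        simp only [hQ]
        rw [Real.mul_self_sqrt (mul_nonneg hc.1.le dpos.le)]
        field_simp; ring
      simp only [hη0]
      rw [this, hc1, ζ1 1 le_rfl, ζ0]; norm_num
  set m := ∫ z, η0 z with hmdef
  have e2 : ContDiff ℝ ∞ (fun z : ℝ × ℝ => L ((2 : ℝ) • z)) := sL.comp (contDiff_const_smul _)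
  have dL2 : ∀ (G : ℝ × ℝ → ℝ), ContDiff ℝ ∞ G → ∀ v,
      dd v (fun z : ℝ × ℝ => G ((2 : ℝ) • z)) = fun z => 2 * dd v G ((2 : ℝ) • z) := by
    intro G hG v
    ext z
    have h1 : HasFDerivAt (fun z : ℝ × ℝ => (2 : ℝ) • z)
      ((2 : ℝ) • ContinuousLinearMap.id ℝ (ℝ × ℝ)) z :=
      ((2 : ℝ) • ContinuousLinearMap.id ℝ (ℝ × ℝ)).hasFDerivAt
    have h2 := ((smooth_diff hG ((2 : ℝ) • z)).hasFDerivAt.comp z h1)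
    have h3 : dd v (fun z : ℝ × ℝ => G ((2 : ℝ) • z)) z = _ := congrArg (fun L => L v) h2.fderiv
    rw [h3]
    simp [dd]
  refine ⟨fun z => η0 z / m, fun z => m⁻¹ * (L ((2 : ℝ) • z) - L z - Real.log 4), ⟨?_, ?_⟩, ⟨?_, ?_⟩,
    ?_, ?_⟩
  · exact sη0.div_const _
  · refine HasCompactSupport.intro cη0 fun z hz => ?_
    show η0 z / m = 0
    rw [image_eq_zero_of_notMem_tsupport hz, zero_div]
  · fun_prop
  · refine HasCompactSupport.intro (isCompact_closedBall (0 : ℝ × ℝ) (1 + |σ|)) fun z hz => ?_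
    have h1 := Qbig z hz
    simp only [hL]
    rw [Qs, ℓ1 _ (by linarith), ℓ1 _ h1.le, Real.log_mul (by norm_num) (by linarith)]
    ring
  · rw [integral_div, div_self hm.ne']
  · intro z
    have h1 : ∀ v, dd v (fun z => m⁻¹ * (L ((2 : ℝ) • z) - L z - Real.log 4))
        = fun z => m⁻¹ * (2 * dd v L ((2 : ℝ) • z) - dd v L z) := by
      intro v; ext z
      have a1 := smooth_diff e2 z
      have a2 := smooth_diff sL z
      rw [dd_const_mul _ ((a1.fun_sub a2).fun_sub (differentiableAt_const _)),
        dd_sub (a1.fun_sub a2) (differentiableAt_const _), dd_sub a1 a2, dd_const, dL2 L sL, sub_zero]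
    have e3 : ∀ v, ContDiff ℝ ∞ (fun z : ℝ × ℝ => dd v L ((2 : ℝ) • z)) :=
      fun v => (dd_contDiff sL).comp (contDiff_const_smul _)
    have h2 : ∀ v w, dd w (dd v (fun z => m⁻¹ * (L ((2 : ℝ) • z) - L z - Real.log 4))) z
        = m⁻¹ * (4 * dd w (dd v L) ((2 : ℝ) • z) - dd w (dd v L) z) := by
      intro v w
      rw [h1]
      have a1 := smooth_diff (e3 v) z
      have a2 := smooth_diff (dd_contDiff (v := v) sL) z
      rw [dd_const_mul _ ((a1.const_mul 2).fun_sub a2), dd_sub (a1.const_mul 2) a2,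
        dd_const_mul _ a1, dL2 (dd v L) (dd_contDiff sL)]
      ring
    have p1 := PL z
    have p2 := PL ((2 : ℝ) • z)
    simp only [PP, dx, dy] at p1 p2 ⊢
    rw [h2, h2, h2, ← p1, ← p2]
    field_simp; ring

/-- sum of a sequence of functions -/
def SS (s : ℕ → ℝ × ℝ → ℝ) (z : ℝ × ℝ) : ℝ := ∑' n, s n z

theorem OrdD.summable {a : ℝ} (ha : 0 < a) {s : ℕ → ℝ × ℝ → ℝ} (hs : OrdD a s) (z : ℝ × ℝ) :
    Summable (fun n => s n z) := by
  obtain ⟨C, h0, hC⟩ := hs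
  exact Summable.of_norm_bounded ((pw_summable ha).mul_left C) (fun n => hC n z)

theorem SS_bound {a : ℝ} (ha : 0 < a) {s : ℕ → ℝ × ℝ → ℝ} (hs : OrdD a s) :
    ∃ M, ∀ z, |SS s z| ≤ M := by
  obtain ⟨C, h0, hC⟩ := hs
  refine ⟨∑' n, C * pw a n, fun z => ?_⟩
  exact tsum_of_norm_bounded (f := fun n => s n z) (((pw_summable ha).mul_left C).hasSum) (fun n => hC n z)

theorem fderiv_norm_le (L : ℝ × ℝ →L[ℝ] ℝ) : ‖L‖ ≤ |L (1, 0)| + |L (0, 1)| := by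
  refine L.opNorm_le_bound (by positivity) fun v => ?_
  have e : L v = v.1 * L (1, 0) + v.2 * L (0, 1) := by
    conv_lhs => rw [show v = v.1 • ((1 : ℝ), (0 : ℝ)) + v.2 • ((0 : ℝ), (1 : ℝ)) by
      ext <;> simp]
    rw [map_add, map_smul, map_smul]; rfl
  rw [e, Real.norm_eq_abs]
  refine (abs_add_le _ _).trans ?_
  rw [abs_mul, abs_mul]
  have h1 : |v.1| ≤ ‖v‖ := norm_fst_le v
  have h2 : |v.2| ≤ ‖v‖ := norm_snd_le v
  nlinarith [abs_nonneg (L (1, 0)), abs_nonneg (L (0, 1))]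

theorem fderiv_ord {a : ℝ} {s : ℕ → ℝ × ℝ → ℝ} (h : ∀ v, OrdD a (fun n => dd v (s n))) :
    ∃ C, 0 ≤ C ∧ ∀ n z, ‖fderiv ℝ (s n) z‖ ≤ C * pw a n := by
  obtain ⟨C, hC0, hC⟩ := h (1, 0)
  obtain ⟨D, hD0, hD⟩ := h (0, 1)
  refine ⟨C + D, by positivity, fun n z => (fderiv_norm_le _).trans ?_⟩
  have h1 := hC n z
  have h2 := hD n z
  simp only [dd] at h1 h2
  linarith

theorem SS_hasFDeriv {a : ℝ} (ha : 0 < a) {s : ℕ → ℝ × ℝ → ℝ} (hs : ∀ n, ContDiff ℝ ∞ (s n))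
    (h0 : OrdD a s) (h1 : ∀ v, OrdD a (fun n => dd v (s n))) :
    Differentiable ℝ (SS s) ∧ ∀ v, dd v (SS s) = SS (fun n => dd v (s n)) := by
  obtain ⟨C, hC0, hC⟩ := fderiv_ord h1
  have hsum : Summable (fun n => C * pw a n) := (pw_summable ha).mul_left C
  have key : ∀ z, HasFDerivAt (SS s) (∑' n, fderiv ℝ (s n) z) z := fun z =>
    hasFDerivAt_tsum hsum (fun n x => (smooth_diff (hs n) x).hasFDerivAt) (fun n x => hC n x)
      (h0.summable ha z) z
  refine ⟨fun z => (key z).differentiableAt, fun v => ?_⟩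
  ext z
  simp only [dd, SS]
  rw [(key z).fderiv]
  have hs' : Summable (fun n => fderiv ℝ (s n) z) := Summable.of_norm_bounded hsum (fun n => hC n z)
  exact (ContinuousLinearMap.apply ℝ ℝ v).map_tsum hs'

theorem SS_hol {α : ℝ} (hα : 0 < α) (hα1 : α < 1) {s : ℕ → ℝ × ℝ → ℝ}
    (hs : ∀ n, ContDiff ℝ ∞ (s n))
    (h0 : OrdD α s) (h1 : ∀ v, OrdD (α - 1) (fun n => dd v (s n))) : Hol α (SS s) := by
  have hb := SS_bound hα h0
  refine ⟨hb, ?_⟩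
  obtain ⟨M, hM⟩ := hb
  obtain ⟨D, hD0, hD⟩ := fderiv_ord h1
  have hsumm := h0.summable hα
  obtain ⟨C, hC0, hC⟩ := h0
  have hM0 : 0 ≤ M := (abs_nonneg _).trans (hM 0)
  have hα' : 0 < 1 - α := by linarith
  set S1 := ∑' n, pw (1 - α) n with hS1
  set S2 := ∑' n, pw α n with hS2
  have S1p : 0 ≤ S1 := tsum_nonneg fun n => (pw_pos _ n).le
  have S2p : 0 ≤ S2 := tsum_nonneg fun n => (pw_pos _ n).le
  have mv : ∀ n z w, |s n z - s n w| ≤ D * pw (α - 1) n * dist z w := by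
    intro n z w
    have := Convex.norm_image_sub_le_of_norm_fderiv_le (𝕜 := ℝ) (f := s n) (s := univ)
      (fun x _ => smooth_diff (hs n) x) (fun x _ => hD n x) convex_univ (mem_univ w) (mem_univ z)
    rw [dist_eq_norm]; exact this
  set B := (D * S1 + 2 * C * S2) * 2 ^ α with hB
  have hB0 : 0 ≤ B := by positivity
  refine ⟨2 * M + B, by positivity, fun z w => ?_⟩
  rcases eq_or_ne z w with rfl | hzw
  · simp only [sub_self, abs_zero]; positivity
  have hd : 0 < dist z w := dist_pos.2 hzw
  set d := dist z w with hdd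
  by_cases hd1 : 1 ≤ d
  · have e1 : 1 ≤ d ^ α := Real.one_le_rpow hd1 hα.le
    have := abs_sub (SS s z) (SS s w)
    have h1 := hM z
    have h2 := hM w
    have h3 : |SS s z - SS s w| ≤ 2 * M := by linarith
    nlinarith
  push Not at hd1
  obtain ⟨N, hN1, hN2⟩ := exists_nat_pow_near_of_lt_one hd hd1.le (by norm_num : (0:ℝ) < 1/2)
    (by norm_num)
  have pN : pw α N ≤ 2 ^ α * d ^ α := by
    rw [← Real.mul_rpow (by norm_num) hd.le]
    have e1 : pw α N = ((1/2 : ℝ) ^ N) ^ α := by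
      unfold pw
      rw [one_div, inv_pow, ← Real.rpow_natCast, ← Real.rpow_neg (by norm_num),
        ← Real.rpow_mul (by norm_num)]
      congr 1; ring
    rw [e1]
    apply Real.rpow_le_rpow (by positivity) _ hα.le
    rw [pow_succ] at hN1
    linarith
  have e2 : SS s z - SS s w = ∑ n ∈ Finset.range N, (s n z - s n w)
      + ∑' n, (s (n + N) z - s (n + N) w) := by
    simp only [SS]
    rw [← (hsumm z).tsum_sub (hsumm w)]
    exact (((hsumm z).sub (hsumm w)).sum_add_tsum_nat_add N).symm
  have p1 : |∑ n ∈ Finset.range N, (s n z - s n w)| ≤ D * S1 * pw α N := by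
    refine (Finset.abs_sum_le_sum_abs _ _).trans ?_
    have t1 : ∀ n ∈ Finset.range N, |s n z - s n w| ≤ D * pw α N * pw (1 - α) (N - 1 - n) := by
      intro n hn
      rw [Finset.mem_range] at hn
      refine (mv n z w).trans ?_
      have : pw (α - 1) n * d ≤ pw α N * pw (1 - α) (N - 1 - n) := by
        calc pw (α - 1) n * d ≤ pw (α - 1) n * (1/2 : ℝ) ^ N := by
              gcongr
              exact (pw_pos _ _).le
          _ = pw α N * pw (1 - α) (N - n) := by
              unfold pw
              rw [one_div, inv_pow, ← Real.rpow_natCast, ← Real.rpow_neg (by norm_num),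
                ← Real.rpow_add (by norm_num), ← Real.rpow_add (by norm_num), Nat.cast_sub hn.le]
              congr 1; ring
          _ ≤ pw α N * pw (1 - α) (N - 1 - n) := by
              apply mul_le_mul_of_nonneg_left _ (pw_pos _ _).le
              unfold pw
              apply Real.rpow_le_rpow_of_exponent_le (by norm_num)
              have : ((N - 1 - n : ℕ) : ℝ) ≤ ((N - n : ℕ) : ℝ) := by
                exact_mod_cast (by omega)
              nlinarith
      nlinarith
    refine (Finset.sum_le_sum t1).trans ?_
    rw [← Finset.mul_sum, Finset.sum_range_reflect]
    have := (pw_summable hα').sum_le_tsum (Finset.range N) (fun n _ => (pw_pos _ n).le)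
    calc _ ≤ D * pw α N * S1 :=
          mul_le_mul_of_nonneg_left this (mul_nonneg hD0 (pw_pos _ _).le)
      _ = _ := by ring
  have p2 : |∑' n, (s (n + N) z - s (n + N) w)| ≤ 2 * C * S2 * pw α N := by
    have hs2 : HasSum (fun n => 2 * C * pw α N * pw α n) (2 * C * pw α N * S2) :=
      (pw_summable hα).hasSum.mul_left _
    have := tsum_of_norm_bounded hs2 (f := fun n => s (n + N) z - s (n + N) w) (fun n => by
      rw [Real.norm_eq_abs]
      refine (abs_sub _ _).trans ?_
      have h1 := hC (n + N) z
      have h2 := hC (n + N) w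
      have h3 : pw α (n + N) = pw α N * pw α n := by
        rw [pw_eq_pow, pw_eq_pow, pw_eq_pow, pow_add]; ring
      rw [h3] at h1 h2
      linarith)
    rw [Real.norm_eq_abs] at this
    linarith
  rw [e2]
  refine (abs_add_le _ _).trans ?_
  have hda : 0 ≤ d ^ α := by positivity
  have : (D * S1 + 2 * C * S2) * pw α N ≤ (D * S1 + 2 * C * S2) * (2 ^ α * d ^ α) :=
    mul_le_mul_of_nonneg_left pN (by positivity)
  calc _ ≤ (D * S1 + 2 * C * S2) * (2 ^ α * d ^ α) := by linarith
    _ = B * d ^ α := by rw [hB]; ring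
    _ ≤ _ := by nlinarith

/-- Lebesgue differentiation for the dyadic averages -/
theorem J_ae_tendsto {η u : ℝ × ℝ → ℝ} (hη : Ker η) (hη1 : ∫ z, η z = 1)
    (hu : LocallyIntegrable u) :
    ∀ᵐ z, Filter.Tendsto (fun n => J η n u z) Filter.atTop (𝓝 (u z)) := by
  obtain ⟨R0, hR0⟩ := hη.cpt.isCompact.isBounded.subset_closedBall (0 : ℝ × ℝ)
  set R := max R0 1 with hR
  have Rpos : 0 < R := lt_of_lt_of_le one_pos (le_max_right _ _)
  have hR' : ∀ z, R < ‖z‖ → η z = 0 := by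
    intro z hz
    apply image_eq_zero_of_notMem_tsupport
    intro h
    have := hR0 h
    rw [mem_closedBall_zero_iff] at this
    linarith [le_max_left R0 1]
  obtain ⟨M, hM⟩ := hη.smooth.continuous.bounded_above_of_compact_support hη.cpt
  have hδ : Filter.Tendsto (fun n : ℕ => R * (1/2 : ℝ) ^ n) Filter.atTop (𝓝[>] 0) := by
    refine tendsto_nhdsWithin_iff.2 ⟨?_, Filter.Eventually.of_forall fun n => ?_⟩
    · simpa using (tendsto_pow_atTop_nhds_zero_of_lt_one (by norm_num : (0:ℝ) ≤ 1/2)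
        (by norm_num)).const_mul R
    · simp only [mem_Ioi]; positivity
  filter_upwards [(IsUnifLocDoublingMeasure.ae_tendsto_average_norm_sub volume hu 1)] with z hz
  have h1 := hz (fun _ => z) (fun n : ℕ => R * (1/2 : ℝ) ^ n) hδ
    (Filter.Eventually.of_forall fun n => Metric.mem_closedBall_self (by positivity))
  set V := volume.real (Metric.closedBall (0 : ℝ × ℝ) 1) with hV
  have hVp : 0 < V := ENNReal.toReal_pos (Metric.measure_closedBall_pos _ _ one_pos).ne'
    (isCompact_closedBall _ _).measure_lt_top.ne
  have := tendsto_integral_smul_of_tendsto_average_norm_sub (g := fun n w => scl η n (z - w))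
    (M * R ^ 2 * V) h1 (Filter.Eventually.of_forall fun n =>
      hu.integrableOn_isCompact (isCompact_closedBall _ _))
    (by simp only [integral_scl, hη1]; exact tendsto_const_nhds)
    (Filter.Eventually.of_forall fun n => ?_) (Filter.Eventually.of_forall fun n w => ?_)
  · refine this.congr fun n => ?_
    simp only [J, smul_eq_mul]
    congr 1; ext w; ring
  · intro w hw
    rw [Function.mem_support] at hw
    rw [mem_closedBall_iff_norm']
    by_contra hc
    push Not at hc
    apply hw
    simp only [scl]
    rw [hR', mul_zero]
    rw [norm_smul, Real.norm_of_nonneg (by positivity)]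
    have e : R = 2 ^ n * (R * (1/2) ^ n) := by
      rw [one_div, inv_pow]; field_simp
    conv_lhs => rw [e]
    exact mul_lt_mul_of_pos_left hc (by positivity)
  · rw [Measure.addHaar_real_closedBall' _ _ (by positivity)]
    simp only [Module.finrank_prod, Module.finrank_self, scl]
    rw [abs_mul, abs_of_pos (by positivity : (0:ℝ) < 4 ^ n)]
    have e : M * R ^ 2 * V / ((R * (1/2 : ℝ) ^ n) ^ (1 + 1) * V) = 4 ^ n * M := by
      have e0 : ((1/2 : ℝ) ^ n) ^ 2 * 4 ^ n = 1 := by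
        rw [← pow_mul, mul_comm n, pow_mul, ← mul_pow]; norm_num
      rw [div_eq_iff (by positivity)]
      linear_combination (-(M * R ^ 2 * V)) * e0
    rw [e]
    exact mul_le_mul_of_nonneg_left (hM _) (by positivity)

/-- weak form of the constant coefficient equation -/
def WE (σ ρ : ℝ) (U h H1 H2 : ℝ × ℝ → ℝ) : Prop :=
  ∀ φ, Ker φ → ∫ z, U z * PP σ ρ φ z = ∫ z, (h z * φ z - H1 z * dx φ z - H2 z * dy φ z)

theorem J_tele {σ ρ : ℝ} {η Ψ U h H1 H2 : ℝ × ℝ → ℝ} (hη : Ker η) (hΨ : Ker Ψ)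
    (hPP : ∀ z, PP σ ρ Ψ z = 4 * η ((2 : ℝ) • z) - η z)
    (hU : BM U) (hh : BM h) (hH1 : BM H1) (hH2 : BM H2) (hw : WE σ ρ U h H1 H2) (n : ℕ) (z : ℝ × ℝ) :
    J η (n + 1) U z - J η n U z = TT 2 Ψ h n z + TT 1 (dx Ψ) H1 n z + TT 1 (dy Ψ) H2 n z := by
  have dG : ∀ (G : ℝ × ℝ → ℝ), ContDiff ℝ ∞ G → ∀ v,
      dd v (fun w : ℝ × ℝ => G ((2 : ℝ) ^ n • (z - w)))
        = fun w => (-(2 ^ n)) * dd v G ((2 : ℝ) ^ n • (z - w)) := by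
    intro G hG v
    ext w
    have h0 : HasFDerivAt (fun w : ℝ × ℝ => z - w) (-ContinuousLinearMap.id ℝ (ℝ × ℝ)) w :=
      (hasFDerivAt_id w).const_sub z
    have h1 : HasFDerivAt (fun w : ℝ × ℝ => (2 : ℝ) ^ n • (z - w))
      ((2 : ℝ) ^ n • (-ContinuousLinearMap.id ℝ (ℝ × ℝ))) w := h0.fun_const_smul _
    have h2 := ((smooth_diff hG ((2 : ℝ) ^ n • (z - w))).hasFDerivAt.comp w h1)
    have h3 : dd v (fun w : ℝ × ℝ => G ((2 : ℝ) ^ n • (z - w))) w = _ :=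
      congrArg (fun L => L v) h2.fderiv
    rw [h3]
    simp [dd]
  have sc : ∀ (G : ℝ × ℝ → ℝ), ContDiff ℝ ∞ G →
      ContDiff ℝ ∞ (fun w : ℝ × ℝ => G ((2 : ℝ) ^ n • (z - w))) := by
    intro G hG
    exact hG.comp ((contDiff_const.sub contDiff_id).const_smul _)
  set φ : ℝ × ℝ → ℝ := fun w => Ψ ((2 : ℝ) ^ n • (z - w)) with hφ
  have kφ : Ker φ := by
    refine ⟨sc Ψ hΨ.smooth, ?_⟩
    have h1 := (hΨ.cpt.comp_smul (two_pow_ne n))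
    exact h1.comp_homeomorph (Homeomorph.subLeft z)
  have d1 : ∀ v, dd v φ = fun w => (-(2 ^ n)) * dd v Ψ ((2 : ℝ) ^ n • (z - w)) := dG Ψ hΨ.smooth
  have d2 : ∀ v w' w, dd w' (dd v φ) w = 4 ^ n * dd w' (dd v Ψ) ((2 : ℝ) ^ n • (z - w)) := by
    intro v w' w
    rw [d1, dd_const_mul _ (smooth_diff (sc _ (dd_contDiff hΨ.smooth)) w),
      dG _ (dd_contDiff hΨ.smooth)]
    rw [show (4 : ℝ) = 2 * 2 by norm_num, mul_pow]; ring
  have pφ : ∀ w, PP σ ρ φ w = scl η (n + 1) (z - w) - scl η n (z - w) := by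
    intro w
    have := hPP ((2 : ℝ) ^ n • (z - w))
    simp only [PP, dx, dy] at this ⊢
    rw [d2, d2, d2]
    simp only [scl]
    rw [smul_smul] at this
    rw [pow_succ, pow_succ (2 : ℝ), mul_comm ((2 : ℝ) ^ n) 2]
    linear_combination 4 ^ n * this
  have q2 : pw 2 n * 4 ^ n = 1 := by
    rw [pw_eq_pow, ← mul_pow, Real.rpow_neg (by norm_num)]; norm_num
  have q1 : pw 1 n * 4 ^ n = 2 ^ n := by
    rw [pw_eq_pow, ← mul_pow, Real.rpow_neg (by norm_num)]; norm_num
  have E := hw φ kφ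
  have L1 : ∫ w, U w * PP σ ρ φ w = J η (n + 1) U z - J η n U z := by
    simp only [pφ, J, mul_sub]
    exact integral_sub (J_int hη hU _ z) (J_int hη hU _ z)
  have L2 : ∫ w, (h w * φ w - H1 w * dx φ w - H2 w * dy φ w)
      = TT 2 Ψ h n z + TT 1 (dx Ψ) H1 n z + TT 1 (dy Ψ) H2 n z := by
    have i1 : Integrable (fun w => pw 2 n * (h w * scl Ψ n (z - w))) :=
      (J_int hΨ hh n z).const_mul _
    have i2 : Integrable (fun w => pw 1 n * (H1 w * scl (dx Ψ) n (z - w))) :=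
      (J_int (hΨ.dd _) hH1 n z).const_mul _
    have i3 : Integrable (fun w => pw 1 n * (H2 w * scl (dy Ψ) n (z - w))) :=
      (J_int (hΨ.dd _) hH2 n z).const_mul _
    have i4 : Integrable (fun w => pw 2 n * (h w * scl Ψ n (z - w))
      + pw 1 n * (H1 w * scl (dx Ψ) n (z - w))) := i1.add i2
    simp only [TT, J]
    rw [← integral_const_mul, ← integral_const_mul, ← integral_const_mul,
      ← integral_add i1 i2, ← integral_add i4 i3]
    congr 1; ext w
    have f1 : dx φ w = _ := congrFun (d1 (1, 0)) w
    have f2 : dy φ w = _ := congrFun (d1 (0, 1)) w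
    rw [f1, f2]
    simp only [dx, dy, scl, hφ]
    linear_combination (-(h w * Ψ ((2 : ℝ) ^ n • (z - w)))) * q2
      - (H1 w * dd (1,0) Ψ ((2 : ℝ) ^ n • (z - w))) * q1
      - (H2 w * dd (0,1) Ψ ((2 : ℝ) ^ n • (z - w))) * q1
  rw [← L1, E, L2]

/-- the kernel pair -/
structure KP (σ ρ : ℝ) (η Ψ : ℝ × ℝ → ℝ) : Prop where
  kη : Ker η
  kΨ : Ker Ψ
  int1 : ∫ z, η z = 1
  pp : ∀ z, PP σ ρ Ψ z = 4 * η ((2 : ℝ) • z) - η z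

/-- combined sequences -/
def Cm (c : ℝ) (U h H1 H2 K0 K K1 K2 : ℝ × ℝ → ℝ) (n : ℕ) (z : ℝ × ℝ) : ℝ :=
  T0 K0 U n z + TT c K h n z + TT (c - 1) K1 H1 n z + TT (c - 1) K2 H2 n z

section
variable {c : ℝ} {U h H1 H2 K0 K K1 K2 : ℝ × ℝ → ℝ}

theorem Cm_smooth (hU : BM U) (hh : BM h) (hH1 : BM H1) (hH2 : BM H2)
    (k0 : Ker K0) (k : Ker K) (k1 : Ker K1) (k2 : Ker K2) (n : ℕ) :
    ContDiff ℝ ∞ (Cm c U h H1 H2 K0 K K1 K2 n) :=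
  (((T0_smooth k0 hU n).add (TT_smooth c k hh n)).add (TT_smooth _ k1 hH1 n)).add
    (TT_smooth _ k2 hH2 n)

theorem Cm_dd (hU : BM U) (hh : BM h) (hH1 : BM H1) (hH2 : BM H2)
    (k0 : Ker K0) (k : Ker K) (k1 : Ker K1) (k2 : Ker K2) (v : ℝ × ℝ) :
    (fun n => dd v (Cm c U h H1 H2 K0 K K1 K2 n))
      = Cm (c - 1) U h H1 H2 (dd v K0) (dd v K) (dd v K1) (dd v K2) := by
  ext n z
  have a0 := smooth_diff (T0_smooth k0 hU n) z
  have a1 := smooth_diff (TT_smooth c k hh n) z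
  have a2 := smooth_diff (TT_smooth (c - 1) k1 hH1 n) z
  have a3 := smooth_diff (TT_smooth (c - 1) k2 hH2 n) z
  unfold Cm
  rw [dd_add ((a0.fun_add a1).fun_add a2) a3, dd_add (a0.fun_add a1) a2, dd_add a0 a1,
    T0_dd k0 hU, TT_dd c k hh, TT_dd _ k1 hH1, TT_dd _ k2 hH2]

theorem Cm_ord (hU : BM U) (hh : BM h) (hH1 : BM H1) (hH2 : BM H2)
    (k0 : Ker K0) (k : Ker K) (k1 : Ker K1) (k2 : Ker K2) :
    OrdD (c - 1) (Cm c U h H1 H2 K0 K K1 K2) :=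
  (((T0_ord (c - 1) k0 hU).add ((TT_ord c k hh).mono (by linarith))).add (TT_ord _ k1 hH1)).add
    (TT_ord _ k2 hH2)

theorem Cm_ord_hol {α : ℝ} (hα : 0 < α) (hα1 : α < 1)
    (hU : BM U) (hh : BM h) (hH1 : Hol α H1) (hH2 : Hol α H2)
    (k0 : Ker K0) (k : Ker K) (k1 : Ker K1) (k2 : Ker K2) (v w : ℝ × ℝ) :
    OrdD (c - 1 + α) (Cm c U h H1 H2 K0 K (dd v K1) (dd w K2)) :=
  (((T0_ord (c - 1 + α) k0 hU).add ((TT_ord c k hh).mono (by linarith))).add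
    (TT_ord_holder hα _ k1 hH1 v)).add (TT_ord_holder hα _ k2 hH2 w)

theorem TT_zero : TT c K (fun _ => 0) = fun _ _ => 0 := by
  ext n z; simp [TT, J]

theorem OrdD.zero (a : ℝ) : OrdD a (fun _ _ => 0) :=
  ⟨0, le_rfl, fun n z => by simp⟩

theorem Cm_ord0 (hU : BM U) (hh : BM h) (k0 : Ker K0) (k : Ker K) :
    OrdD c (Cm c U h (fun _ => 0) (fun _ => 0) K0 K K1 K2) := by
  unfold Cm
  simp only [TT_zero]
  exact (((T0_ord c k0 hU).add (TT_ord c k hh)).add (OrdD.zero c)).add (OrdD.zero c)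

theorem Cm_ord0_hol {α : ℝ} (hα : 0 < α) (hU : BM U) (hh : Hol α h) (k0 : Ker K0) (k : Ker K)
    (v : ℝ × ℝ) :
    OrdD (c + α) (Cm c U h (fun _ => 0) (fun _ => 0) K0 (dd v K) K1 K2) := by
  unfold Cm
  simp only [TT_zero]
  exact (((T0_ord (c + α) k0 hU).add (TT_ord_holder hα c k hh v)).add (OrdD.zero _)).add
    (OrdD.zero _)
end

theorem Cm_tendsto {σ ρ : ℝ} {η Ψ U h H1 H2 : ℝ × ℝ → ℝ} (kp : KP σ ρ η Ψ)
    (hU : BM U) (hh : BM h) (hH1 : BM H1) (hH2 : BM H2) (hw : WE σ ρ U h H1 H2) (z : ℝ × ℝ)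
    (hs : Summable (fun n => Cm 2 U h H1 H2 η Ψ (dx Ψ) (dy Ψ) n z)) :
    Filter.Tendsto (fun n => J η n U z) Filter.atTop
      (𝓝 (SS (Cm 2 U h H1 H2 η Ψ (dx Ψ) (dy Ψ)) z)) := by
  have h1 := hs.hasSum.tendsto_sum_nat
  have h2 := (Filter.tendsto_add_atTop_iff_nat 1).2 h1
  rw [← Filter.tendsto_add_atTop_iff_nat 1]
  refine h2.congr fun n => ?_
  induction n with
  | zero =>
    have := J_tele kp.kη kp.kΨ kp.pp hU hh hH1 hH2 hw 0 z
    simp only [zero_add, Finset.sum_range_one, Cm, T0, if_true]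
    norm_num at this ⊢
    linarith
  | succ m ih =>
    have := J_tele kp.kη kp.kΨ kp.pp hU hh hH1 hH2 hw (m + 1) z
    rw [Finset.sum_range_succ, ih]
    simp only [Cm, T0]
    norm_num at this ⊢
    linarith

theorem BM_zero : BM (fun _ => 0) := ⟨aestronglyMeasurable_const, 0, by simp⟩

theorem stage1 {σ ρ α : ℝ} (hα : 0 < α) (hα1 : α < 1) {η Ψ U h H1 H2 : ℝ × ℝ → ℝ}
    (kp : KP σ ρ η Ψ)
    (hU : BM U) (hh : BM h) (hH1 : BM H1) (hH2 : BM H2) (hw : WE σ ρ U h H1 H2) :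
    ∃ W, Hol α W ∧ ∀ z, Filter.Tendsto (fun n => J η n U z) Filter.atTop (𝓝 (W z)) := by
  have k := kp.kΨ
  have o1 : OrdD 1 (Cm 2 U h H1 H2 η Ψ (dx Ψ) (dy Ψ)) := by
    have := Cm_ord (c := 2) hU hh hH1 hH2 kp.kη k (k.dd (1, 0)) (k.dd (0, 1))
    norm_num at this; exact this
  have o2 : ∀ v, OrdD 0 (fun n => dd v (Cm 2 U h H1 H2 η Ψ (dx Ψ) (dy Ψ) n)) := by
    intro v
    rw [Cm_dd hU hh hH1 hH2 kp.kη k (k.dd (1, 0)) (k.dd (0, 1))]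
    have := Cm_ord (c := 2 - 1) hU hh hH1 hH2 (kp.kη.dd v) (k.dd v) ((k.dd (1, 0)).dd v)
      ((k.dd (0, 1)).dd v)
    norm_num at this ⊢; exact this
  refine ⟨SS (Cm 2 U h H1 H2 η Ψ (dx Ψ) (dy Ψ)), ?_, fun z => ?_⟩
  · exact SS_hol hα hα1 (Cm_smooth hU hh hH1 hH2 kp.kη k (k.dd (1, 0)) (k.dd (0, 1)))
      (o1.mono hα1.le) (fun v => (o2 v).mono (by linarith))
  · exact Cm_tendsto kp hU hh hH1 hH2 hw z (o1.summable one_pos z)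

theorem stage2 {σ ρ α : ℝ} (hα : 0 < α) (hα1 : α < 1) {η Ψ U h H1 H2 : ℝ × ℝ → ℝ}
    (kp : KP σ ρ η Ψ)
    (hU : BM U) (hh : BM h) (hH1 : Hol α H1) (hH2 : Hol α H2) (hw : WE σ ρ U h H1 H2) :
    ∃ W, Differentiable ℝ W ∧ (∀ v, Hol α (dd v W)) ∧
      ∀ z, Filter.Tendsto (fun n => J η n U z) Filter.atTop (𝓝 (W z)) := by
  have k := kp.kΨ
  have b1 := hH1.bm hα
  have b2 := hH2.bm hα
  have o1 : OrdD 1 (Cm 2 U h H1 H2 η Ψ (dx Ψ) (dy Ψ)) := by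
    have := Cm_ord (c := 2) hU hh b1 b2 kp.kη k (k.dd (1, 0)) (k.dd (0, 1))
    norm_num at this; exact this
  have e2 : ∀ v, (fun n => dd v (Cm 2 U h H1 H2 η Ψ (dx Ψ) (dy Ψ) n)) = _ := fun v =>
    Cm_dd hU hh b1 b2 kp.kη k (k.dd (1, 0)) (k.dd (0, 1)) v
  have o2 : ∀ v, OrdD α (fun n => dd v (Cm 2 U h H1 H2 η Ψ (dx Ψ) (dy Ψ) n)) := by
    intro v
    rw [e2]
    have := Cm_ord_hol (c := 2 - 1) hα hα1 hU hh hH1 hH2 (kp.kη.dd v) (k.dd v) (k.dd (1, 0))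
      (k.dd (0, 1)) v v
    norm_num at this ⊢; exact this
  have s1 := Cm_smooth (c := 2) hU hh b1 b2 kp.kη k (k.dd (1, 0)) (k.dd (0, 1))
  have o3 : ∀ v w, OrdD (α - 1) (fun n => dd w (dd v (Cm 2 U h H1 H2 η Ψ (dx Ψ) (dy Ψ) n))) := by
    intro v w
    have : ∀ n, dd v (Cm 2 U h H1 H2 η Ψ (dx Ψ) (dy Ψ) n) = _ := fun n => congrFun (e2 v) n
    simp only [this]
    rw [Cm_dd hU hh b1 b2 (kp.kη.dd v) (k.dd v) ((k.dd (1, 0)).dd v) ((k.dd (0, 1)).dd v)]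
    have := Cm_ord_hol (c := 2 - 1 - 1) hα hα1 hU hh hH1 hH2 ((kp.kη.dd v).dd w) ((k.dd v).dd w)
      ((k.dd (1, 0)).dd v) ((k.dd (0, 1)).dd v) w w
    exact this.mono (by linarith)
  obtain ⟨d1, d2⟩ := SS_hasFDeriv hα s1 (o1.mono hα1.le) o2
  refine ⟨SS (Cm 2 U h H1 H2 η Ψ (dx Ψ) (dy Ψ)), d1, fun v => ?_, fun z => ?_⟩
  · rw [d2]
    exact SS_hol hα hα1 (fun n => dd_contDiff (s1 n)) (o2 v) (o3 v)
  · exact Cm_tendsto kp hU hh b1 b2 hw z (o1.summable one_pos z)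

theorem stage3 {σ ρ α : ℝ} (hα : 0 < α) (hα1 : α < 1) {η Ψ U h : ℝ × ℝ → ℝ}
    (kp : KP σ ρ η Ψ)
    (hU : BM U) (hh : Hol α h) (hw : WE σ ρ U h (fun _ => 0) (fun _ => 0)) :
    ∃ W, Differentiable ℝ W ∧ (∀ v, Differentiable ℝ (dd v W)) ∧
      (∀ v w, Hol α (dd w (dd v W))) ∧
      ∀ z, Filter.Tendsto (fun n => J η n U z) Filter.atTop (𝓝 (W z)) := by
  have k := kp.kΨ
  have b0 := hh.bm hα
  set S := Cm 2 U h (fun _ => 0) (fun _ => 0) η Ψ (dx Ψ) (dy Ψ) with hS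
  have o1 : OrdD 2 S := Cm_ord0 hU b0 kp.kη k
  have e2 : ∀ v, (fun n => dd v (S n)) = _ := fun v =>
    Cm_dd hU b0 BM_zero BM_zero kp.kη k (k.dd (1, 0)) (k.dd (0, 1)) v
  have e2' : ∀ v n, dd v (S n) = _ := fun v n => congrFun (e2 v) n
  have e3 : ∀ v w, (fun n => dd w (dd v (S n))) = _ := fun v w => by
    simp only [e2']
    exact Cm_dd hU b0 BM_zero BM_zero (kp.kη.dd v) (k.dd v) ((k.dd (1, 0)).dd v)
      ((k.dd (0, 1)).dd v) w
  have e3' : ∀ v w n, dd w (dd v (S n)) = _ := fun v w n => congrFun (e3 v w) n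
  have s1 : ∀ n, ContDiff ℝ ∞ (S n) :=
    Cm_smooth (c := 2) hU b0 BM_zero BM_zero kp.kη k (k.dd (1, 0)) (k.dd (0, 1))
  have o2 : ∀ v, OrdD 1 (fun n => dd v (S n)) := by
    intro v
    rw [e2]
    have := Cm_ord0 (c := 2 - 1) (K1 := dd v (dx Ψ)) (K2 := dd v (dy Ψ)) hU b0 (kp.kη.dd v) (k.dd v)
    exact this.mono (by norm_num)
  have o3 : ∀ v w, OrdD α (fun n => dd w (dd v (S n))) := by
    intro v w
    rw [e3]
    have := Cm_ord0_hol (c := 2 - 1 - 1) (K1 := dd w (dd v (dx Ψ))) (K2 := dd w (dd v (dy Ψ)))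
      hα hU hh ((kp.kη.dd v).dd w) (k.dd v) w
    exact this.mono (by linarith)
  have o4 : ∀ v w x, OrdD (α - 1) (fun n => dd x (dd w (dd v (S n)))) := by
    intro v w x
    simp only [e3']
    rw [Cm_dd hU b0 BM_zero BM_zero ((kp.kη.dd v).dd w) ((k.dd v).dd w) (((k.dd (1, 0)).dd v).dd w)
      (((k.dd (0, 1)).dd v).dd w)]
    have := Cm_ord0_hol (c := 2 - 1 - 1 - 1) (K1 := dd x (dd w (dd v (dx Ψ))))
      (K2 := dd x (dd w (dd v (dy Ψ))))
      hα hU hh (((kp.kη.dd v).dd w).dd x) ((k.dd v).dd w) x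
    exact this.mono (by linarith)
  obtain ⟨d1, d2⟩ := SS_hasFDeriv one_pos s1 (o1.mono (by norm_num)) o2
  have dv := fun v => SS_hasFDeriv hα (fun n => dd_contDiff (v := v) (s1 n))
    ((o2 v).mono hα1.le) (o3 v)
  refine ⟨SS S, d1, fun v => ?_, fun v w => ?_, fun z => ?_⟩
  · rw [d2]; exact (dv v).1
  · rw [d2, (dv v).2]
    exact SS_hol hα hα1 (fun n => dd_contDiff (dd_contDiff (s1 n))) (o3 v w) (o4 v w)
  · exact Cm_tendsto kp hU b0 BM_zero BM_zero hw z (o1.summable two_pos z)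

theorem C2_dd {v : ℝ × ℝ} {w : ℝ × ℝ → ℝ} (hw : ContDiff ℝ 2 w) : ContDiff ℝ 1 (dd v w) := by
  unfold dd
  exact (hw.fderiv_right (m := 1) (by norm_num)).clm_apply contDiff_const

theorem C1_dd {v : ℝ × ℝ} {w : ℝ × ℝ → ℝ} (hw : ContDiff ℝ 1 w) : Continuous (dd v w) := by
  unfold dd
  exact (hw.continuous_fderiv (by norm_num)).clm_apply continuous_const

theorem integral_adj2 (σ ρ κ θ q r : ℝ) {w φ : ℝ × ℝ → ℝ} (hw : ContDiff ℝ 2 w)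
    (hφ : ContDiff ℝ ∞ φ) (hc : HasCompactSupport φ) :
    ∫ z, w z * Ast σ ρ κ θ q r φ z = ∫ z, hestonA σ ρ κ θ q r w z * φ z := by
  have hwd : Differentiable ℝ w := hw.differentiable (by norm_num)
  have hw1 : ContDiff ℝ 1 w := hw.of_le (by norm_num)
  have hwx : ContDiff ℝ 1 (dd (1,0) w) := C2_dd hw
  have hwy : ContDiff ℝ 1 (dd (0,1) w) := C2_dd hw
  have hwxd : Differentiable ℝ (dd (1,0) w) := hwx.differentiable (by norm_num)
  have hwyd : Differentiable ℝ (dd (0,1) w) := hwy.differentiable (by norm_num)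
  have hφ1 : ContDiff ℝ 1 φ := hφ.of_le (by simp)
  have hφx1 : ContDiff ℝ 1 (dd (1,0) φ) := (dd_contDiff hφ).of_le (by simp)
  have hφy1 : ContDiff ℝ 1 (dd (0,1) φ) := (dd_contDiff hφ).of_le (by simp)
  have hwc : Continuous w := hw.continuous
  have e1 : Continuous (dd (1,0) w) := hwx.continuous
  have e2 : Continuous (dd (0,1) w) := hwy.continuous
  have e3 : Continuous (dd (1,0) (dd (1,0) w)) := C1_dd hwx
  have e4 : Continuous (dd (0,1) (dd (1,0) w)) := C1_dd hwx
  have e5 : Continuous (dd (0,1) (dd (0,1) w)) := C1_dd hwy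
  have hφd := smooth_diff hφ
  have hcx : HasCompactSupport (dd (1, 0) φ) := dd_compact hc
  have hcy : HasCompactSupport (dd (0, 1) φ) := dd_compact hc
  have hcxx : HasCompactSupport (dd (1, 0) (dd (1, 0) φ)) := dd_compact hcx
  have hcxy : HasCompactSupport (dd (0, 1) (dd (1, 0) φ)) := dd_compact hcx
  have hcyy : HasCompactSupport (dd (0, 1) (dd (0, 1) φ)) := dd_compact hcy
  set G1 : ℝ × ℝ → ℝ := fun z => (-(1 / 2) * (z.2 * w z)) * dx φ z
    + ((1 / 2) * (z.2 * dx w z) + ρ * σ * (z.2 * dy w z) + (r - q - (1/2) * z.2) * w z) * φ z with hG1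
  set G2 : ℝ × ℝ → ℝ := fun z => (-(ρ * σ) * (z.2 * w z)) * dx φ z
    + (-(σ ^ 2 / 2) * (z.2 * w z)) * dy φ z
    + ((σ ^ 2 / 2) * (z.2 * dy w z) + (κ * (θ - z.2) - σ ^ 2 / 2) * w z) * φ z with hG2
  have s1 : ContDiff ℝ 1 G1 := by fun_prop
  have s2 : ContDiff ℝ 1 G2 := by fun_prop
  have c1 : HasCompactSupport G1 := hcx.mul_left.add hc.mul_left
  have c2 : HasCompactSupport G2 := (hcx.mul_left.add hcy.mul_left).add hc.mul_left
  have z0 : ∀ {v : ℝ × ℝ} {g : ℝ × ℝ → ℝ}, ContDiff ℝ 1 g → HasCompactSupport g →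
      ∫ z, dd v g z = 0 := by
    intro v g hg hgc
    have := ibp (v := v) (f := fun _ => 1) contDiff_const hg hgc
    simpa [dd_const] using this
  have key : ∀ z, w z * Ast σ ρ κ θ q r φ z - hestonA σ ρ κ θ q r w z * φ z
      = dd (1, 0) G1 z + dd (0, 1) G2 z := by
    intro z
    have hxy : dd (1, 0) (dd (0, 1) w) z = dd (0, 1) (dd (1, 0) w) z :=
      dd_comm hw.contDiffAt
    simp only [hG1, hG2]
    simp (disch := fun_prop) only [dd_add, dd_sub, dd_mul, dd_const, dx_snd, dy_snd]
    rw [hestonA_eq, Ast, PP, PP, hxy]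
    ring
  have i1 : Integrable (fun z => w z * Ast σ ρ κ θ q r φ z) := by
    apply Continuous.integrable_of_hasCompactSupport
    · simp only [Ast, PP]; fun_prop
    · apply HasCompactSupport.mul_left
      exact (((hcxx.add hcxy.mul_left).add hcyy.mul_left).mul_left.add hcx.mul_left
        |>.add hcy.mul_left |>.add hc.mul_left)
  have i2 : Integrable (fun z => hestonA σ ρ κ θ q r w z * φ z) := by
    apply Continuous.integrable_of_hasCompactSupport
    · simp only [hestonA_eq, PP]; fun_prop
    · exact hc.mul_left
  have j1 : Integrable (dd (1, 0) G1) :=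
    (C1_dd s1).integrable_of_hasCompactSupport (dd_compact c1)
  have j2 : Integrable (dd (0, 1) G2) :=
    (C1_dd s2).integrable_of_hasCompactSupport (dd_compact c2)
  rw [← sub_eq_zero, ← integral_sub i1 i2, integral_congr_ae (Filter.Eventually.of_forall key),
    integral_add j1 j2, z0 s1 c1, z0 s2 c2, add_zero]

theorem Tst_mul {O : Set (ℝ × ℝ)} {g φ : ℝ × ℝ → ℝ} (hg : ContDiff ℝ ∞ g) (hφ : φ ∈ Tst O) :
    (fun z => g z * φ z) ∈ Tst O :=
  ⟨hg.mul hφ.1, hφ.2.1.mul_left, (tsupport_mul_subset_right).trans hφ.2.2⟩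

theorem Tst_mul' {O : Set (ℝ × ℝ)} {g φ : ℝ × ℝ → ℝ} (hg : ContDiff ℝ ∞ g) (hφ : φ ∈ Tst O) :
    (fun z => φ z * g z) ∈ Tst O :=
  ⟨hφ.1.mul hg, hφ.2.1.mul_right, (tsupport_mul_subset_left).trans hφ.2.2⟩

theorem Tst_dd {O : Set (ℝ × ℝ)} {v : ℝ × ℝ} {φ : ℝ × ℝ → ℝ} (hφ : φ ∈ Tst O) :
    dd v φ ∈ Tst O :=
  ⟨dd_contDiff hφ.1, dd_compact hφ.2.1, dd_tsupport.trans hφ.2.2⟩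

theorem Tst_add {O : Set (ℝ × ℝ)} {g φ : ℝ × ℝ → ℝ} (hg : g ∈ Tst O) (hφ : φ ∈ Tst O) :
    (fun z => g z + φ z) ∈ Tst O := (Tst O).add_mem hg hφ

theorem Tst_PP {O : Set (ℝ × ℝ)} {σ ρ : ℝ} {φ : ℝ × ℝ → ℝ} (hφ : φ ∈ Tst O) :
    PP σ ρ φ ∈ Tst O := by
  unfold PP
  exact Tst_add (Tst_add (Tst_dd (Tst_dd hφ))
    (Tst_mul (g := fun _ => 2 * ρ * σ) contDiff_const (Tst_dd (Tst_dd hφ))))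
    (Tst_mul (g := fun _ => σ ^ 2) contDiff_const (Tst_dd (Tst_dd hφ)))

theorem Tst_Ast {O : Set (ℝ × ℝ)} {σ ρ κ θ q r : ℝ} {φ : ℝ × ℝ → ℝ} (hφ : φ ∈ Tst O) :
    Ast σ ρ κ θ q r φ ∈ Tst O := by
  unfold Ast
  refine Tst_add (Tst_add (Tst_add ?_ ?_) ?_) ?_
  · exact Tst_mul (g := fun z => -(z.2/2)) (by fun_prop) (Tst_PP hφ)
  · exact Tst_mul (g := fun z => (r - q - z.2 / 2 - ρ * σ)) (by fun_prop) (Tst_dd hφ)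
  · exact Tst_mul (g := fun z => (κ * (θ - z.2) - σ ^ 2)) (by fun_prop) (Tst_dd hφ)
  · exact Tst_mul (g := fun z => (r-κ)) (by fun_prop) hφ

/-- dividing a test function by `y` -/
theorem Tst_div {O : Set (ℝ × ℝ)} (hOsub : O ⊆ HH) {χ : ℝ × ℝ → ℝ} (hχ : χ ∈ Tst O) :
    ∃ X ∈ Tst O, ∀ z : ℝ × ℝ, z.2 * X z = 2 * χ z := by
  have hsup : tsupport (fun z : ℝ × ℝ => (2 / z.2) * χ z) ⊆ tsupport χ := tsupport_mul_subset_right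
  refine ⟨fun z => (2 / z.2) * χ z, ⟨?_, hχ.2.1.mul_left, hsup.trans hχ.2.2⟩, ?_⟩
  · rw [contDiff_iff_contDiffAt]
    intro z
    by_cases hz : z ∈ tsupport (fun z : ℝ × ℝ => (2 / z.2) * χ z)
    swap
    · exact contDiffAt_const.congr_of_eventuallyEq (notMem_tsupport_iff_eventuallyEq.1 hz)
    have h0 : 0 < z.2 := hOsub (hχ.2.2 (hsup hz))
    exact (contDiffAt_const.div contDiffAt_snd h0.ne').mul hχ.1.contDiffAt
  · intro z
    by_cases hz : χ z = 0
    · simp [hz]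
    · have h0 : 0 < z.2 := hOsub (hχ.2.2 (subset_tsupport _ hz))
      field_simp

/-- locally bounded and measurable -/
def LB (O : Set (ℝ × ℝ)) (u : ℝ × ℝ → ℝ) : Prop := ∀ χ ∈ Tst O, BM (fun z => u z * χ z)

/-- weak solution -/
def WS (σ ρ κ θ q r : ℝ) (O : Set (ℝ × ℝ)) (u f : ℝ × ℝ → ℝ) : Prop :=
  ∀ φ ∈ Tst O, ∫ z, u z * Ast σ ρ κ θ q r φ z = ∫ z, f z * φ z

theorem BM.congr {g h : ℝ × ℝ → ℝ} (hg : BM g) (e : g =ᵐ[volume] h) : BM h := by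
  refine ⟨hg.1.congr e, ?_⟩
  obtain ⟨M, hM⟩ := hg.2
  refine ⟨M, ?_⟩
  filter_upwards [hM, e] with z h1 h2
  rwa [← h2]

theorem BM.sub {g h : ℝ × ℝ → ℝ} (hg : BM g) (hh : BM h) : BM (fun z => g z - h z) := by
  refine ⟨hg.1.sub hh.1, ?_⟩
  obtain ⟨M, hM⟩ := hg.2
  obtain ⟨N, hN⟩ := hh.2
  refine ⟨M + N, ?_⟩
  filter_upwards [hM, hN] with z h1 h2
  exact (abs_sub _ _).trans (add_le_add h1 h2)

theorem BM_of_cont {g : ℝ × ℝ → ℝ} (hg : Continuous g) (hc : HasCompactSupport g) : BM g := by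
  refine ⟨hg.aestronglyMeasurable, ?_⟩
  obtain ⟨C, hC⟩ := hc.exists_bound_of_continuous hg
  exact ⟨C, Filter.Eventually.of_forall hC⟩

theorem LB.congr {O : Set (ℝ × ℝ)} {u v : ℝ × ℝ → ℝ} (hu : LB O u) (e : u =ᵐ[volume] v) :
    LB O v := by
  intro χ hχ
  refine (hu χ hχ).congr ?_
  filter_upwards [e] with z h
  rw [h]

theorem WS.congr {σ ρ κ θ q r : ℝ} {O : Set (ℝ × ℝ)} {u v f : ℝ × ℝ → ℝ}
    (hu : WS σ ρ κ θ q r O u f) (e : u =ᵐ[volume] v) : WS σ ρ κ θ q r O v f := by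
  intro φ hφ
  rw [← hu φ hφ]
  apply integral_congr_ae
  filter_upwards [e] with z h
  rw [h]

theorem LB_of_bound {O : Set (ℝ × ℝ)} {u W : ℝ × ℝ → ℝ} (hu : Measurable u) (hW : Continuous W)
    (h : ∀ z, |u z| ≤ W z) : LB O u := by
  intro χ hχ
  refine ⟨(hu.mul hχ.1.continuous.measurable).aestronglyMeasurable, ?_⟩
  obtain ⟨C, hC⟩ := (hχ.2.1.mul_left (f := W)).exists_bound_of_continuous (hW.mul hχ.1.continuous)
  refine ⟨C, Filter.Eventually.of_forall fun z => ?_⟩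
  refine le_trans ?_ (hC z)
  simp only [Pi.mul_apply]
  rw [abs_mul, norm_mul]
  exact mul_le_mul_of_nonneg_right ((h z).trans (le_abs_self _)) (abs_nonneg _)

theorem PP_mul (σ ρ : ℝ) {X φ : ℝ × ℝ → ℝ} (hX : ContDiff ℝ ∞ X) (hφ : ContDiff ℝ ∞ φ)
    (z : ℝ × ℝ) :
    PP σ ρ (fun z => X z * φ z) z = X z * PP σ ρ φ z + φ z * PP σ ρ X z
      + 2 * (dx X z + ρ * σ * dy X z) * dx φ z + 2 * (ρ * σ * dx X z + σ ^ 2 * dy X z) * dy φ z := by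
  have hXd := smooth_diff hX
  have hφd := smooth_diff hφ
  have e : ∀ v, dd v (fun z => X z * φ z) = fun z => dd v X z * φ z + X z * dd v φ z := by
    intro v; funext z
    rw [dd_mul (hXd z) (hφd z)]
    try ring
  simp only [PP, dx, dy, e]
  simp (disch := fun_prop) only [dd_add, dd_mul]
  ring

theorem loc_WE (σ ρ κ θ q r : ℝ) {O : Set (ℝ × ℝ)} (hO : IsOpen O) (hOsub : O ⊆ HH)
    {f : ℝ × ℝ → ℝ} (hf : ContinuousOn f O) {χ : ℝ × ℝ → ℝ} (hχ : χ ∈ Tst O) :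
    ∃ X ∈ Tst O, ∃ m0 ∈ Tst O, ∃ m1 ∈ Tst O, ∃ m2 ∈ Tst O, ∀ u, LB O u →
      WS σ ρ κ θ q r O u f →
      WE σ ρ (fun z => u z * χ z) (fun z => u z * m0 z - f z * X z) (fun z => u z * m1 z)
        (fun z => u z * m2 z) := by
  obtain ⟨X, hX, hXe⟩ := Tst_div hOsub hχ
  refine ⟨X, hX, Ast σ ρ κ θ q r X, Tst_Ast hX,
    fun z => (z.2 * dx X z + ρ * σ * z.2 * dy X z) + (-(r - q - z.2 / 2 - ρ * σ)) * X z, ?_,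
    fun z => (ρ * σ * z.2 * dx X z + σ ^ 2 * z.2 * dy X z) + (-(κ * (θ - z.2) - σ ^ 2)) * X z, ?_, ?_⟩
  · refine Tst_add (Tst_add ?_ ?_) ?_
    · exact Tst_mul (g := fun z => z.2) (by fun_prop) (Tst_dd hX)
    · exact Tst_mul (g := fun z => ρ * σ * z.2) (by fun_prop) (Tst_dd hX)
    · exact Tst_mul (g := fun z => (-(r - q - z.2 / 2 - ρ * σ))) (by fun_prop) hX
  · refine Tst_add (Tst_add ?_ ?_) ?_
    · exact Tst_mul (g := fun z => ρ * σ * z.2) (by fun_prop) (Tst_dd hX)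
    · exact Tst_mul (g := fun z => σ ^ 2 * z.2) (by fun_prop) (Tst_dd hX)
    · exact Tst_mul (g := fun z => (-(κ * (θ - z.2) - σ ^ 2))) (by fun_prop) hX
  intro u hu hw φ hφ
  have hXφ : (fun z => X z * φ z) ∈ Tst O := Tst_mul' hφ.smooth hX
  have h1 := hw _ hXφ
  have hXd := smooth_diff hX.1
  have hφd := smooth_diff hφ.smooth
  have e : ∀ v z, dd v (fun z => X z * φ z) z = dd v X z * φ z + X z * dd v φ z := by
    intro v z
    rw [dd_mul (hXd z) (hφd z)]
    try ring
  have i1 : Integrable (fun z => u z * Ast σ ρ κ θ q r (fun z => X z * φ z) z) := by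
    obtain ⟨χ', c1, c2, c3, _, c5⟩ := exists_cutoff hXφ.2.1 hO hXφ.2.2
    refine ((hu χ' ⟨c1, c2, c3⟩).int_mul (Tst_Ast (σ := σ) (ρ := ρ) (κ := κ) (θ := θ) (q := q) (r := r) hXφ).1.continuous
      (Tst_Ast hXφ).2.1).congr ?_
    refine Filter.Eventually.of_forall fun z => ?_
    by_cases hz : z ∈ tsupport (fun z => X z * φ z)
    · have : χ' z = 1 := c5.self_of_nhdsSet z hz
      simp [this]
    · have : Ast σ ρ κ θ q r (fun z => X z * φ z) z = 0 := by
        have := fun h => hz (Ast_tsupport σ ρ κ θ q r h)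
        exact image_eq_zero_of_notMem_tsupport this
      simp [this]
  have i2 : Integrable (fun z => f z * (X z * φ z)) :=
    (cont_mul hO hf hXφ.1.continuous hXφ.2.2).integrable_of_hasCompactSupport hXφ.2.1.mul_left
  have i3 : Integrable (fun z => u z * χ z * PP σ ρ φ z) := by
    have hp : PP σ ρ φ ∈ Tst univ := Tst_PP ⟨hφ.smooth, hφ.cpt, subset_univ _⟩
    exact (hu χ hχ).int_mul hp.1.continuous hp.2.1
  have key : ∀ z, (u z * Ast σ ρ κ θ q r X z - f z * X z) * φ z
      - u z * ((z.2 * dx X z + ρ * σ * z.2 * dy X z) + (-(r - q - z.2 / 2 - ρ * σ)) * X z) * dx φ z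
      - u z * ((ρ * σ * z.2 * dx X z + σ ^ 2 * z.2 * dy X z) + (-(κ * (θ - z.2) - σ ^ 2)) * X z) * dy φ z
      = (u z * Ast σ ρ κ θ q r (fun z => X z * φ z) z - f z * (X z * φ z))
        + u z * χ z * PP σ ρ φ z := by
    intro z
    have hz := hXe z
    have : χ z = z.2 * X z / 2 := by linarith
    rw [this, Ast, Ast, PP_mul σ ρ hX.1 hφ.smooth, dx, dx, dx, dy, dy, dy, e, e]
    ring
  have i12 : Integrable (fun z => u z * Ast σ ρ κ θ q r (fun z => X z * φ z) z - f z * (X z * φ z)) :=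
    i1.sub i2
  rw [integral_congr_ae (Filter.Eventually.of_forall key), integral_add i12 i3,
    integral_sub i1 i2, h1]
  simp

theorem locHolder_cont {α : ℝ} (hα : 0 < α) {O : Set (ℝ × ℝ)} (hO : IsOpen O) {f : ℝ × ℝ → ℝ}
    (hf : locHolderOn α O f) : ContinuousOn f O := by
  intro z hz
  obtain ⟨ε, hε, hεO⟩ := Metric.nhds_basis_closedBall.mem_iff.1 (hO.mem_nhds hz)
  obtain ⟨C, hC⟩ := hf _ (isCompact_closedBall z ε) hεO
  apply ContinuousAt.continuousWithinAt
  rw [ContinuousAt, tendsto_iff_dist_tendsto_zero]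
  have h0 : Filter.Tendsto (fun w => C * dist w z ^ α) (𝓝 z) (𝓝 0) := by
    have : ContinuousAt (fun w => C * dist w z ^ α) z := by
      refine continuousAt_const.mul (ContinuousAt.rpow_const ?_ (Or.inr hα.le))
      exact (continuous_id.dist continuous_const).continuousAt
    simpa [ContinuousAt, Real.zero_rpow hα.ne'] using this
  refine squeeze_zero' (Filter.Eventually.of_forall fun _ => dist_nonneg) ?_ h0
  filter_upwards [Metric.closedBall_mem_nhds z hε] with w hw
  rw [Real.dist_eq]
  exact hC w hw z (Metric.mem_closedBall_self hε.le)

theorem hol_mul {α : ℝ} (hα : 0 < α) (hα1 : α < 1) {O : Set (ℝ × ℝ)} (hO : IsOpen O) {f X : ℝ × ℝ → ℝ}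
    (hf : locHolderOn α O f) (hX : X ∈ Tst O) : Hol α (fun z => f z * X z) := by
  have hK := hX.2.1
  obtain ⟨L, hL, hKL, hLO⟩ := exists_compact_between hK hO hX.2.2
  obtain ⟨δ, hδ, hδL⟩ := hK.exists_thickening_subset_open isOpen_interior hKL
  obtain ⟨Cf, hCf⟩ := hf L hL hLO
  have hfc := locHolder_cont hα hO hf
  have hc : Continuous (fun z => f z * X z) := cont_mul hO hfc hX.1.continuous hX.2.2
  obtain ⟨B, hB⟩ := (hX.2.1.mul_left (f := f)).exists_bound_of_continuous hc
  obtain ⟨Mf, hMf⟩ := hL.exists_bound_of_continuousOn (hfc.mono hLO)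
  obtain ⟨MX, hMX⟩ := hX.2.1.exists_bound_of_continuous hX.1.continuous
  obtain ⟨Lp, hLp⟩ := (hX.1.of_le (m := 1) (by simp)).lipschitzWith_of_hasCompactSupport hX.2.1 (by simp)
  simp only [Real.norm_eq_abs, Pi.mul_apply] at hB hMf hMX
  have hB0 : 0 ≤ B := (abs_nonneg _).trans (hB 0)
  have hMX0 : 0 ≤ MX := (abs_nonneg _).trans (hMX 0)
  have hLp0 : 0 ≤ (Lp : ℝ) := Lp.2
  refine ⟨⟨B, hB⟩, 2 * B / δ ^ α + |Mf| * (Lp + 2 * MX) + MX * |Cf|, by positivity, ?_⟩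
  intro z w
  have hd : 0 ≤ dist z w := dist_nonneg
  have hda : 0 ≤ dist z w ^ α := by positivity
  have hXH : |X z - X w| ≤ (Lp + 2 * MX) * dist z w ^ α := by
    have h1 : |X z - X w| ≤ Lp * dist z w := by simpa [Real.dist_eq] using hLp.dist_le_mul z w
    have h2 : |X z - X w| ≤ 2 * MX := by
      have := abs_sub (X z) (X w)
      linarith [hMX z, hMX w]
    rcases le_total (dist z w) 1 with h | h
    · have h3 : dist z w ≤ dist z w ^ α := by
        simpa using Real.rpow_le_rpow_of_exponent_ge_of_imp hd h hα1.le (by intro _ h'; linarith)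
      nlinarith [mul_le_mul_of_nonneg_left h3 hLp0]
    · have h3 : 1 ≤ dist z w ^ α := Real.one_le_rpow h hα.le
      nlinarith
  have t1 : 0 ≤ 2 * B / δ ^ α * dist z w ^ α := by positivity
  have t2 : 0 ≤ |Mf| * (Lp + 2 * MX) * dist z w ^ α := by positivity
  have t3 : 0 ≤ MX * |Cf| * dist z w ^ α := by positivity
  rw [add_mul, add_mul]
  rcases le_or_gt δ (dist z w) with h | h
  · have h1 : 1 ≤ dist z w ^ α / δ ^ α := by
      rw [le_div_iff₀ (by positivity), one_mul]
      exact Real.rpow_le_rpow hδ.le h hα.le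
    have h2 : 2 * B / δ ^ α * dist z w ^ α = 2 * B * (dist z w ^ α / δ ^ α) := by ring
    have h3 := abs_sub (f z * X z) (f w * X w)
    have h4 := hB z
    have h5 := hB w
    nlinarith
  · by_cases hzw : z ∈ tsupport X ∨ w ∈ tsupport X
    · have hz : z ∈ L ∧ w ∈ L := by
        rcases hzw with hz | hw
        · refine ⟨interior_subset (hKL hz), interior_subset (hδL ?_)⟩
          exact Metric.mem_thickening_iff.2 ⟨z, hz, by rwa [dist_comm]⟩
        · refine ⟨interior_subset (hδL ?_), interior_subset (hKL hw)⟩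
          exact Metric.mem_thickening_iff.2 ⟨w, hw, h⟩
      have e : f z * X z - f w * X w = f z * (X z - X w) + X w * (f z - f w) := by ring
      have h1 : |f z * (X z - X w)| ≤ |Mf| * ((Lp + 2 * MX) * dist z w ^ α) := by
        rw [abs_mul]
        exact mul_le_mul ((hMf z hz.1).trans (le_abs_self _)) hXH (abs_nonneg _) (abs_nonneg _)
      have h2 : |X w * (f z - f w)| ≤ MX * (|Cf| * dist z w ^ α) := by
        rw [abs_mul]
        refine mul_le_mul (hMX w) ((hCf z hz.1 w hz.2).trans ?_) (abs_nonneg _) hMX0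
        exact mul_le_mul_of_nonneg_right (le_abs_self _) hda
      rw [e]
      have := abs_add_le (f z * (X z - X w)) (X w * (f z - f w))
      linarith
    · push Not at hzw
      beta_reduce
      rw [image_eq_zero_of_notMem_tsupport hzw.1, image_eq_zero_of_notMem_tsupport hzw.2]
      simp
      linarith

theorem J_lim_eq {η : ℝ × ℝ → ℝ} (hη : Ker η) (h1 : ∫ z, η z = 1) {U W : ℝ × ℝ → ℝ}
    (hU : Continuous U) (hW : Continuous W)
    (h : ∀ z, Filter.Tendsto (fun n => J η n U z) Filter.atTop (𝓝 (W z))) : U = W := by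
  refine (hU.ae_eq_iff_eq volume hW).1 ?_
  filter_upwards [J_ae_tendsto hη h1 hU.locallyIntegrable] with z hz
  exact tendsto_nhds_unique hz (h z)

/-- mollifications only see nearby values -/
theorem J_near {η : ℝ × ℝ → ℝ} (hη : Ker η) {u v : ℝ × ℝ → ℝ} {z₀ : ℝ × ℝ} {δ : ℝ} (hδ : 0 < δ)
    (h : ∀ z ∈ Metric.ball z₀ (2 * δ), u z = v z) {z : ℝ × ℝ} (hz : z ∈ Metric.ball z₀ δ) :
    ∀ᶠ n in Filter.atTop, J η n u z = J η n v z := by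
  obtain ⟨R, hR⟩ := hη.cpt.isBounded.subset_closedBall (0 : ℝ × ℝ)
  have h2 : Filter.Tendsto (fun n : ℕ => (2 : ℝ) ^ n) Filter.atTop Filter.atTop :=
    tendsto_pow_atTop_atTop_of_one_lt (by norm_num)
  filter_upwards [h2.eventually_gt_atTop (R / δ)] with n hn
  unfold J
  congr 1
  funext w
  by_cases hw : scl η n (z - w) = 0
  · rw [hw]; simp
  · have h3 : η ((2 : ℝ) ^ n • (z - w)) ≠ 0 := by
      intro h0
      apply hw
      simp [scl, h0]
    have h4 := hR (subset_tsupport _ h3)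
    rw [mem_closedBall_zero_iff, norm_smul, norm_pow, Real.norm_ofNat] at h4
    have h5 : ‖z - w‖ < δ := by
      rw [div_lt_iff₀ hδ] at hn
      have hp : (0 : ℝ) < 2 ^ n := by positivity
      by_contra hc
      push Not at hc
      nlinarith [mul_le_mul_of_nonneg_left hc hp.le]
    rw [h w ?_]
    rw [Metric.mem_ball] at hz ⊢
    have := dist_triangle w z z₀
    rw [dist_comm w z, dist_eq_norm z w] at this
    linarith

theorem cont_rep {σ ρ κ θ q r : ℝ} {η Ψ : ℝ × ℝ → ℝ} (kp : KP σ ρ η Ψ)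
    {α : ℝ} (hα : 0 < α) (hα1 : α < 1) {O : Set (ℝ × ℝ)} (hO : IsOpen O) (hOsub : O ⊆ HH)
    {f u : ℝ × ℝ → ℝ} (hf : ContinuousOn f O) (hu : LB O u) (hl : LocallyIntegrable u)
    (hw : WS σ ρ κ θ q r O u f) : ∃ v : ℝ × ℝ → ℝ, u =ᵐ[volume] v ∧ ContinuousOn v O := by
  refine ⟨fun z => Filter.limUnder Filter.atTop (fun n => J η n u z), ?_, ?_⟩
  · filter_upwards [J_ae_tendsto kp.kη kp.int1 hl] with z hz
    exact hz.limUnder_eq.symm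
  · intro z₀ hz₀
    obtain ⟨χ, c1, c2, c3, _, c5⟩ := exists_cutoff (isCompact_singleton (x := z₀)) hO
      (singleton_subset_iff.2 hz₀)
    have hχ : χ ∈ Tst O := ⟨c1, c2, c3⟩
    rw [nhdsSet_singleton] at c5
    obtain ⟨δ, hδ, hb⟩ := Metric.nhds_basis_ball.mem_iff.1 c5
    obtain ⟨X, hX, m0, hm0, m1, hm1, m2, hm2, H⟩ := loc_WE σ ρ κ θ q r hO hOsub hf hχ
    obtain ⟨W, hW, hlim⟩ := stage1 hα hα1 kp (hu χ hχ)
      ((hu m0 hm0).sub (BM_of_cont (cont_mul hO hf hX.1.continuous hX.2.2) hX.2.1.mul_left))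
      (hu m1 hm1) (hu m2 hm2) (H u hu hw)
    apply ContinuousAt.continuousWithinAt
    refine ((hW.cont hα).continuousAt (x := z₀)).congr ?_
    filter_upwards [Metric.ball_mem_nhds z₀ (half_pos hδ)] with z hz
    symm
    apply Filter.Tendsto.limUnder_eq
    refine (hlim z).congr' ?_
    refine J_near kp.kη (half_pos hδ) (z₀ := z₀) ?_ hz
    intro w hw
    have : χ w = 1 := hb (by simpa [mul_div_cancel₀] using hw)
    simp [this]

theorem Hol.add {α : ℝ} {g h : ℝ × ℝ → ℝ} (hg : Hol α g) (hh : Hol α h) :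
    Hol α (fun z => g z + h z) := by
  obtain ⟨⟨M, hM⟩, C, hC, h1⟩ := hg
  obtain ⟨⟨N, hN⟩, D, hD, h2⟩ := hh
  refine ⟨⟨M + N, fun z => (abs_add_le _ _).trans (add_le_add (hM z) (hN z))⟩, C + D, by positivity, ?_⟩
  intro z w
  have e : g z + h z - (g w + h w) = (g z - g w) + (h z - h w) := by ring
  rw [e, add_mul]
  exact (abs_add_le _ _).trans (add_le_add (h1 z w) (h2 z w))

theorem Hol.neg {α : ℝ} {g : ℝ × ℝ → ℝ} (hg : Hol α g) : Hol α (fun z => - g z) := by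
  obtain ⟨⟨M, hM⟩, C, hC, h1⟩ := hg
  refine ⟨⟨M, fun z => by simpa using hM z⟩, C, hC, ?_⟩
  intro z w
  have e : -g z - -g w = -(g z - g w) := by ring
  rw [e, abs_neg]
  exact h1 z w

theorem Hol.sub {α : ℝ} {g h : ℝ × ℝ → ℝ} (hg : Hol α g) (hh : Hol α h) :
    Hol α (fun z => g z - h z) := by
  simpa [sub_eq_add_neg] using hg.add hh.neg

theorem C1_of_dd {W : ℝ × ℝ → ℝ} (hd : Differentiable ℝ W) (hc : ∀ v, Continuous (dd v W)) :
    ContDiff ℝ 1 W := by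
  rw [contDiff_one_iff_fderiv]
  exact ⟨hd, continuous_clm_apply.2 hc⟩

theorem C2_of_dd {W : ℝ × ℝ → ℝ} (hd : Differentiable ℝ W) (hd' : ∀ v, Differentiable ℝ (dd v W))
    (hc : ∀ v w, Continuous (dd w (dd v W))) : ContDiff ℝ 2 W := by
  have : ContDiff ℝ (1 + 1) W := by
    rw [contDiff_succ_iff_fderiv]
    refine ⟨hd, by simp, ?_⟩
    rw [contDiff_clm_apply_iff]
    intro v
    exact C1_of_dd (hd' v) (hc v)
  simpa [one_add_one_eq_two] using this

theorem stageA {σ ρ κ θ q r : ℝ} {η Ψ : ℝ × ℝ → ℝ} (kp : KP σ ρ η Ψ)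
    {α : ℝ} (hα : 0 < α) (hα1 : α < 1) {O : Set (ℝ × ℝ)} (hO : IsOpen O) (hOsub : O ⊆ HH)
    {f u : ℝ × ℝ → ℝ} (hf : locHolderOn α O f) (hu : ContinuousOn u O)
    (hw : WS σ ρ κ θ q r O u f) (χ : ℝ × ℝ → ℝ) (hχ : χ ∈ Tst O) :
    Hol α (fun z => u z * χ z) := by
  have hfc := locHolder_cont hα hO hf
  have hcm : ∀ χ ∈ Tst O, Continuous (fun z => u z * χ z) := fun χ hχ =>
    cont_mul hO hu hχ.1.continuous hχ.2.2
  have hLB : LB O u := fun χ hχ => BM_of_cont (hcm χ hχ) hχ.2.1.mul_left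
  obtain ⟨X, hX, m0, hm0, m1, hm1, m2, hm2, H⟩ := loc_WE σ ρ κ θ q r hO hOsub hfc hχ
  obtain ⟨W, hW, hlim⟩ := stage1 hα hα1 kp (hLB χ hχ)
    ((hLB m0 hm0).sub (BM_of_cont (cont_mul hO hfc hX.1.continuous hX.2.2) hX.2.1.mul_left))
    (hLB m1 hm1) (hLB m2 hm2) (H u hLB hw)
  rw [J_lim_eq kp.kη kp.int1 (hcm χ hχ) (hW.cont hα) hlim]
  exact hW

theorem stageB {σ ρ κ θ q r : ℝ} {η Ψ : ℝ × ℝ → ℝ} (kp : KP σ ρ η Ψ)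
    {α : ℝ} (hα : 0 < α) (hα1 : α < 1) {O : Set (ℝ × ℝ)} (hO : IsOpen O) (hOsub : O ⊆ HH)
    {f u : ℝ × ℝ → ℝ} (hf : locHolderOn α O f) (hu : ContinuousOn u O)
    (hw : WS σ ρ κ θ q r O u f) (χ : ℝ × ℝ → ℝ) (hχ : χ ∈ Tst O) :
    Differentiable ℝ (fun z => u z * χ z) ∧ ∀ v, Hol α (dd v (fun z => u z * χ z)) := by
  have hfc := locHolder_cont hα hO hf
  have hA := stageA kp hα hα1 hO hOsub hf hu hw
  have hLB : LB O u := fun χ hχ => (hA χ hχ).bm hα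
  obtain ⟨X, hX, m0, hm0, m1, hm1, m2, hm2, H⟩ := loc_WE σ ρ κ θ q r hO hOsub hfc hχ
  obtain ⟨W, hW, hW', hlim⟩ := stage2 hα hα1 kp (hLB χ hχ)
    ((hLB m0 hm0).sub ((hol_mul hα hα1 hO hf hX).bm hα))
    (hA m1 hm1) (hA m2 hm2) (H u hLB hw)
  rw [J_lim_eq kp.kη kp.int1 ((hA χ hχ).cont hα) hW.continuous hlim]
  exact ⟨hW, hW'⟩

theorem stageC {σ ρ κ θ q r : ℝ} {η Ψ : ℝ × ℝ → ℝ} (kp : KP σ ρ η Ψ)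
    {α : ℝ} (hα : 0 < α) (hα1 : α < 1) {O : Set (ℝ × ℝ)} (hO : IsOpen O) (hOsub : O ⊆ HH)
    {f u : ℝ × ℝ → ℝ} (hf : locHolderOn α O f) (hu : ContinuousOn u O)
    (hw : WS σ ρ κ θ q r O u f) (χ : ℝ × ℝ → ℝ) (hχ : χ ∈ Tst O) :
    ContDiff ℝ 2 (fun z => u z * χ z) ∧ ∀ v w, Hol α (dd w (dd v (fun z => u z * χ z))) := by
  have hfc := locHolder_cont hα hO hf
  have hA := stageA kp hα hα1 hO hOsub hf hu hw
  have hB := stageB kp hα hα1 hO hOsub hf hu hw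
  have hLB : LB O u := fun χ hχ => (hA χ hχ).bm hα
  obtain ⟨X, hX, m0, hm0, m1, hm1, m2, hm2, H⟩ := loc_WE σ ρ κ θ q r hO hOsub hfc hχ
  have hC1 : ∀ χ ∈ Tst O, ContDiff ℝ 1 (fun z => u z * χ z) := fun χ hχ =>
    C1_of_dd (hB χ hχ).1 fun v => ((hB χ hχ).2 v).cont hα
  have hh : Hol α (fun z => (u z * m0 z - f z * X z) + dx (fun z => u z * m1 z) z
      + dy (fun z => u z * m2 z) z) :=
    (((hA m0 hm0).sub (hol_mul hα hα1 hO hf hX)).add ((hB m1 hm1).2 _)).add ((hB m2 hm2).2 _)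
  have hWE : WE σ ρ (fun z => u z * χ z) (fun z => (u z * m0 z - f z * X z)
      + dx (fun z => u z * m1 z) z + dy (fun z => u z * m2 z) z) (fun _ => 0) (fun _ => 0) := by
    intro φ hφ
    rw [H u hLB hw φ hφ]
    have hφ1 : ContDiff ℝ 1 φ := hφ.smooth.of_le (by simp)
    have b1 := ibp (v := (1, 0)) (hC1 m1 hm1) hφ1 hφ.cpt
    have b2 := ibp (v := (0, 1)) (hC1 m2 hm2) hφ1 hφ.cpt
    have i0 : Integrable (fun z => (u z * m0 z - f z * X z) * φ z) :=
      (((hA m0 hm0).sub (hol_mul hα hα1 hO hf hX)).bm hα).int_mul hφ.smooth.continuous hφ.cpt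
    have i1 : Integrable (fun z => u z * m1 z * dd (1, 0) φ z) :=
      ((hA m1 hm1).bm hα).int_mul (hφ.dd _).smooth.continuous (hφ.dd _).cpt
    have i2 : Integrable (fun z => u z * m2 z * dd (0, 1) φ z) :=
      ((hA m2 hm2).bm hα).int_mul (hφ.dd _).smooth.continuous (hφ.dd _).cpt
    have i3 : Integrable (fun z => dd (1, 0) (fun z => u z * m1 z) z * φ z) :=
      (((hB m1 hm1).2 _).bm hα).int_mul hφ.smooth.continuous hφ.cpt
    have i4 : Integrable (fun z => dd (0, 1) (fun z => u z * m2 z) z * φ z) :=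
      (((hB m2 hm2).2 _).bm hα).int_mul hφ.smooth.continuous hφ.cpt
    have e1 : ∫ z, ((u z * m0 z - f z * X z) * φ z - u z * m1 z * dd (1, 0) φ z
        - u z * m2 z * dd (0, 1) φ z) = (∫ z, (u z * m0 z - f z * X z) * φ z)
          - (∫ z, u z * m1 z * dd (1, 0) φ z) - ∫ z, u z * m2 z * dd (0, 1) φ z := by
      have i01 : Integrable (fun z => (u z * m0 z - f z * X z) * φ z - u z * m1 z * dd (1, 0) φ z) :=
        i0.sub i1
      rw [integral_sub i01 i2, integral_sub i0 i1]
    have e2 : ∫ z, ((u z * m0 z - f z * X z) * φ z + dd (1, 0) (fun z => u z * m1 z) z * φ z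
        + dd (0, 1) (fun z => u z * m2 z) z * φ z) = (∫ z, (u z * m0 z - f z * X z) * φ z)
          + (∫ z, dd (1, 0) (fun z => u z * m1 z) z * φ z)
          + ∫ z, dd (0, 1) (fun z => u z * m2 z) z * φ z := by
      have i03 : Integrable (fun z => (u z * m0 z - f z * X z) * φ z
          + dd (1, 0) (fun z => u z * m1 z) z * φ z) := i0.add i3
      rw [integral_add i03 i4, integral_add i0 i3]
    refine e1.trans ?_
    have e3 : ∀ z, ((u z * m0 z - f z * X z) + dx (fun z => u z * m1 z) z
      + dy (fun z => u z * m2 z) z) * φ z - 0 * dx φ z - 0 * dy φ z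
      = (u z * m0 z - f z * X z) * φ z + dd (1, 0) (fun z => u z * m1 z) z * φ z
        + dd (0, 1) (fun z => u z * m2 z) z * φ z := fun z => by rw [dx, dy]; ring
    rw [integral_congr_ae (Filter.Eventually.of_forall e3), e2]
    linarith
  obtain ⟨W, hW, hW', hW2, hlim⟩ := stage3 hα hα1 kp (hLB χ hχ) hh hWE
  rw [J_lim_eq kp.kη kp.int1 ((hA χ hχ).cont hα) hW.continuous hlim]
  exact ⟨C2_of_dd hW hW' fun v w => (hW2 v w).cont hα, hW2⟩

theorem Ast_near {σ ρ κ θ q r : ℝ} {φ χ u : ℝ × ℝ → ℝ} (h : ∀ z ∈ tsupport φ, χ z = 1) (z : ℝ × ℝ) :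
    u z * χ z * Ast σ ρ κ θ q r φ z = u z * Ast σ ρ κ θ q r φ z := by
  by_cases hz : z ∈ tsupport φ
  · rw [h z hz, mul_one]
  · have : Ast σ ρ κ θ q r φ z = 0 :=
      image_eq_zero_of_notMem_tsupport fun h' => hz (Ast_tsupport σ ρ κ θ q r h')
    rw [this]; simp

theorem hestonA_congr {σ ρ κ θ q r : ℝ} {u v : ℝ × ℝ → ℝ} {z : ℝ × ℝ} (h : u =ᶠ[𝓝 z] v) :
    hestonA σ ρ κ θ q r u z = hestonA σ ρ κ θ q r v z := by
  have h1 : ∀ w, dd w u =ᶠ[𝓝 z] dd w v := fun w => dd_congr' h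
  rw [hestonA_eq, hestonA_eq, PP, PP, dx, dx, dx, dx, dy, dy, dy, dy, dd_congr (h1 _),
    dd_congr (h1 _), dd_congr (h1 _), dd_congr h, dd_congr h, h.eq_of_nhds]

theorem regularity {σ ρ κ θ q r : ℝ} (hσ : σ ≠ 0) (hρ₁ : -1 < ρ) (hρ₂ : ρ < 1)
    {α : ℝ} (hα : 0 < α) (hα1 : α < 1) {O : Set (ℝ × ℝ)} (hO : IsOpen O) (hOsub : O ⊆ HH)
    {f u W : ℝ × ℝ → ℝ} (hf : locHolderOn α O f) (hu : Measurable u) (hW : Continuous W)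
    (hb : ∀ z, |u z| ≤ W z) (hw : WS σ ρ κ θ q r O u f) :
    ∃ v : ℝ × ℝ → ℝ, u =ᵐ[volume] v ∧ ContinuousOn v O ∧ C2alphaOn α O v ∧
      ∀ z ∈ O, hestonA σ ρ κ θ q r v z = f z := by
  obtain ⟨η, Ψ, k1, k2, k3, k4⟩ := kernel_exists hσ hρ₁ hρ₂
  have kp : KP σ ρ η Ψ := ⟨k1, k2, k3, k4⟩
  have hfc := locHolder_cont hα hO hf
  have hLB : LB O u := LB_of_bound hu hW hb
  have hl : LocallyIntegrable u := by
    refine hW.locallyIntegrable.mono hu.aestronglyMeasurable (Filter.Eventually.of_forall fun z => ?_)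
    exact (hb z).trans (le_abs_self _)
  obtain ⟨v, hv, hvc⟩ := cont_rep kp hα hα1 hO hOsub hfc hLB hl hw
  have hws := hw.congr hv
  have hA := stageA kp hα hα1 hO hOsub hf hvc hws
  have hB := stageB kp hα hα1 hO hOsub hf hvc hws
  have hC := stageC kp hα hα1 hO hOsub hf hvc hws
  have hcut : ∀ K : Set (ℝ × ℝ), IsCompact K → K ⊆ O → ∃ χ ∈ Tst O,
      ∀ z ∈ K, v =ᶠ[𝓝 z] (fun z => v z * χ z) := by
    intro K hK hKO
    obtain ⟨χ, c1, c2, c3, _, c5⟩ := exists_cutoff hK hO hKO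
    refine ⟨χ, ⟨c1, c2, c3⟩, fun z hz => ?_⟩
    filter_upwards [Filter.Eventually.filter_mono (nhds_le_nhdsSet hz) c5] with w hw
    simp [hw]
  have hloc : ∀ (g : ℝ × ℝ → ℝ) (T : (ℝ × ℝ → ℝ) → ℝ × ℝ → ℝ),
      (∀ χ ∈ Tst O, Hol α (T (fun z => v z * χ z))) →
      (∀ w z, v =ᶠ[𝓝 z] w → T v z = T w z) → locHolderOn α O (T v) := by
    intro g T h1 h2 K hK hKO
    obtain ⟨χ, hχ, hχe⟩ := hcut K hK hKO
    obtain ⟨_, C, hC, h3⟩ := h1 χ hχ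
    refine ⟨C, fun z hz w hw => ?_⟩
    rw [h2 _ z (hχe z hz), h2 _ w (hχe w hw)]
    exact h3 z w
  refine ⟨v, hv, hvc, ⟨?_, ?_, ?_, ?_⟩, ?_⟩
  · intro z hz
    obtain ⟨χ, hχ, hχe⟩ := hcut {z} isCompact_singleton (singleton_subset_iff.2 hz)
    exact ((hC χ hχ).1.contDiffAt.congr_of_eventuallyEq (hχe z rfl)).contDiffWithinAt
  · exact hloc v (fun u => u) hA fun w z h => h.eq_of_nhds
  · intro e
    exact hloc v (fun u => dd e u) (fun χ hχ => (hB χ hχ).2 e) fun w z h => dd_congr h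
  · intro e e'
    exact hloc v (fun u => dd e' (dd e u)) (fun χ hχ => (hC χ hχ).2 e e')
      fun w z h => dd_congr (dd_congr' h)
  · intro z₀ hz₀
    obtain ⟨χ, c1, c2, c3, _, c5⟩ := exists_cutoff (isCompact_singleton (x := z₀)) hO
      (singleton_subset_iff.2 hz₀)
    have hχ : χ ∈ Tst O := ⟨c1, c2, c3⟩
    rw [nhdsSet_singleton] at c5
    obtain ⟨δ, hδ, hb⟩ := Metric.nhds_basis_ball.mem_iff.1 (Filter.inter_mem c5 (hO.mem_nhds hz₀))
    have hχ1 : ∀ z ∈ Metric.ball z₀ δ, χ z = 1 := fun z hz => (hb hz).1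
    set U := fun z => v z * χ z with hU
    have hU2 : ContDiff ℝ 2 U := (hC χ hχ).1
    have e1 : Continuous (dd (1,0) U) := (C2_dd hU2).continuous
    have e2 : Continuous (dd (0,1) U) := (C2_dd hU2).continuous
    have e3 : Continuous (dd (1,0) (dd (1,0) U)) := C1_dd (C2_dd hU2)
    have e4 : Continuous (dd (0,1) (dd (1,0) U)) := C1_dd (C2_dd hU2)
    have e5 : Continuous (dd (0,1) (dd (0,1) U)) := C1_dd (C2_dd hU2)
    have e0 : Continuous U := hU2.continuous
    have hAc : Continuous (hestonA σ ρ κ θ q r U) := by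
      have : hestonA σ ρ κ θ q r U = fun z => _ := funext fun z => hestonA_eq σ ρ κ θ q r U z
      rw [this]; simp only [PP]; fun_prop
    have hfχ : Continuous (fun z => f z * χ z) := cont_mul hO hfc c1.continuous c3
    have hG : Continuous (fun z => hestonA σ ρ κ θ q r U z - f z * χ z) := hAc.sub hfχ
    have hae := Metric.isOpen_ball.ae_eq_zero_of_integral_contDiff_smul_eq_zero (U := Metric.ball z₀ δ)
      (μ := volume) (f := fun z => hestonA σ ρ κ θ q r U z - f z * χ z)
      (hG.locallyIntegrable.locallyIntegrableOn _) ?_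
    · have h2 : EqOn (fun z => hestonA σ ρ κ θ q r U z - f z * χ z) (fun _ => 0) (Metric.ball z₀ δ) := by
        refine Measure.eqOn_open_of_ae_eq (μ := volume) ?_ Metric.isOpen_ball hG.continuousOn continuousOn_const
        exact (ae_restrict_iff' Metric.isOpen_ball.measurableSet).2 hae
      have h3 := h2 (Metric.mem_ball_self hδ)
      simp only [hχ1 z₀ (Metric.mem_ball_self hδ), mul_one] at h3
      have h4 : v =ᶠ[𝓝 z₀] U := by
        filter_upwards [Metric.ball_mem_nhds z₀ hδ] with z hz
        simp [hU, hχ1 z hz]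
      rw [hestonA_congr h4]
      linarith
    · intro φ hφ hφc hφs
      have hT : φ ∈ Tst O := ⟨hφ, hφc, hφs.trans fun z hz => (hb hz).2⟩
      have a1 := integral_adj2 σ ρ κ θ q r hU2 hφ hφc
      have a2 := hws φ hT
      have a3 : ∫ z, U z * Ast σ ρ κ θ q r φ z = ∫ z, f z * φ z := by
        rw [← a2]
        refine integral_congr_ae (Filter.Eventually.of_forall fun z => ?_)
        exact Ast_near (fun z hz => hχ1 z (hφs hz)) z
      have a4 : ∀ z, φ z • (hestonA σ ρ κ θ q r U z - f z * χ z)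
          = hestonA σ ρ κ θ q r U z * φ z - f z * φ z := by
        intro z
        by_cases hz : z ∈ tsupport φ
        · rw [hχ1 z (hφs hz), smul_eq_mul]; ring
        · rw [image_eq_zero_of_notMem_tsupport hz]; simp
      have i1 : Integrable (fun z => hestonA σ ρ κ θ q r U z * φ z) :=
        (hAc.mul hφ.continuous).integrable_of_hasCompactSupport hφc.mul_left
      have i2 : Integrable (fun z => f z * φ z) :=
        (cont_mul hO hfc hφ.continuous hT.2.2).integrable_of_hasCompactSupport hφc.mul_left
      rw [integral_congr_ae (Filter.Eventually.of_forall a4), integral_sub i1 i2, ← a1, a3, sub_self]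

/-- the growth weight -/
def VV (M₁ M₂ : ℝ) (z : ℝ × ℝ) : ℝ := 1 + exp (M₁ * z.2) + exp (M₂ * z.1)

theorem VV_smooth (M₁ M₂ : ℝ) : ContDiff ℝ ∞ (VV M₁ M₂) := by
  unfold VV; fun_prop

theorem VV_ge (M₁ M₂ : ℝ) (z : ℝ × ℝ) : 1 ≤ VV M₁ M₂ z := by
  unfold VV; nlinarith [exp_pos (M₁ * z.2), exp_pos (M₂ * z.1)]

theorem exp_deriv1 (c t : ℝ) : HasDerivAt (fun t => exp (c * t)) (c * exp (c * t)) t := by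
  simpa [mul_comm] using ((hasDerivAt_id t).const_mul c).exp

theorem exp_deriv2 (c t : ℝ) : HasDerivAt (fun t => c * exp (c * t)) (c ^ 2 * exp (c * t)) t := by
  have := (exp_deriv1 c t).const_mul c
  rw [← mul_assoc, ← pow_two] at this
  exact this

theorem dx_fst_fun : dd (1, 0) (fun z : ℝ × ℝ => z.1) = fun _ => 1 := funext dx_fst
theorem dy_fst_fun : dd (0, 1) (fun z : ℝ × ℝ => z.1) = fun _ => 0 := funext dy_fst
theorem dx_snd_fun : dd (1, 0) (fun z : ℝ × ℝ => z.2) = fun _ => 0 := funext dx_snd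
theorem dy_snd_fun : dd (0, 1) (fun z : ℝ × ℝ => z.2) = fun _ => 1 := funext dy_snd

theorem hestonA_VV (σ ρ κ θ q r M₁ M₂ : ℝ) (z : ℝ × ℝ) :
    hestonA σ ρ κ θ q r (VV M₁ M₂) z = r
      + exp (M₁ * z.2) * (r - κ * θ * M₁ + z.2 * M₁ * (κ - σ ^ 2 * M₁ / 2))
      + exp (M₂ * z.1) * (r * (1 - M₂) + q * M₂ + z.2 / 2 * M₂ * (1 - M₂)) := by
  have h1 : ContDiff ℝ ∞ (fun z : ℝ × ℝ => exp (M₁ * z.2)) := by fun_prop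
  have h2 : ContDiff ℝ ∞ (fun z : ℝ × ℝ => exp (M₂ * z.1)) := by fun_prop
  have e : VV M₁ M₂ = fun z => 1 * (1 * (fun _ : ℝ × ℝ => (1 : ℝ)) z + 1 * (fun z : ℝ × ℝ => exp (M₁ * z.2)) z)
      + 1 * (fun z : ℝ × ℝ => exp (M₂ * z.1)) z := by
    funext z; simp [VV]
  have c1 : hestonA σ ρ κ θ q r (fun _ => (1 : ℝ)) z = r := by
    have : ∀ v, dd v (fun _ : ℝ × ℝ => (1 : ℝ)) = fun _ => 0 := fun v => funext fun z => dd_const 1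
    simp [hestonA_eq, PP, dx, dy, this, dd_const]
  rw [e, hestonA_lin σ ρ κ θ q r 1 1 (by fun_prop) h2, hestonA_lin σ ρ κ θ q r 1 1 (by fun_prop) h1, c1,
    hestonA_comp σ ρ κ θ q r (exp_deriv1 M₁) (exp_deriv2 M₁) smooth_snd,
    hestonA_comp σ ρ κ θ q r (exp_deriv1 M₂) (exp_deriv2 M₂) smooth_fst]
  simp only [hestonA_eq, PP, dx, dy, dx_fst_fun, dx_snd_fun, dy_fst_fun, dy_snd_fun, dd_const]
  ring

theorem VV_super {σ κ θ q r M₁ M₂ : ℝ} (ρ : ℝ) (hσ : σ ≠ 0) (hκ : 0 < κ) (hθ : 0 < θ) (hr : 0 < r)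
    (hq : 0 ≤ q) (h1 : 0 ≤ M₁) (h1' : M₁ < min (r / (κ * θ)) (2 * κ / σ ^ 2))
    (h2 : 0 ≤ M₂) (h2' : M₂ < 1) :
    ∃ c0 : ℝ, 0 < c0 ∧ ∀ z ∈ HH, c0 * VV M₁ M₂ z ≤ hestonA σ ρ κ θ q r (VV M₁ M₂) z := by
  have hσ2 : 0 < σ ^ 2 := by positivity
  have a1 : 0 < r - κ * θ * M₁ := by
    have := (lt_div_iff₀ (by positivity)).1 (lt_min_iff.1 h1').1
    linarith
  have a2 : 0 < κ - σ ^ 2 * M₁ / 2 := by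
    have := (lt_div_iff₀ hσ2).1 (lt_min_iff.1 h1').2
    linarith
  have a3 : 0 < r * (1 - M₂) := mul_pos hr (by linarith)
  refine ⟨min r (min (r - κ * θ * M₁) (r * (1 - M₂))), by positivity, ?_⟩
  intro z hz
  have hz : 0 < z.2 := hz
  rw [hestonA_VV]
  set c := min r (min (r - κ * θ * M₁) (r * (1 - M₂)))
  have b1 : c ≤ r := min_le_left _ _
  have b2 : c ≤ r - κ * θ * M₁ := (min_le_right _ _).trans (min_le_left _ _)
  have b3 : c ≤ r * (1 - M₂) := (min_le_right _ _).trans (min_le_right _ _)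
  have d1 : 0 ≤ z.2 * M₁ * (κ - σ ^ 2 * M₁ / 2) := by positivity
  have d2 : 0 ≤ q * M₂ + z.2 / 2 * M₂ * (1 - M₂) := by
    have : 0 ≤ 1 - M₂ := by linarith
    positivity
  have g1 := mul_le_mul_of_nonneg_left (b2.trans (le_add_of_nonneg_right d1)) (exp_pos (M₁ * z.2)).le
  have g2 := mul_le_mul_of_nonneg_left (b3.trans (le_add_of_nonneg_right d2)) (exp_pos (M₂ * z.1)).le
  rw [VV]
  linarith

/-- the shifted squared distance -/
def NN (z₀ p z : ℝ × ℝ) : ℝ :=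
  (z.1 - z₀.1) * (z.1 - z₀.1) + (z.2 - z₀.2) * (z.2 - z₀.2)
    - 2 * p.1 * (z.1 - z₀.1) - 2 * p.2 * (z.2 - z₀.2)

theorem NN_smooth (z₀ p : ℝ × ℝ) : ContDiff ℝ ∞ (NN z₀ p) := by
  unfold NN; fun_prop

theorem hestonA_NN (σ ρ κ θ q r l : ℝ) (z₀ p z : ℝ × ℝ) :
    hestonA σ ρ κ θ q r (fun z => exp (-l * NN z₀ p z)) z = exp (-l * NN z₀ p z) *
      (-l * (-(z.2 * (1 + σ ^ 2)) - (r - q - z.2 / 2) * (2 * (z.1 - z₀.1 - p.1))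
        - κ * (θ - z.2) * (2 * (z.2 - z₀.2 - p.2)))
      - (z.2 / 2) * l ^ 2 * (4 * ((z.1 - z₀.1 - p.1) ^ 2
        + 2 * ρ * σ * (z.1 - z₀.1 - p.1) * (z.2 - z₀.2 - p.2) + σ ^ 2 * (z.2 - z₀.2 - p.2) ^ 2)) + r) := by
  have hx : dd (1, 0) (NN z₀ p) = fun z => 2 * (z.1 - z₀.1 - p.1) := by
    funext z
    unfold NN
    simp (disch := fun_prop) only [dd_add, dd_sub, dd_mul, dd_const, dx_snd, dy_snd, dx_fst, dy_fst]
    ring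
  have hy : dd (0, 1) (NN z₀ p) = fun z => 2 * (z.2 - z₀.2 - p.2) := by
    funext z
    unfold NN
    simp (disch := fun_prop) only [dd_add, dd_sub, dd_mul, dd_const, dx_snd, dy_snd, dx_fst, dy_fst]
    ring
  rw [hestonA_comp σ ρ κ θ q r (exp_deriv1 (-l)) (exp_deriv2 (-l)) (NN_smooth z₀ p)]
  simp only [hestonA_eq, PP, dx, dy, hx, hy]
  simp (disch := fun_prop) only [dd_add, dd_sub, dd_mul, dd_const, dx_snd, dy_snd, dx_fst, dy_fst]
  ring

theorem barrier_B {σ κ θ q r y a b S : ℝ} (hκ : 0 < κ) (hz : 0 < y) (hS0 : 0 < S)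
    (hSa : |a| ≤ 1 + S) (hSb : |b| ≤ 1 + S) :
    -(-(y * (1 + σ ^ 2)) - (r - q - y / 2) * (2 * a) - κ * (θ - y) * (2 * b))
      ≤ (2 + σ ^ 2 + 2 * |r - q| + 2 * κ * |θ| + 2 * κ) * (1 + y) * (1 + S) := by
  have t1 : (r - q) * (2 * a) ≤ 2 * |r - q| * (1 + S) := by
    have := le_abs_self ((r - q) * a)
    rw [abs_mul] at this
    nlinarith [mul_le_mul_of_nonneg_left hSa (abs_nonneg (r - q))]
  have t2 : -(y * a) ≤ y * (1 + S) := by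
    have := neg_abs_le a
    nlinarith
  have t3 : κ * θ * (2 * b) ≤ 2 * κ * |θ| * (1 + S) := by
    have := le_abs_self (θ * b)
    rw [abs_mul] at this
    have h := mul_le_mul_of_nonneg_left hSb (abs_nonneg θ)
    nlinarith
  have t4 : -(κ * y * (2 * b)) ≤ 2 * κ * y * (1 + S) := by
    have := neg_abs_le b
    have hky : 0 < κ * y := by positivity
    nlinarith
  have t5 : y * (1 + σ ^ 2) ≤ y * (1 + σ ^ 2) * (1 + S) := le_mul_of_one_le_right (by positivity) (by linarith)
  have n1 : 0 ≤ (2 + σ ^ 2 + 2 * κ) * (1 + S) := by positivity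
  have n2 : 0 ≤ (2 * |r - q| + 2 * κ * |θ|) * y * (1 + S) := by positivity
  linarith

set_option maxHeartbeats 1000000 in
theorem barrier_A {σ ρ κ q r : ℝ} (θ : ℝ) (hσ : σ ≠ 0) (hρ₁ : -1 < ρ) (hρ₂ : ρ < 1)
    (hκ : 0 < κ) (hr : 0 < r) {z₀ p : ℝ × ℝ} (hz₀ : 0 < z₀.2)
    (hp : 0 < p.1 ^ 2 + p.2 ^ 2) (hp' : p.1 ^ 2 + p.2 ^ 2 ≤ (z₀.2 / 8) ^ 2) {ε : ℝ} (hε : 0 < ε) :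
    ∃ Λ : ℝ, 0 < Λ ∧ ∀ l ≥ Λ, ∀ z : ℝ × ℝ, 0 < z.2 → 0 ≤ NN z₀ p z →
      hestonA σ ρ κ θ q r (fun z => exp (-l * NN z₀ p z)) z ≤ ε := by
  obtain ⟨P, hP⟩ : ∃ P, P = p.1 ^ 2 + p.2 ^ 2 := ⟨_, rfl⟩
  rw [← hP] at hp hp'
  set Y := z₀.2 with hY
  obtain ⟨m, hm⟩ : ∃ m, m = (1 - ρ ^ 2) * σ ^ 2 / (1 + σ ^ 2) := ⟨_, rfl⟩
  have hρ2 : 0 < 1 - ρ ^ 2 := by nlinarith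
  have hm0 : 0 < m := by rw [hm]; positivity
  have hQ : ∀ a b : ℝ, m * (a ^ 2 + b ^ 2) ≤ a ^ 2 + 2 * ρ * σ * a * b + σ ^ 2 * b ^ 2 := by
    intro a b
    have h1 : 0 < 1 + σ ^ 2 := by positivity
    rw [hm, div_mul_eq_mul_div, div_le_iff₀ h1]
    nlinarith [sq_nonneg (a + ρ * σ * b), sq_nonneg (ρ * σ * a + σ ^ 2 * b)]
  obtain ⟨b0, hb0⟩ : ∃ b0, b0 = (2 + σ ^ 2 + 2 * |r - q| + 2 * κ * |θ| + 2 * κ) * (1 + 1 / P) := ⟨_, rfl⟩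
  have hb0p : 0 < b0 := by rw [hb0]; positivity
  obtain ⟨b1, hb1⟩ : ∃ b1, b1 = b0 * (1 + Y / 2) := ⟨_, rfl⟩
  have hb1p : 0 < b1 := by rw [hb1]; positivity
  obtain ⟨X, hX⟩ : ∃ X, X = b0 * (2 / Y + 1) + 2 * r / (P * Y) := ⟨_, rfl⟩
  have hXp : 0 < X := by rw [hX]; positivity
  refine ⟨1 + X / (2 * m) + (1 + 8 * (b1 + r) / ε) / P, by positivity, ?_⟩
  intro l hl z hz hN
  have l1 : 1 ≤ l := by
    have : 0 < X / (2 * m) + (1 + 8 * (b1 + r) / ε) / P := by positivity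
    linarith
  have l2 : X ≤ l * (2 * m) := by
    rw [← div_le_iff₀ (by positivity)]
    have : 0 < (1 + 8 * (b1 + r) / ε) / P := by positivity
    linarith
  have l3 : 1 + 8 * (b1 + r) / ε ≤ l * P := by
    rw [← div_le_iff₀ hp]
    have : 0 < X / (2 * m) := by positivity
    linarith
  rw [hestonA_NN]
  obtain ⟨a, ha⟩ : ∃ a, a = z.1 - z₀.1 - p.1 := ⟨_, rfl⟩
  obtain ⟨b, hb⟩ : ∃ b, b = z.2 - Y - p.2 := ⟨_, rfl⟩
  obtain ⟨y, hy⟩ : ∃ y, y = z.2 := ⟨_, rfl⟩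
  obtain ⟨S, hS⟩ : ∃ S, S = a ^ 2 + b ^ 2 := ⟨_, rfl⟩
  have hNS : NN z₀ p z = S - P := by rw [hS, hP, NN, ha, hb]; ring
  rw [hNS] at hN ⊢
  rw [← ha, ← hY, ← hb, ← hy]
  rw [← hy] at hz
  have hSP : P ≤ S := by linarith
  have hS0 : 0 < S := by linarith
  have hSa : |a| ≤ 1 + S := by
    have h1 : |a| ^ 2 = a ^ 2 := sq_abs a
    nlinarith [sq_nonneg (|a| - 1), sq_nonneg b]
  have hSb : |b| ≤ 1 + S := by
    have h1 : |b| ^ 2 = b ^ 2 := sq_abs b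
    nlinarith [sq_nonneg (|b| - 1), sq_nonneg a]
  have hk : 1 + S ≤ S * (1 + 1 / P) := by
    have : 1 ≤ S * (1 / P) := by rw [mul_one_div, le_div_iff₀ hp]; linarith
    linarith
  have hB : -(-(y * (1 + σ ^ 2)) - (r - q - y / 2) * (2 * a) - κ * (θ - y) * (2 * b))
      ≤ b0 * (1 + y) * S := by
    have t6 := barrier_B (r := r) (q := q) (σ := σ) (θ := θ) hκ hz hS0 hSa hSb
    refine t6.trans ?_
    rw [hb0]
    have n3 : 0 ≤ (2 + σ ^ 2 + 2 * |r - q| + 2 * κ * |θ| + 2 * κ) * (1 + y) := by positivity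
    have := mul_le_mul_of_nonneg_left hk n3
    linarith
  have hT : -l * (-(y * (1 + σ ^ 2)) - (r - q - y / 2) * (2 * a) - κ * (θ - y) * (2 * b))
      - (y / 2) * l ^ 2 * (4 * (a ^ 2 + 2 * ρ * σ * a * b + σ ^ 2 * b ^ 2)) + r
      ≤ l * (b0 * (1 + y) * S) - 2 * l ^ 2 * y * (m * S) + r := by
    have h1 := mul_le_mul_of_nonneg_left hB (by linarith : (0:ℝ) ≤ l)
    have h2 := mul_le_mul_of_nonneg_left (hQ a b) (by positivity : (0:ℝ) ≤ 2 * l ^ 2 * y)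
    rw [← hS] at h2
    linarith
  refine (mul_le_mul_of_nonneg_left hT (exp_pos _).le).trans ?_
  rcases le_or_gt (Y / 2) y with hc | hc
  · have h1 : 1 ≤ 2 * y / Y := by rw [le_div_iff₀ hz₀]; linarith
    have h2 : 1 + y ≤ (2 / Y + 1) * y := by
      have : (2 / Y + 1) * y = 2 * y / Y + y := by ring
      linarith
    have h3 : r ≤ l * (2 * r / (P * Y)) * (y * S) := by
      have e : l * (2 * r / (P * Y)) * (y * S) = l * r * ((2 * y / Y) * (S / P)) := by ring
      have h4 : 1 ≤ S / P := by rw [le_div_iff₀ hp]; linarith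
      have h5 : 1 ≤ (2 * y / Y) * (S / P) := one_le_mul_of_one_le_of_one_le h1 h4
      rw [e]
      have h6 : r ≤ l * r := le_mul_of_one_le_left hr.le l1
      exact h6.trans (le_mul_of_one_le_right (hr.le.trans h6) h5)
    have h4 : l * (b0 * (1 + y) * S) ≤ l * (b0 * ((2 / Y + 1) * y) * S) := by gcongr
    have h5 : l * (b0 * (1 + y) * S) - 2 * l ^ 2 * y * (m * S) + r ≤ 0 := by
      have h6 : l * X * (y * S) ≤ l * (l * (2 * m)) * (y * S) := by gcongr
      rw [hX] at h6
      linarith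
    exact (mul_nonpos_of_nonneg_of_nonpos (exp_pos _).le h5).trans hε.le
  · have p2 : p.2 ^ 2 ≤ (Y / 8) ^ 2 := by linarith [sq_nonneg p.1]
    have p3 := abs_le.1 (abs_le_of_sq_le_sq p2 (by positivity : 0 ≤ Y / 8))
    have hb3 : 3 * Y / 8 ≤ -b := by rw [hb, ← hy]; linarith [p3.1]
    have hb4 : (3 * Y / 8) ^ 2 ≤ b ^ 2 := by
      rw [← neg_sq b]
      exact pow_le_pow_left₀ (by positivity) hb3 2
    have hSP2 : 2 * P ≤ S := by linarith [sq_nonneg a, sq_nonneg Y]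
    obtain ⟨t, ht⟩ : ∃ t, t = l * S := ⟨_, rfl⟩
    have ht1 : 1 + 8 * (b1 + r) / ε ≤ t := by
      rw [ht]; exact l3.trans (mul_le_mul_of_nonneg_left hSP (by linarith))
    have ht0 : 1 ≤ t := by
      have : 0 < 8 * (b1 + r) / ε := by positivity
      linarith
    have ht2 : 8 * (b1 + r) ≤ ε * t := by
      have : 8 * (b1 + r) / ε ≤ t := by linarith
      rw [div_le_iff₀ hε] at this
      linarith
    have hE : exp (-l * (S - P)) ≤ exp (-(t / 2)) := by
      apply exp_le_exp.2
      rw [ht]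
      have := mul_le_mul_of_nonneg_left hSP2 (by linarith : (0:ℝ) ≤ l)
      linarith
    have hT2 : l * (b0 * (1 + y) * S) - 2 * l ^ 2 * y * (m * S) + r ≤ (b1 + r) * t := by
      have h1 : 0 ≤ 2 * l ^ 2 * y * (m * S) := by positivity
      have h2 : l * (b0 * (1 + y) * S) ≤ b1 * t := by
        rw [hb1, ht]
        have : l * (b0 * (1 + y) * S) ≤ l * (b0 * (1 + Y / 2) * S) := by gcongr
        linarith
      have h3 : r ≤ r * t := le_mul_of_one_le_right hr.le ht0
      linarith
    have hq := quadratic_le_exp_of_nonneg (x := t / 2) (by linarith)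
    calc exp (-l * (S - P)) * (l * (b0 * (1 + y) * S) - 2 * l ^ 2 * y * (m * S) + r)
        ≤ exp (-l * (S - P)) * ((b1 + r) * t) := mul_le_mul_of_nonneg_left hT2 (exp_pos _).le
      _ ≤ exp (-(t / 2)) * ((b1 + r) * t) := mul_le_mul_of_nonneg_right hE (by positivity)
      _ ≤ ε := by
        rw [exp_neg, inv_mul_le_iff₀ (exp_pos _)]
        have h8 : 8 * (b1 + r) * t ≤ ε * t * t := by gcongr
        have h9 : ε * t * t / 8 ≤ exp (t / 2) * ε := by
          have := mul_le_mul_of_nonneg_right hq hε.le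
          have h10 : 0 ≤ (1 + t / 2) * ε := by positivity
          linarith
        linarith

theorem ext_geom {O : Set (ℝ × ℝ)} (hO : IsOpen O) (hs : extSphere O (Gamma1 O)) {z₀ : ℝ × ℝ}
    (hz₀ : z₀ ∈ Gamma1 O) : ∃ p : ℝ × ℝ, 0 < p.1 ^ 2 + p.2 ^ 2 ∧
      p.1 ^ 2 + p.2 ^ 2 ≤ (z₀.2 / 8) ^ 2 ∧
      ∀ z ∈ O, ((z.1 - z₀.1) ^ 2 + (z.2 - z₀.2) ^ 2) / 2 ≤ NN z₀ p z := by
  obtain ⟨c, R, hR, hball⟩ := hs z₀ hz₀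
  have hy : 0 < z₀.2 := hz₀.2
  have hzO : z₀ ∉ O := fun h => by
    have := hz₀.1.2
    rw [hO.interior_eq] at this
    exact this h
  have hout : ∀ z ∈ O, R ^ 2 ≤ (z.1 - c.1) ^ 2 + (z.2 - c.2) ^ 2 := by
    intro z hz
    by_contra hlt
    push Not at hlt
    have hm : z ∈ {z : ℝ × ℝ | Real.sqrt ((z.1 - c.1) ^ 2 + (z.2 - c.2) ^ 2) ≤ R} ∩ closure O :=
      ⟨(Real.sqrt_le_left hR.le).2 hlt.le, subset_closure hz⟩
    rw [hball] at hm
    exact hzO (hm ▸ hz)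
  have hle : (z₀.1 - c.1) ^ 2 + (z₀.2 - c.2) ^ 2 ≤ R ^ 2 := by
    have hm : z₀ ∈ {z : ℝ × ℝ | Real.sqrt ((z.1 - c.1) ^ 2 + (z.2 - c.2) ^ 2) ≤ R} ∩ closure O := by
      rw [hball]; rfl
    exact (Real.sqrt_le_left hR.le).1 hm.1
  have hge : R ^ 2 ≤ (z₀.1 - c.1) ^ 2 + (z₀.2 - c.2) ^ 2 := by
    have hcl : IsClosed {z : ℝ × ℝ | R ^ 2 ≤ (z.1 - c.1) ^ 2 + (z.2 - c.2) ^ 2} :=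
      isClosed_le (by fun_prop) (by fun_prop)
    exact closure_minimal (show O ⊆ {z : ℝ × ℝ | R ^ 2 ≤ (z.1 - c.1) ^ 2 + (z.2 - c.2) ^ 2} from hout)
      hcl hz₀.1.1
  have hR2 : 0 < R ^ 2 := by positivity
  obtain ⟨t, ht⟩ : ∃ t, t = min (1 / 2) (z₀.2 / (8 * R)) := ⟨_, rfl⟩
  have ht0 : 0 < t := by rw [ht]; positivity
  have ht1 : t ≤ 1 / 2 := by rw [ht]; exact min_le_left _ _
  have ht2 : t * R ≤ z₀.2 / 8 := by
    have : t ≤ z₀.2 / (8 * R) := by rw [ht]; exact min_le_right _ _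
    calc t * R ≤ z₀.2 / (8 * R) * R := by gcongr
      _ = z₀.2 / 8 := by field_simp
  have hp : (t * (c.1 - z₀.1)) ^ 2 + (t * (c.2 - z₀.2)) ^ 2 = (t * R) ^ 2 := by
    have : (z₀.1 - c.1) ^ 2 + (z₀.2 - c.2) ^ 2 = R ^ 2 := le_antisymm hle hge
    rw [mul_pow t R, ← this]; ring
  refine ⟨(t * (c.1 - z₀.1), t * (c.2 - z₀.2)), ?_, ?_, ?_⟩
  · rw [hp]; positivity
  · rw [hp]; exact pow_le_pow_left₀ (by positivity) ht2 2
  · intro z hz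
    have h1 := hout z hz
    have h2 : 0 ≤ (z.1 - z₀.1) ^ 2 + (z.2 - z₀.2) ^ 2 - 2 * (c.1 - z₀.1) * (z.1 - z₀.1)
        - 2 * (c.2 - z₀.2) * (z.2 - z₀.2) := by
      nlinarith
    have h3 := mul_nonneg ht0.le h2
    have h4 : 0 ≤ (1 / 2 - t) * ((z.1 - z₀.1) ^ 2 + (z.2 - z₀.2) ^ 2) := by
      have : 0 ≤ 1 / 2 - t := by linarith
      positivity
    simp only [NN]
    linarith

theorem barrier {σ ρ κ θ q r : ℝ} (hσ : σ ≠ 0) (hρ₁ : -1 < ρ) (hρ₂ : ρ < 1)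
    (hκ : 0 < κ) (hr : 0 < r) {O : Set (ℝ × ℝ)} (hO : IsOpen O) (hOsub : O ⊆ HH)
    (hs : extSphere O (Gamma1 O)) {V f G : ℝ × ℝ → ℝ} (hV : ContDiff ℝ ∞ V) (hV1 : ∀ z, 1 ≤ V z)
    {c0 Cf CG C1 : ℝ} (hVA : ∀ z ∈ O, c0 * V z ≤ hestonA σ ρ κ θ q r V z)
    (hf : ∀ z ∈ O, f z ≤ Cf * V z) (hG : Continuous G) (hGb : ∀ z, G z ≤ CG * V z)
    (h0 : 0 ≤ C1) (h1 : Cf + 1 ≤ C1 * c0) (h2 : CG + 1 ≤ C1) {z₀ : ℝ × ℝ} (hz₀ : z₀ ∈ Gamma1 O)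
    {ε : ℝ} (hε : 0 < ε) (hε1 : ε < 1) :
    ∃ w, Super σ ρ κ θ q r O V f G w ∧ w z₀ = G z₀ + ε := by
  obtain ⟨p, hp, hp', hN⟩ := ext_geom hO hs hz₀
  have hy : 0 < z₀.2 := hz₀.2
  set D : ℝ × ℝ → ℝ := fun z => C1 * V z - G z with hD
  have hDc : Continuous D := (continuous_const.mul hV.continuous).sub hG
  have hD1 : ∀ z, 1 ≤ D z := by
    intro z
    have a1 := hV1 z
    have a2 := hGb z
    have a3 := mul_le_mul_of_nonneg_right h2 (by linarith : 0 ≤ V z)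
    simp only [hD]; linarith
  obtain ⟨K, hK⟩ : ∃ K, K = D z₀ - ε := ⟨_, rfl⟩
  have hK0 : 0 < K := by have := hD1 z₀; linarith
  obtain ⟨Λ, hΛ, hΛA⟩ := barrier_A (σ := σ) (ρ := ρ) (q := q) θ hσ hρ₁ hρ₂ hκ hr hy hp hp'
    (ε := 1 / K) (by positivity)
  have hnear : ∀ᶠ z in 𝓝 z₀, K < D z := hDc.continuousAt.eventually_const_lt (by linarith)
  obtain ⟨δ, hδ, hδb⟩ := Metric.nhds_basis_ball.mem_iff.1 hnear
  obtain ⟨l, hl⟩ : ∃ l, l = Λ + 2 * K / δ ^ 2 := ⟨_, rfl⟩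
  have hlΛ : Λ ≤ l := by
    have : 0 < 2 * K / δ ^ 2 := by positivity
    linarith
  have hl0 : 0 < l := by linarith
  have hlK : 2 * K ≤ l * δ ^ 2 := by
    rw [← div_le_iff₀ (by positivity)]; linarith
  have hH : ContDiff ℝ ∞ (fun z => exp (-l * NN z₀ p z)) := by
    have := NN_smooth z₀ p
    fun_prop
  have hN0 : ∀ z ∈ O, 0 ≤ NN z₀ p z := fun z hz => le_trans (by positivity) (hN z hz)
  have hH1 : ∀ z ∈ O, exp (-l * NN z₀ p z) ≤ 1 := by
    intro z hz
    rw [exp_le_one_iff]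
    nlinarith [mul_nonneg hl0.le (hN0 z hz)]
  refine ⟨fun z => C1 * V z + (-K) * exp (-l * NN z₀ p z), ⟨?_, ?_, ?_, ?_⟩, ?_⟩
  · exact (contDiff_const.mul hV).add (contDiff_const.mul hH)
  · intro z hz
    rw [hestonA_lin σ ρ κ θ q r C1 (-K) hV hH]
    have a1 := hΛA l hlΛ z (hOsub hz) (hN0 z hz)
    have a2 := mul_le_mul_of_nonneg_left a1 hK0.le
    rw [mul_one_div_cancel hK0.ne'] at a2
    have a3 := mul_le_mul_of_nonneg_left (hVA z hz) h0
    have a4 := mul_le_mul_of_nonneg_right h1 (by linarith [hV1 z] : 0 ≤ V z)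
    have a5 := hf z hz
    have a6 := hV1 z
    linarith
  · intro z hz
    suffices h : K * exp (-l * NN z₀ p z) ≤ D z by
      simp only [hD] at h; linarith
    by_cases hzb : z ∈ Metric.ball z₀ δ
    · have a1 : K < D z := hδb hzb
      have := mul_le_mul_of_nonneg_left (hH1 z hz) hK0.le
      linarith
    · have a1 : δ ^ 2 ≤ (z.1 - z₀.1) ^ 2 + (z.2 - z₀.2) ^ 2 := by
        rw [Metric.mem_ball, not_lt, Prod.dist_eq, le_max_iff, Real.dist_eq, Real.dist_eq] at hzb
        rcases hzb with h | h
        · have := pow_le_pow_left₀ hδ.le h 2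
          rw [sq_abs] at this
          linarith [sq_nonneg (z.2 - z₀.2)]
        · have := pow_le_pow_left₀ hδ.le h 2
          rw [sq_abs] at this
          linarith [sq_nonneg (z.1 - z₀.1)]
      have a2 := hN z hz
      have a3 : K ≤ l * NN z₀ p z := by
        have : l * (δ ^ 2 / 2) ≤ l * NN z₀ p z := mul_le_mul_of_nonneg_left (by linarith) hl0.le
        linarith
      have a4 : K * exp (-l * NN z₀ p z) ≤ 1 := by
        rw [neg_mul, exp_neg, mul_inv_le_iff₀ (exp_pos _), one_mul]
        linarith [add_one_le_exp (l * NN z₀ p z)]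
      linarith [hD1 z]
  · refine ⟨C1 + K, fun z hz => ?_⟩
    have a1 := hH1 z hz
    have a2 := exp_pos (-l * NN z₀ p z)
    have a3 := hV1 z
    have a4 := mul_le_mul_of_nonneg_left a1 hK0.le
    have a5 := mul_le_mul_of_nonneg_left a3 hK0.le
    have a6 : 0 ≤ C1 * V z := mul_nonneg h0 (by linarith)
    have a7 := mul_pos hK0 a2
    rw [abs_le]
    constructor <;> linarith
  · have : NN z₀ p z₀ = 0 := by simp [NN]
    simp only [this, hK, hD]
    simp
    try ring

theorem ae_le_imp {O : Set (ℝ × ℝ)} (hO : IsOpen O) {v w : ℝ × ℝ → ℝ} (hv : ContinuousOn v O)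
    (hw : ContinuousOn w O) (h : ∀ᵐ z ∂(volume.restrict O), v z ≤ w z) : ∀ z ∈ O, v z ≤ w z := by
  have ho : IsOpen (O ∩ (fun z => v z - w z) ⁻¹' (Ioi 0)) :=
    (hv.sub hw).isOpen_inter_preimage hO isOpen_Ioi
  have h0 : volume (O ∩ (fun z => v z - w z) ⁻¹' (Ioi 0)) = 0 := by
    rw [ae_restrict_iff' hO.measurableSet] at h
    refine measure_mono_null ?_ (ae_iff.1 h)
    rintro z ⟨hz, hz'⟩ hc
    have := hc hz
    simp at hz'
    linarith
  have h0' := (ho.measure_eq_zero_iff (μ := volume)).1 h0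
  intro z hz
  by_contra hc
  push Not at hc
  have : z ∈ O ∩ (fun z => v z - w z) ⁻¹' (Ioi 0) := ⟨hz, by simpa using hc⟩
  rw [h0'] at this
  exact this

theorem exp_mono_bound {M M' N N' : ℝ} (h : M ≤ M') (h' : N ≤ N') (hN : 0 ≤ N)
    {z : ℝ × ℝ} (hz : 0 ≤ z.2) :
    1 + exp (M * z.2) + exp (N * z.1) ≤ 2 * VV M' N' z := by
  have h1 : exp (M * z.2) ≤ exp (M' * z.2) := exp_le_exp.2 (mul_le_mul_of_nonneg_right h hz)
  have h2 : exp (N * z.1) ≤ 1 + exp (N' * z.1) := by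
    rcases le_total 0 z.1 with hx | hx
    · have : exp (N * z.1) ≤ exp (N' * z.1) := exp_le_exp.2 (mul_le_mul_of_nonneg_right h' hx)
      linarith
    · have : exp (N * z.1) ≤ 1 := exp_le_one_iff.2 (mul_nonpos_of_nonneg_of_nonpos hN hx)
      linarith [exp_pos (N' * z.1)]
  rw [VV]
  linarith [exp_pos (M' * z.2), exp_pos (N' * z.1)]

theorem extend_g {Γ : Set (ℝ × ℝ)} (hΓ : IsClosed Γ) {g V : ℝ × ℝ → ℝ} {C : ℝ} (hC : 0 ≤ C)
    (hg : ContinuousOn g Γ) (hV : Continuous V) (hV1 : ∀ z, 1 ≤ V z)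
    (hb : ∀ z ∈ Γ, |g z| ≤ C * V z) :
    ∃ G : ℝ × ℝ → ℝ, Continuous G ∧ (∀ z ∈ Γ, G z = g z) ∧ ∀ z, |G z| ≤ C * V z := by
  have hVp : ∀ z, 0 < V z := fun z => by linarith [hV1 z]
  have hVn : ∀ z, V z ≠ 0 := fun z => (hVp z).ne'
  have hc : ContinuousOn (fun z => g z / V z) Γ := hg.div hV.continuousOn fun z _ => hVn z
  obtain ⟨F, hF, hF'⟩ := ContinuousMap.exists_restrict_eq_forall_mem_of_closed
    (⟨fun z : Γ => g z / V z, continuousOn_iff_continuous_domRestrict.1 hc⟩ : C(Γ, ℝ)) (t := Icc (-C) C)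
    (by
      rintro ⟨z, hz⟩
      show g z / V z ∈ Icc (-C) C
      rw [mem_Icc]
      rw [← abs_le, abs_div, abs_of_pos (hVp z), div_le_iff₀ (hVp z)]
      exact hb z hz) ⟨0, by simp [hC]⟩ hΓ
  refine ⟨fun z => F z * V z, F.continuous.mul hV, ?_, ?_⟩
  · intro z hz
    have h3 : F z = g z / V z := congrArg (fun h : C(Γ, ℝ) => h ⟨z, hz⟩) hF'
    show F z * V z = g z
    rw [h3, div_mul_cancel₀ _ (hVn z)]
  · intro z
    rw [abs_mul, abs_of_pos (hVp z)]
    exact mul_le_mul_of_nonneg_right (abs_le.2 (hF z)) (hVp z).le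

theorem locHolderOn_congr {α : ℝ} {O : Set (ℝ × ℝ)} {u v : ℝ × ℝ → ℝ} (h : ∀ z ∈ O, u z = v z)
    (hv : locHolderOn α O v) : locHolderOn α O u := by
  intro K hK hKO
  obtain ⟨C, hC⟩ := hv K hK hKO
  refine ⟨C, fun z hz w hw => ?_⟩
  rw [h z (hKO hz), h w (hKO hw)]
  exact hC z hz w hw

theorem C2alphaOn_congr {α : ℝ} {O : Set (ℝ × ℝ)} (hO : IsOpen O) {u v : ℝ × ℝ → ℝ}
    (h : ∀ z ∈ O, u z = v z) (hv : C2alphaOn α O v) : C2alphaOn α O u := by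
  have e : ∀ z ∈ O, u =ᶠ[𝓝 z] v := fun z hz => by
    filter_upwards [hO.mem_nhds hz] with w hw using h w hw
  refine ⟨hv.1.congr h, locHolderOn_congr h hv.2.1, fun a => ?_, fun a b => ?_⟩
  · exact locHolderOn_congr (fun z hz => dd_congr (v := a) (e z hz)) (hv.2.2.1 a)
  · exact locHolderOn_congr (fun z hz => dd_congr (v := b) (dd_congr' (v := a) (e z hz)))
      (hv.2.2.2 a b)

theorem super_const {σ ρ κ θ q r : ℝ} {O : Set (ℝ × ℝ)} {V f G : ℝ × ℝ → ℝ}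
    (hV : ContDiff ℝ ∞ V) (hV1 : ∀ z, 1 ≤ V z)
    {c0 Cf CG C1 : ℝ} (hVA : ∀ z ∈ O, c0 * V z ≤ hestonA σ ρ κ θ q r V z)
    (hf : ∀ z ∈ O, f z ≤ Cf * V z) (hGb : ∀ z, G z ≤ CG * V z)
    (h0 : 0 ≤ C1) (h1 : Cf + 1 ≤ C1 * c0) (h2 : CG + 1 ≤ C1) :
    Super σ ρ κ θ q r O V f G (fun z => C1 * V z) := by
  refine ⟨contDiff_const.mul hV, fun z hz => ?_, fun z hz => ?_, C1, fun z hz => ?_⟩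
  · have e := hestonA_lin σ ρ κ θ q r C1 0 hV hV z
    simp only [zero_mul, add_zero] at e
    rw [e]
    have a1 := mul_le_mul_of_nonneg_left (hVA z hz) h0
    have a2 := mul_le_mul_of_nonneg_right h1 (by linarith [hV1 z] : 0 ≤ V z)
    have a3 := hf z hz
    have a4 := hV1 z
    nlinarith
  · have a2 := mul_le_mul_of_nonneg_right h2 (by linarith [hV1 z] : 0 ≤ V z)
    have a4 := hV1 z
    have a3 := hGb z
    linarith
  · rw [abs_of_nonneg]
    exact mul_nonneg h0 (by linarith [hV1 z])

theorem growth_bound {O : Set (ℝ × ℝ)} {C M M' N N' : ℝ} (hC : 0 < C) (h : M ≤ M') (h' : N ≤ N')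
    (hN : 0 ≤ N) (hO : ∀ z ∈ O, 0 ≤ z.2) {f : ℝ × ℝ → ℝ}
    (hf : ∀ z ∈ O, |f z| ≤ C * (1 + exp (M * z.2) + exp (N * z.1))) :
    ∀ z ∈ O, |f z| ≤ (2 * C) * VV M' N' z := by
  intro z hz
  have := mul_le_mul_of_nonneg_left (exp_mono_bound h h' hN (hO z hz)) hC.le
  linarith [hf z hz]

theorem heston_main
    (σ ρ κ θ q r : ℝ) (hσ : σ ≠ 0) (hρ₁ : -1 < ρ) (hρ₂ : ρ < 1)
    (hκ : 0 < κ) (hθ : 0 < θ) (hr : 0 < r) (hq : 0 ≤ q)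
    (O : Set (ℝ × ℝ)) (hO : IsOpen O) (hOsub : O ⊆ HH)
    (hsphere : extSphere O (Gamma1 O))
    (α : ℝ) (hα₀ : 0 < α) (hα₁ : α < 1)
    (f g : ℝ × ℝ → ℝ)
    (hf : locHolderOn α O f) (hfg : ellGrowth σ κ θ r O f)
    (hg : ContinuousOn g (closure (Gamma1 O)))
    (hgg : ellGrowth σ κ θ r (closure (Gamma1 O)) g) :
    ∃ u : ℝ × ℝ → ℝ, ContinuousOn u (O ∪ Gamma1 O) ∧ C2alphaOn α O u ∧
      ellGrowth σ κ θ r O u ∧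
      (∀ z ∈ O, hestonA σ ρ κ θ q r u z = f z) ∧
      (∀ z ∈ Gamma1 O, u z = g z) := by
  classical
  obtain ⟨C, M, N, hC, hM, hM', hN, hN', hfb⟩ := hfg
  obtain ⟨D, P, Q, hD, hP, hP', hQ, hQ', hgb⟩ := hgg
  obtain ⟨M₁, hM₁⟩ : ∃ m, m = max M P := ⟨_, rfl⟩
  obtain ⟨M₂, hM₂⟩ : ∃ m, m = max N Q := ⟨_, rfl⟩
  have e1 : M ≤ M₁ := hM₁ ▸ le_max_left _ _
  have e2 : P ≤ M₁ := hM₁ ▸ le_max_right _ _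
  have e3 : N ≤ M₂ := hM₂ ▸ le_max_left _ _
  have e4 : Q ≤ M₂ := hM₂ ▸ le_max_right _ _
  have e5 : M₁ < min (r / (κ * θ)) (2 * κ / σ ^ 2) := hM₁ ▸ max_lt hM' hP'
  have e6 : M₂ < 1 := hM₂ ▸ max_lt hN' hQ'
  obtain ⟨c0, hc0, hVA'⟩ := VV_super ρ hσ hκ hθ hr hq (hM.trans e1) e5 (hN.trans e3) e6
  have hfb' := growth_bound hC e1 e3 hN (fun z hz => (hOsub hz).le) hfb
  have hcl : ∀ z ∈ closure (Gamma1 O), 0 ≤ z.2 := by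
    intro z hz
    have hc : IsClosed {z : ℝ × ℝ | 0 ≤ z.2} := isClosed_le continuous_const continuous_snd
    have hs : Gamma1 O ⊆ {z : ℝ × ℝ | 0 ≤ z.2} := by
      intro w hw
      have hw2 : (0 : ℝ) < w.2 := hw.2
      exact hw2.le
    exact closure_minimal hs hc hz
  have hgb' := growth_bound hD e2 e4 hQ hcl hgb
  have hV : ContDiff ℝ ∞ (VV M₁ M₂) := VV_smooth _ _
  have hV1 : ∀ z, 1 ≤ VV M₁ M₂ z := VV_ge _ _
  have hVV : ∀ z, VV M₁ M₂ z = 1 + exp (M₁ * z.2) + exp (M₂ * z.1) := fun z => rfl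
  generalize VV M₁ M₂ = V at *
  have hVA : ∀ z ∈ O, c0 * V z ≤ hestonA σ ρ κ θ q r V z := fun z hz => hVA' z (hOsub hz)
  obtain ⟨G, hGc, hGg, hGb⟩ := extend_g isClosed_closure (by positivity : 0 ≤ 2 * D) hg
    hV.continuous hV1 hgb'
  obtain ⟨C1, hC1⟩ : ∃ c, c = (2 * C + 1) / c0 + 2 * D + 1 := ⟨_, rfl⟩
  have hC1p : 0 < C1 := by rw [hC1]; positivity
  have k1 : 2 * C + 1 ≤ C1 * c0 := by
    have : (2 * C + 1) / c0 * c0 = 2 * C + 1 := div_mul_cancel₀ _ hc0.ne'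
    have h2 : 0 ≤ (2 * D + 1) * c0 := by positivity
    rw [hC1]; linarith
  have k2 : 2 * D + 1 ≤ C1 := by
    have : 0 ≤ (2 * C + 1) / c0 := by positivity
    rw [hC1]; linarith
  have f1 : ∀ z ∈ O, f z ≤ 2 * C * V z := fun z hz => (le_abs_self _).trans (hfb' z hz)
  have f2 : ∀ z ∈ O, -f z ≤ 2 * C * V z := fun z hz => (neg_le_abs _).trans (hfb' z hz)
  have g1 : ∀ z, G z ≤ 2 * D * V z := fun z => (le_abs_self _).trans (hGb z)
  have g2 : ∀ z, -G z ≤ 2 * D * V z := fun z => (neg_le_abs _).trans (hGb z)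
  have s1 : Super σ ρ κ θ q r O V f G (fun z => C1 * V z) :=
    super_const hV hV1 hVA f1 g1 hC1p.le k1 k2
  have s2 : Super σ ρ κ θ q r O V (fun z => -f z) (fun z => -G z) (fun z => C1 * V z) :=
    super_const hV hV1 hVA f2 g2 hC1p.le k1 k2
  obtain ⟨u, hu, hub, huw, hup, hum⟩ := weak_exists hρ₁ hρ₂ hr hO hOsub hc0 hV hV1 hVA
    (locHolder_cont hα₀ hO hf) s1 s2
  obtain ⟨v, huv, hvc, hv2, hvA⟩ := regularity hσ hρ₁ hρ₂ hα₀ hα₁ hO hOsub hf hu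
    (continuous_const.mul hV.continuous) hub huw
  have huv' : u =ᵐ[volume.restrict O] v := ae_restrict_of_ae huv
  have hvp : ∀ w, Super σ ρ κ θ q r O V f G w → ∀ z ∈ O, v z ≤ w z := by
    intro w hw
    apply ae_le_imp hO hvc hw.smooth.continuous.continuousOn
    filter_upwards [huv', hup w hw] with z h1 h2
    rw [← h1]; exact h2
  have hvm : ∀ w, Super σ ρ κ θ q r O V (fun z => -f z) (fun z => -G z) w →
      ∀ z ∈ O, -w z ≤ v z := by
    intro w hw
    apply ae_le_imp hO hw.smooth.continuous.neg.continuousOn hvc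
    filter_upwards [huv', hum w hw] with z h1 h2
    rw [← h1]; exact h2
  have hdisj : ∀ z ∈ Gamma1 O, z ∉ O := by
    intro z hz hzO
    have := hz.1
    rw [hO.frontier_eq] at this
    exact this.2 hzO
  have hUO : ∀ z ∈ O, (fun z => if z ∈ O then v z else g z) z = v z := fun z hz => by simp [hz]
  have hUG : ∀ z ∈ Gamma1 O, (fun z => if z ∈ O then v z else g z) z = g z :=
    fun z hz => by simp [hdisj z hz]
  generalize (fun z => if z ∈ O then v z else g z) = U at hUO hUG
  have hUe : ∀ z ∈ O, U =ᶠ[𝓝 z] v := fun z hz => by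
    filter_upwards [hO.mem_nhds hz] with w hw using hUO w hw
  refine ⟨U, ?_, C2alphaOn_congr hO hUO hv2, ⟨C1, M₁, M₂, hC1p, hM.trans e1, e5, hN.trans e3, e6, ?_⟩,
    fun z hz => ?_, hUG⟩
  · rintro z₀ (hz | hz)
    · have h1 : ContinuousAt v z₀ := hvc.continuousAt (hO.mem_nhds hz)
      exact (h1.congr (hUe z₀ hz).symm).continuousWithinAt
    · rw [ContinuousWithinAt, Metric.tendsto_nhds]
      intro ε hε
      have hε' : 0 < min (ε / 2) (1 / 2) := by positivity
      have hε1 : min (ε / 2) (1 / 2) < 1 := (min_le_right _ _).trans_lt (by norm_num)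
      have hε2 : min (ε / 2) (1 / 2) ≤ ε / 2 := min_le_left _ _
      obtain ⟨w, hw, hw0⟩ := barrier hσ hρ₁ hρ₂ hκ hr hO hOsub hsphere hV hV1 hVA f1 hGc g1
        hC1p.le k1 k2 hz hε' hε1
      obtain ⟨y, hy, hy0⟩ := barrier hσ hρ₁ hρ₂ hκ hr hO hOsub hsphere hV hV1 hVA f2 hGc.neg g2
        hC1p.le k1 k2 hz hε' hε1
      have hg0 : U z₀ = G z₀ := by rw [hUG z₀ hz, hGg z₀ (subset_closure hz)]
      have n1 : ∀ᶠ z in 𝓝 z₀, w z < G z₀ + ε :=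
        hw.smooth.continuous.continuousAt.eventually_lt continuousAt_const (by rw [hw0]; linarith)
      have n2 : ∀ᶠ z in 𝓝 z₀, y z < -G z₀ + ε :=
        hy.smooth.continuous.continuousAt.eventually_lt continuousAt_const (by rw [hy0, Pi.neg_apply]; linarith)
      have n3 : ∀ᶠ z in 𝓝 z₀, dist (G z) (G z₀) < ε := Metric.tendsto_nhds.1 hGc.continuousAt ε hε
      filter_upwards [nhdsWithin_le_nhds n1, nhdsWithin_le_nhds n2, nhdsWithin_le_nhds n3,
        self_mem_nhdsWithin] with z m1 m2 m3 m4
      rw [hg0]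
      rcases m4 with hzO | hzG
      · rw [hUO z hzO, Real.dist_eq, abs_lt]
        have := hvp w hw z hzO
        have := hvm y hy z hzO
        constructor <;> linarith
      · rw [hUG z hzG, ← hGg z (subset_closure hzG)]
        exact m3
  · intro z hz
    rw [hUO z hz, ← hVV, abs_le]
    exact ⟨hvm _ s2 z hz, hvp _ s1 z hz⟩
  · rw [hestonA_congr (hUe z hz)]
    exact hvA z hz

end HestonHelpers

/-- Existence of solutions to the elliptic Heston boundary value problem with continuous
Dirichlet boundary data, when `β ≥ 1`. -/
theorem heston_elliptic_bvp_existence_beta_ge_one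
    (σ ρ κ θ q r : ℝ) (hσ : σ ≠ 0) (hρ₁ : -1 < ρ) (hρ₂ : ρ < 1)
    (hκ : 0 < κ) (hθ : 0 < θ) (hr : 0 < r) (hq : 0 ≤ q)
    (hβ : 1 ≤ 2 * κ * θ / σ ^ 2)
    (O : Set (ℝ × ℝ)) (hO : IsOpen O) (hOconn : IsConnected O) (hOsub : O ⊆ HH)
    (hΓ₀ : (Gamma0 O).Nonempty)
    (hsphere : extSphere O (Gamma1 O))
    (α : ℝ) (hα₀ : 0 < α) (hα₁ : α < 1)
    (f g : ℝ × ℝ → ℝ)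
    (hf : locHolderOn α O f) (hfg : ellGrowth σ κ θ r O f)
    (hg : ContinuousOn g (closure (Gamma1 O)))
    (hgg : ellGrowth σ κ θ r (closure (Gamma1 O)) g) :
    ∃ u : ℝ × ℝ → ℝ, ContinuousOn u (O ∪ Gamma1 O) ∧ C2alphaOn α O u ∧
      ellGrowth σ κ θ r O u ∧
      (∀ z ∈ O, hestonA σ ρ κ θ q r u z = f z) ∧
      (∀ z ∈ Gamma1 O, u z = g z) := by
  exact heston_main σ ρ κ θ q r hσ hρ₁ hρ₂ hκ hθ hr hq O hO hOsub hsphere α hα₀ hα₁ f g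
    hf hfg hg hgg

end
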